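/- There exists no smooth function I : T*U → ℝ which is polynomial in momenta of degree ≤ 7 such that the four functions H, p_φ, p_t, I are functionally independent and pairwise Poisson-commute. -/

import Mathlib

open Real Finset

noncomputable section

/-- A phase-space point `(x, y, φ, t, p_x, p_y, p_φ, p_t)` of `T*U ⊂ ℝ⁴ × ℝ⁴`. -/
abbrev PhasePt := Fin 8 → ℝ

/-- The phase space `T*U` over `U = {x > 1, -1 < y < 1}`. -/
def TStar : Set PhasePt := {z | 1 < z 0 ∧ -1 < z 1 ∧ z 1 < 1}

/-- The base domain `U`. -/
def Ubase : Set (Fin 4 → ℝ) := {w | 1 < w 0 ∧ -1 < w 1 ∧ w 1 < 1}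

/-- Projection to the base coordinates `(x, y, φ, t)`. -/
def basePt (z : PhasePt) : Fin 4 → ℝ := fun q => z ⟨q.1, by omega⟩

/-- Partial derivative in the `i`-th coordinate. -/
def pd (i : Fin 8) (f : PhasePt → ℝ) (z : PhasePt) : ℝ :=
  fderiv ℝ f z (Pi.single i 1)

/-- The canonical Poisson bracket on `T*U`. -/
def pois (f g : PhasePt → ℝ) (z : PhasePt) : ℝ :=
    (pd 0 f z * pd 4 g z - pd 4 f z * pd 0 g z)
  + (pd 1 f z * pd 5 g z - pd 5 f z * pd 1 g z)
  + (pd 2 f z * pd 6 g z - pd 6 f z * pd 2 g z)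
  + (pd 3 f z * pd 7 g z - pd 7 f z * pd 3 g z)

/-- The geodesic Hamiltonian of the Zipoy-Voorhees metric with parameter `δ = 2`. -/
def Ham (z : PhasePt) : ℝ :=
  (1/2) * ( (((z 0)^2 - 1) * (z 4)^2 + (1 - (z 1)^2) * (z 5)^2)
      / ((((z 0 + 1)/(z 0 - 1))^2) * (((z 0)^2 - 1)^4 / ((z 0)^2 - (z 1)^2)^3))
    + (z 6)^2 / ((((z 0 + 1)/(z 0 - 1))^2) * (((z 0)^2 - 1) * (1 - (z 1)^2)))
    - ((z 0 + 1)/(z 0 - 1))^2 * (z 7)^2 )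

/-- The momentum `p_φ`. -/
def Pphi (z : PhasePt) : ℝ := z 6

/-- The momentum `p_t`. -/
def Ptm (z : PhasePt) : ℝ := z 7

/-- `I` is polynomial in momenta of degree `≤ d`, with smooth coefficients. -/
def IsPolyMom (d : ℕ) (I : PhasePt → ℝ) : Prop :=
  ∃ c : ℕ → ℕ → ℕ → ℕ → ((Fin 4 → ℝ) → ℝ),
    (∀ i j k m, ContDiffOn ℝ (⊤ : ℕ∞) (c i j k m) Ubase) ∧
    ∀ z ∈ TStar, I z =
      ∑ i ∈ Finset.range (d+1), ∑ j ∈ Finset.range (d+1),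
      ∑ k ∈ Finset.range (d+1), ∑ m ∈ Finset.range (d+1),
        (if i + j + k + m ≤ d then
          c i j k m (basePt z) * (z 4)^i * (z 5)^j * (z 6)^k * (z 7)^m else 0)

/-- `I` is a homogeneous polynomial in momenta of degree `d`, with smooth coefficients. -/
def IsHomPolyMom (d : ℕ) (I : PhasePt → ℝ) : Prop :=
  ∃ c : ℕ → ℕ → ℕ → ℕ → ((Fin 4 → ℝ) → ℝ),
    (∀ i j k m, ContDiffOn ℝ (⊤ : ℕ∞) (c i j k m) Ubase) ∧
    ∀ z ∈ TStar, I z =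
      ∑ i ∈ Finset.range (d+1), ∑ j ∈ Finset.range (d+1),
      ∑ k ∈ Finset.range (d+1), ∑ m ∈ Finset.range (d+1),
        (if i + j + k + m = d then
          c i j k m (basePt z) * (z 4)^i * (z 5)^j * (z 6)^k * (z 7)^m else 0)

/-- Functional independence: the differentials are linearly independent at every point
of a dense subset of `T*U`. -/
def FunIndep (f₁ f₂ f₃ f₄ : PhasePt → ℝ) : Prop :=
  ∃ S : Set PhasePt, S ⊆ TStar ∧ TStar ⊆ closure S ∧
    ∀ z ∈ S, LinearIndependent ℝ
      ![fderiv ℝ f₁ z, fderiv ℝ f₂ z, fderiv ℝ f₃ z, fderiv ℝ f₄ z]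


namespace ZV
open PowerSeries

/-- double power series: outer variable S, inner variable T -/
abbrev FF := PowerSeries (PowerSeries ℂ)

/-- derivative in S -/
def dS (f : FF) : FF := PowerSeries.derivative (PowerSeries ℂ) f

/-- derivative in T, coefficientwise -/
def dT (f : FF) : FF := PowerSeries.mk fun i => PowerSeries.derivative ℂ (coeff i f)

/-- series in S only -/
def iot : PowerSeries ℂ →+* FF := PowerSeries.map (PowerSeries.C (R := ℂ))

theorem coeff_dT (i : ℕ) (f : FF) : coeff i (dT f) = PowerSeries.derivative ℂ (coeff i f) := by
  simp [dT]

theorem coeff_dS (i : ℕ) (f : FF) : coeff i (dS f) = coeff (i+1) f * ((i : PowerSeries ℂ) + 1) := by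
  simp [dS, PowerSeries.coeff_derivative]

theorem dT_add (f g : FF) : dT (f + g) = dT f + dT g := by
  ext1 i; simp [coeff_dT]
theorem dT_neg (f : FF) : dT (-f) = -dT f := by
  ext1 i; simp [coeff_dT]
theorem dT_sub (f g : FF) : dT (f - g) = dT f - dT g := by
  ext1 i; simp [coeff_dT]
theorem dT_zero : dT 0 = 0 := by
  ext1 i; simp [coeff_dT]
theorem dT_sum {ι : Type*} (s : Finset ι) (f : ι → FF) : dT (∑ l ∈ s, f l) = ∑ l ∈ s, dT (f l) := by
  classical
  induction s using Finset.induction_on with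
  | empty => simp [dT_zero]
  | insert a s ha ih => simp [Finset.sum_insert ha, dT_add, ih]
theorem dT_mul (f g : FF) : dT (f * g) = dT f * g + f * dT g := by
  ext1 i
  rw [coeff_dT, map_add, coeff_mul, coeff_mul, coeff_mul, map_sum, ← Finset.sum_add_distrib]
  refine Finset.sum_congr rfl fun p _ => ?_
  rw [Derivation.leibniz, coeff_dT, coeff_dT]
  simp only [smul_eq_mul]; ring
theorem dT_iot (f : PowerSeries ℂ) : dT (iot f) = 0 := by
  ext1 i; simp [coeff_dT, iot]
theorem dT_C (f : PowerSeries ℂ) : dT (C f) = C (PowerSeries.derivative ℂ f) := by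
  ext1 i; rw [coeff_dT, coeff_C, coeff_C]; split_ifs <;> simp
theorem dS_C (f : PowerSeries ℂ) : dS (C f) = 0 := by
  simp [dS]
theorem dS_iot (f : PowerSeries ℂ) : dS (iot f) = iot (PowerSeries.derivative ℂ f) := by
  ext1 i; rw [coeff_dS]; simp [iot, PowerSeries.coeff_derivative]
theorem dS_add (f g : FF) : dS (f + g) = dS f + dS g := by simp [dS]
theorem dS_sub (f g : FF) : dS (f - g) = dS f - dS g := by simp [dS]
theorem dS_mul (f g : FF) : dS (f * g) = dS f * g + f * dS g := by
  simp [dS]; ring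
theorem dS_sum {ι : Type*} (s : Finset ι) (f : ι → FF) : dS (∑ l ∈ s, f l) = ∑ l ∈ s, dS (f l) := by
  simp [dS]

theorem der_eq_zero (f : PowerSeries ℂ) (h : PowerSeries.derivative ℂ f = 0) :
    f = C (constantCoeff f) := by
  apply PowerSeries.derivative.ext
  · simp [h]
  · simp

theorem eq_iot_of_dT (f : FF) (h : dT f = 0) : ∃ g, f = iot g := by
  refine ⟨PowerSeries.mk fun i => constantCoeff (coeff i f), ?_⟩
  ext1 i
  have : PowerSeries.derivative ℂ (coeff i f) = 0 := by rw [← coeff_dT, h]; simp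
  rw [der_eq_zero _ this]; simp [iot]

theorem iot_inj : Function.Injective iot := by
  intro a b h
  ext i
  have := congrArg (fun f => constantCoeff (coeff i f)) h
  simpa [iot] using this

/-- operator `V ∂_S + c V_S` -/
def LV (V : FF) (c : ℤ) (f : FF) : FF := V * dS f + (c : FF) * (dS V * f)

theorem LV_sub (V c f g) : LV V c (f - g) = LV V c f - LV V c g := by
  simp only [LV, dS_sub]; ring
theorem LV_zero (V c) : LV V c 0 = 0 := by
  simp [LV, dS]

/-- Solutions, indexed from the top index `m` downwards. -/
structure Sol (V : FF) (m : ℤ) (B : ℕ → FF) : Prop where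
  h0 : dT (B 0) = 0
  h1 : dT (B 1) = 0
  h2 : ∀ k, dT (B (k+2)) + LV V (m - k) (B k) = 0

/-- the monodromy datum -/
structure Mono (V : FF) (ρ : PowerSeries ℂ) (L : Subalgebra ℂ (PowerSeries ℂ × PowerSeries ℂ)) : Prop where
  prim : ∀ a b, (PowerSeries.derivative ℂ a, b) ∈ L → ∃ a', PowerSeries.derivative ℂ a' = b ∧ (a, a') ∈ L
  sep : ∀ b, ((0 : PowerSeries ℂ), b) ∈ L → b = 0
  dat : ∃ (u h : Fin 17 → PowerSeries ℂ) (j : Fin 17 → ℂ),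
    V = ∑ l, iot (u l) * C (PowerSeries.derivative ℂ (h l)) ∧
    (∀ l, (PowerSeries.derivative ℂ (h l), PowerSeries.derivative ℂ (h l)) ∈ L) ∧
    (∀ l, (h l, h l + C (j l)) ∈ L) ∧ ρ = ∑ l, C (j l) * u l

section mono
variable {V : FF} {ρ : PowerSeries ℂ} {L : Subalgebra ℂ (PowerSeries ℂ × PowerSeries ℂ)}

/-- lifted relation -/
def LL (L : Subalgebra ℂ (PowerSeries ℂ × PowerSeries ℂ)) (a b : FF) : Prop :=
  ∀ i, (coeff i a, coeff i b) ∈ L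

theorem LL_add {a b c d : FF} (h : LL L a b) (h' : LL L c d) : LL L (a + c) (b + d) := fun i => by
  have := L.add_mem (h i) (h' i); simpa using this
theorem LL_mul {a b c d : FF} (h : LL L a b) (h' : LL L c d) : LL L (a * c) (b * d) := fun i => by
  rw [coeff_mul, coeff_mul]
  have : ∑ p ∈ antidiagonal i, ((coeff p.1 a, coeff p.1 b) * (coeff p.2 c, coeff p.2 d)) ∈ L :=
    L.sum_mem fun p _ => L.mul_mem (h _) (h' _)
  convert this using 1
  ext1 <;> simp [Prod.fst_sum, Prod.snd_sum]
theorem LL_sum {ι : Type*} (s : Finset ι) (f g : ι → FF) (h : ∀ l ∈ s, LL L (f l) (g l)) :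
    LL L (∑ l ∈ s, f l) (∑ l ∈ s, g l) := fun i => by
  have : ∑ l ∈ s, (coeff i (f l), coeff i (g l)) ∈ L :=
    L.sum_mem fun p hp => h p hp i
  convert this using 1
  ext1 <;> simp [Prod.fst_sum, Prod.snd_sum]
theorem LL_iot (a : PowerSeries ℂ) : LL L (iot a) (iot a) := fun i => by
  have := L.algebraMap_mem (coeff i a)
  simpa [iot, Prod.algebraMap_apply] using this
theorem LL_C {a b : PowerSeries ℂ} (h : (a, b) ∈ L) : LL L (C a) (C b) := fun i => by
  rw [coeff_C, coeff_C]; split_ifs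
  · exact h
  · exact L.zero_mem
theorem LL_int (c : ℤ) : LL L (c : FF) (c : FF) := by
  have := LL_iot (L := L) (c : PowerSeries ℂ)
  simpa using this
theorem LL_dS {a b : FF} (h : LL L a b) : LL L (dS a) (dS b) := fun i => by
  rw [coeff_dS, coeff_dS]
  have := L.mul_mem (h (i+1)) (L.algebraMap_mem ((i:ℂ)+1))
  simpa [Prod.algebraMap_apply] using this
theorem LL_neg {a b : FF} (h : LL L a b) : LL L (-a) (-b) := fun i => by
  have := L.neg_mem (h i); simpa using this


theorem LL_V (M : Mono V ρ L) : LL L V V := by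
  obtain ⟨u, h, j, hV, h1, h2, h3⟩ := M.dat
  rw [hV]
  exact LL_sum _ _ _ fun l _ => LL_mul (LL_iot _) (LL_C (h1 l))

theorem LL_LV (M : Mono V ρ L) {a b : FF} (c : ℤ) (h : LL L a b) : LL L (LV V c a) (LV V c b) :=
  LL_add (LL_mul (LL_V M) (LL_dS h)) (LL_mul (LL_int c) (LL_mul (LL_dS (LL_V M)) h))

theorem LL_prim (M : Mono V ρ L) {a b : FF} (h : LL L (dT a) b) : ∃ a', dT a' = b ∧ LL L a a' := by
  have : ∀ i, ∃ a', PowerSeries.derivative ℂ a' = coeff i b ∧ (coeff i a, a') ∈ L := fun i => by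
    apply M.prim
    have := h i
    rwa [coeff_dT] at this
  choose a' h1 h2 using this
  refine ⟨PowerSeries.mk a', ?_, fun i => by simpa using h2 i⟩
  ext1 i; simp [coeff_dT, h1]

theorem LL_sep (M : Mono V ρ L) {b : FF} (h : LL L 0 b) : b = 0 := by
  ext1 i
  rw [M.sep (coeff i b) (by simpa using h i)]; simp

theorem mono_step (M : Mono V ρ L) {m : ℤ} {B : ℕ → FF} (hB : Sol V m B) (k : ℕ) (b : FF) (hb : LL L (B k) b) :
    ∃ b', dT b' + LV V (m - k) b = 0 ∧ LL L (B (k+2)) b' := by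
  have h : LL L (dT (B (k+2))) (-LV V (m-k) b) := by
    rw [eq_neg_of_add_eq_zero_left (hB.h2 k)]
    exact LL_neg (LL_LV M _ hb)
  obtain ⟨a', h1, h2⟩ := LL_prim M h
  exact ⟨a', by rw [h1]; ring, h2⟩

theorem mono_step2 (M : Mono V ρ L) {m : ℤ} {B : ℕ → FF} (hB : Sol V m B) (α : PowerSeries ℂ) (hα : B 0 = iot α) :
    LL L (B 2) (B 2 - iot (ρ * PowerSeries.derivative ℂ α + m * (PowerSeries.derivative ℂ ρ * α))) := by
  obtain ⟨u, h, j, hV, h1, h2, h3⟩ := M.dat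
  set c : Fin 17 → PowerSeries ℂ := fun l => u l * PowerSeries.derivative ℂ α + m * (PowerSeries.derivative ℂ (u l) * α) with hc
  have e1 : LV V m (B 0) = ∑ l, iot (c l) * C (PowerSeries.derivative ℂ (h l)) := by
    rw [LV, hα, hV, dS_iot, dS_sum]
    simp only [dS_mul, dS_iot, dS_C, hc, map_add, map_mul, map_intCast, Finset.sum_mul, Finset.mul_sum, ← Finset.sum_add_distrib]
    refine Finset.sum_congr rfl fun l _ => ?_
    ring
  have e2 : dT (B 2 + ∑ l, iot (c l) * C (h l)) = 0 := by
    have := hB.h2 0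
    simp only [Nat.cast_zero, sub_zero, e1] at this
    rw [dT_add, dT_sum, ← this]
    simp [dT_mul, dT_iot, dT_C]
  obtain ⟨β, hβ⟩ := eq_iot_of_dT _ e2
  have e3 : B 2 = iot β + -∑ l, iot (c l) * C (h l) := by rw [← hβ]; ring
  have e4 : B 2 - iot (ρ * PowerSeries.derivative ℂ α + m * (PowerSeries.derivative ℂ ρ * α))
      = iot β + -∑ l, iot (c l) * C (h l + C (j l)) := by
    rw [e3, h3]
    have : ∀ x : ℂ, (C (C x : PowerSeries ℂ) : FF) = iot (C x) := by intro x; simp [iot]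
    simp only [map_add, mul_add, this, Finset.sum_add_distrib, ← map_mul, map_sum]
    rw [← map_sum iot, neg_add, ← add_assoc, sub_eq_add_neg, ← map_add, ← map_neg, ← map_neg]
    congr 2
    simp only [hc, Finset.sum_mul, Derivation.leibniz, PowerSeries.derivative_C, Finset.mul_sum, ← Finset.sum_add_distrib, smul_eq_mul]
    congr 1
    refine Finset.sum_congr rfl fun l _ => ?_
    ring
  rw [e4]
  nth_rewrite 1 [e3]
  exact LL_add (LL_iot _) (LL_neg (LL_sum _ _ _ fun l _ => LL_mul (LL_iot _) (LL_C (h2 l))))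

theorem mono_sol (M : Mono V ρ L) {m : ℤ} {B : ℕ → FF} (hB : Sol V m B) (α : PowerSeries ℂ) (hα : B 0 = iot α) :
    ∃ B' : ℕ → FF, Sol V m B' ∧ B' 0 = B 0 ∧ B' 1 = B 1 ∧
      B' 2 = B 2 - iot (ρ * PowerSeries.derivative ℂ α + m * (PowerSeries.derivative ℂ ρ * α)) ∧
      ∀ k, B k = 0 → B' k = 0 := by
  classical
  choose F hF1 hF2 using fun k b hb => mono_step M hB k b hb
  let B' : ℕ → FF := fun n => Nat.strongRec (motive := fun _ => FF) (fun n ih =>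
    match n, ih with
    | 0, _ => B 0
    | 1, _ => B 1
    | 2, _ => B 2 - iot (ρ * PowerSeries.derivative ℂ α + m * (PowerSeries.derivative ℂ ρ * α))
    | (k+3), ih => if hb : LL L (B (k+1)) (ih (k+1) (by omega)) then F (k+1) _ hb else 0) n
  have b0 : B' 0 = B 0 := by simp only [B']; rw [Nat.strongRec_eq]
  have b1 : B' 1 = B 1 := by simp only [B']; rw [Nat.strongRec_eq]
  have b2 : B' 2 = B 2 - iot (ρ * PowerSeries.derivative ℂ α + m * (PowerSeries.derivative ℂ ρ * α)) := by
    simp only [B']; rw [Nat.strongRec_eq]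
  have b3 : ∀ k, B' (k+3) = if hb : LL L (B (k+1)) (B' (k+1)) then F (k+1) _ hb else 0 := by
    intro k
    simp only [B']; rw [Nat.strongRec_eq]
  have hL : ∀ k, LL L (B k) (B' k) := by
    intro k
    induction k using Nat.strong_induction_on with
    | _ k ih =>
      match k, ih with
      | 0, _ =>
        rw [b0, hα]; exact LL_iot _
      | 1, _ =>
        obtain ⟨g, hg⟩ := eq_iot_of_dT _ hB.h1
        rw [b1, hg]; exact LL_iot _
      | 2, _ =>
        rw [b2]; exact mono_step2 M hB α hα
      | k+3, ih =>
        have := ih (k+1) (by omega)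
        rw [b3, dif_pos this]
        exact hF2 _ _ _
  refine ⟨B', ⟨by rw [b0]; exact hB.h0, by rw [b1]; exact hB.h1, ?_⟩, b0, b1, b2, ?_⟩
  · intro k
    match k with
    | 0 =>
      have := hB.h2 0
      rw [zero_add] at this ⊢
      rw [b0, b2, dT_sub, dT_iot, sub_zero]
      exact this
    | k+1 =>
      have := b3 k
      rw [dif_pos (hL (k+1))] at this
      rw [show k+1+2 = k+3 by ring, this]
      exact hF1 _ _ _
  · intro k hk
    have := hL k
    rw [hk] at this
    exact LL_sep M this

end mono
end ZV

namespace ZV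
section fm
open PowerSeries

/-- The final algebraic facts needed about the pair of monodromy functions. -/
def GoodPair (ρ₀ ρ₁ : PowerSeries ℂ) : Prop :=
  ∀ (m : ℤ) (α : PowerSeries ℂ) (κ₀ κ₁ : ℂ), (m ≠ 2 → κ₀ = 0 ∧ κ₁ = 0) →
    ρ₀ * PowerSeries.derivative ℂ α + m * (PowerSeries.derivative ℂ ρ₀ * α) = C κ₀ →
    ρ₁ * PowerSeries.derivative ℂ α + m * (PowerSeries.derivative ℂ ρ₁ * α) = C κ₁ →
    (m ≠ 0 → α = 0) ∧ (m = 0 → PowerSeries.derivative ℂ α = 0)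

theorem formal_main {V : FF} {ρ₀ ρ₁ : PowerSeries ℂ} {L₀ L₁} (M₀ : Mono V ρ₀ L₀) (M₁ : Mono V ρ₁ L₁)
    (G : GoodPair ρ₀ ρ₁) (n : ℕ) : ∀ (m : ℤ) (B : ℕ → FF), Sol V m B → (∀ k, n ≤ k → B k = 0) →
      (∀ k : ℕ, (k : ℤ) ≠ m → B k = 0) ∧ (∀ k : ℕ, (k : ℤ) = m → ∃ c : ℂ, B k = iot (C c)) := by
  induction n using Nat.strong_induction_on with
  | _ n ih =>
  intro m B hB hn
  rcases Nat.eq_zero_or_pos n with rfl | hpos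
  · refine ⟨fun k _ => hn k (Nat.zero_le _), fun k _ => ⟨0, by simp [hn k (Nat.zero_le _)]⟩⟩
  obtain ⟨α, hα⟩ := eq_iot_of_dT _ hB.h0
  have key : ∀ {ρ : PowerSeries ℂ} {L}, Mono V ρ L → ∃ κ : ℂ, (m ≠ 2 → κ = 0) ∧
      ρ * PowerSeries.derivative ℂ α + m * (PowerSeries.derivative ℂ ρ * α) = C κ := by
    intro ρ L M
    obtain ⟨B', hB', e0, e1, e2, e3⟩ := mono_sol M hB α hα
    have hD : Sol V (m - 2) (fun k => B (k+2) - B' (k+2)) := by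
      refine ⟨?_, ?_, ?_⟩
      · have h := hB.h2 0; have h' := hB'.h2 0
        rw [e0] at h'
        rw [dT_sub]
        linear_combination h - h'
      · have h := hB.h2 1; have h' := hB'.h2 1
        rw [e1] at h'
        rw [dT_sub]
        linear_combination h - h'
      · intro k
        have h := hB.h2 (k+2); have h' := hB'.h2 (k+2)
        have e : m - 2 - (k:ℤ) = m - ((k+2 : ℕ):ℤ) := by push_cast; ring
        rw [dT_sub, LV_sub, e]
        linear_combination h - h'
    have := ih (n-2) (by omega) (m-2) _ hD (fun k hk => by
      have h1 := hn (k+2) (by omega)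
      rw [e3 _ h1, h1, sub_zero])
    have e4 : B (0+2) - B' (0+2) = iot (ρ * PowerSeries.derivative ℂ α + m * (PowerSeries.derivative ℂ ρ * α)) := by
      rw [zero_add, e2]; ring
    by_cases hm : m = 2
    · obtain ⟨c, hc⟩ := this.2 0 (by simp [hm])
      refine ⟨c, fun h => absurd hm h, ?_⟩
      apply iot_inj
      rw [← e4, hc]
    · have hc := this.1 0 (by intro h; apply hm; push_cast at h; omega)
      refine ⟨0, fun h => rfl, ?_⟩
      apply iot_inj
      rw [← e4, hc]; simp
  obtain ⟨κ₀, h0, h0'⟩ := key M₀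
  obtain ⟨κ₁, h1, h1'⟩ := key M₁
  obtain ⟨g1, g2⟩ := G m α κ₀ κ₁ (fun h => ⟨h0 h, h1 h⟩) h0' h1'
  have hLV : LV V m (B 0) = 0 := by
    by_cases hm : m = 0
    · rw [hα, LV, dS_iot, g2 hm, hm]; simp
    · rw [hα, g1 hm, map_zero, LV_zero]
  have hS : Sol V (m-1) (fun k => B (k+1)) := by
    refine ⟨hB.h1, ?_, ?_⟩
    · have := hB.h2 0
      simp only [Nat.cast_zero, sub_zero, hLV, add_zero, zero_add] at this
      exact this
    · intro k
      have := hB.h2 (k+1)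
      have e : m - 1 - (k:ℤ) = m - ((k+1 : ℕ):ℤ) := by push_cast; ring
      rw [e]; exact this
  have hrec := ih (n-1) (by omega) (m-1) _ hS (fun k hk => hn _ (by omega))
  constructor
  · intro k hk
    cases k with
    | zero => rw [hα, g1 (by simpa using Ne.symm hk), map_zero]
    | succ k => exact hrec.1 k (by intro h; apply hk; push_cast; omega)
  · intro k hk
    cases k with
    | zero =>
      have := der_eq_zero α (g2 (by simpa using hk.symm))
      exact ⟨constantCoeff α, by rw [hα, ← this]⟩
    | succ k => exact hrec.2 k (by push_cast at hk; omega)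

end fm

section alg
open Polynomial

theorem eval_cond (z : ℂ) (hz : z^4 = 1) (a s₁ : ℂ[X]) (s₀ w Q : ℂ[X]) (κ₀ κ₁ : ℂ) (hs : s₀ = (X - Polynomial.C z)^2 * a)
    (ha : a.eval z ≠ 0) (hs1 : s₁.eval z ≠ 0)
    (hw : w = derivative s₀ * s₁ - derivative s₁ * s₀)
    (hQ : Q = Polynomial.C κ₀ * s₁ - Polynomial.C κ₁ * s₀)
    (hE : X * (X^4 - 1) * (derivative w * Q - 3 * w * derivative Q) + w * Q * (3 * (X^4-1) + 12 * X^4) = 0) :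
    κ₀ = 0 := by
  have hd := congrArg (fun p => (derivative p).eval z) hE
  have e0 : s₀.eval z = 0 := by simp [hs]
  have e1 : (derivative s₀).eval z = 0 := by simp [hs, derivative_mul, derivative_pow]
  have e2 : (derivative (derivative s₀)).eval z = 2 * a.eval z := by
    simp [hs, derivative_mul, derivative_pow]
  have w0 : w.eval z = 0 := by simp [hw, e0, e1]
  have w1 : (derivative w).eval z = 2 * a.eval z * s₁.eval z := by
    simp [hw, derivative_mul, e0, e1, e2]
  have q0 : Q.eval z = κ₀ * s₁.eval z := by simp [hQ, e0]
  simp [derivative_mul, derivative_pow, w0, hz, w1, q0] at hd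
  have hz3 : z * z^3 = 1 := by rw [← hz]; ring
  have : 32 * (a.eval z * (s₁.eval z)^2) * κ₀ = 0 := by
    linear_combination hd - 4 * (2 * a.eval z * s₁.eval z * (κ₀ * s₁.eval z)) * hz3
  have h3 : 32 * (a.eval z * (s₁.eval z)^2) ≠ 0 := mul_ne_zero (by norm_num) (mul_ne_zero ha (pow_ne_zero 2 hs1))
  exact (mul_eq_zero.mp this).resolve_left h3

/-- Taylor expansion of polynomials as power series at `z`. -/
def tayl (z : ℂ) : ℂ[X] →+* PowerSeries ℂ :=
  (Polynomial.coeToPowerSeries.ringHom).comp (Polynomial.taylorAlgHom z).toRingHom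

theorem tayl_inj (z : ℂ) : Function.Injective (tayl z) := by
  intro a b h
  have : (Polynomial.taylor z a : PowerSeries ℂ) = (Polynomial.taylor z b : PowerSeries ℂ) := h
  exact Polynomial.taylor_injective z (Polynomial.coe_injective ℂ this)

theorem tayl_der (z : ℂ) (p : ℂ[X]) : PowerSeries.derivative ℂ (tayl z p) = tayl z (Polynomial.derivative p) := by
  have h1 : ∀ p, tayl z p = (Polynomial.taylor z p : PowerSeries ℂ) := fun p => rfl
  rw [h1, h1, PowerSeries.derivative_coe]
  congr 1
  simp [Polynomial.taylor_apply, Polynomial.derivative_comp]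

theorem tayl_C (z c : ℂ) : tayl z (Polynomial.C c) = PowerSeries.C c := by
  have h1 : ∀ p, tayl z p = (Polynomial.taylor z p : PowerSeries ℂ) := fun p => rfl
  rw [h1]; simp

theorem tayl_X (z : ℂ) : tayl z Polynomial.X = PowerSeries.C z + PowerSeries.X := by
  have h1 : ∀ p, tayl z p = (Polynomial.taylor z p : PowerSeries ℂ) := fun p => rfl
  rw [h1]; simp [add_comm]

theorem good_pair (X0 : ℂ) (r : PowerSeries ℂ) (hr : r ≠ 0)
    (hr' : tayl X0 (X * (X^4-1)) * PowerSeries.derivative ℂ r = - (r * tayl X0 (3 * (X^4-1) + 12 * X^4)))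
    (s₀ s₁ a₀ a₁ : ℂ[X]) (z₀ z₁ : ℂ) (hz0 : z₀^4 = 1) (hz1 : z₁^4 = 1)
    (h0 : s₀ = (X - Polynomial.C z₀)^2 * a₀) (h1 : s₁ = (X - Polynomial.C z₁)^2 * a₁)
    (ha0 : a₀.eval z₀ ≠ 0) (ha1 : a₁.eval z₁ ≠ 0) (h01 : s₀.eval z₁ ≠ 0) (h10 : s₁.eval z₀ ≠ 0) :
    GoodPair (r * tayl X0 s₀) (r * tayl X0 s₁) := by
  intro m α κ₀ κ₁ hκ E0 E1
  set w := derivative s₀ * s₁ - derivative s₁ * s₀ with hw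
  have hwne : w ≠ 0 := by
    intro h
    have := congrArg (fun p => (derivative p).eval z₀) h
    have e0 : s₀.eval z₀ = 0 := by simp [h0]
    have e1 : (derivative s₀).eval z₀ = 0 := by simp [h0, derivative_mul, derivative_pow]
    have e2 : (derivative (derivative s₀)).eval z₀ = 2 * a₀.eval z₀ := by
      simp [h0, derivative_mul, derivative_pow]
    simp [hw, derivative_mul, e0, e1, e2, ha0, h10] at this
  have hTw : tayl X0 w ≠ 0 := fun h => hwne (tayl_inj X0 (by rw [h, map_zero]))
  have hs0 : tayl X0 s₀ ≠ 0 := fun h => h01 (by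
    have : s₀ = 0 := tayl_inj X0 (by rw [h, map_zero])
    rw [this]; simp)
  simp only [Derivation.leibniz, smul_eq_mul, tayl_der] at E0 E1
  have hTw' : tayl X0 w = tayl X0 (derivative s₀) * tayl X0 s₁ - tayl X0 (derivative s₁) * tayl X0 s₀ := by
    simp [hw]
  by_cases hm0 : m = 0
  · refine ⟨fun h => absurd hm0 h, fun _ => ?_⟩
    rw [hm0, (hκ (by omega)).1] at E0
    simp at E0
    rcases E0 with (h | h) | h
    · exact absurd h hr
    · exact absurd h hs0
    · exact h
  refine ⟨fun _ => ?_, fun h => absurd h hm0⟩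
  -- reduce to `κ = 0`
  have fin : κ₀ = 0 → κ₁ = 0 → α = 0 := by
    intro k0 k1
    rw [k0, map_zero] at E0
    rw [k1, map_zero] at E1
    have : (m : PowerSeries ℂ) * (r * (r * (tayl X0 w * α))) = 0 := by
      rw [hTw']
      linear_combination r * tayl X0 s₁ * E0 - r * tayl X0 s₀ * E1
    have hm : (m : PowerSeries ℂ) ≠ 0 := fun h => hm0 (by
      have := congrArg PowerSeries.constantCoeff h
      simpa using this)
    rcases mul_eq_zero.mp this with h | h
    · exact absurd h hm
    rcases mul_eq_zero.mp h with h | h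
    · exact absurd h hr
    rcases mul_eq_zero.mp h with h | h
    · exact absurd h hr
    rcases mul_eq_zero.mp h with h | h
    · exact absurd h hTw
    · exact h
  by_cases hm2 : m = 2
  swap
  · exact fin (hκ hm2).1 (hκ hm2).2
  rw [hm2] at E0 E1
  push_cast at E0 E1
  set Q := Polynomial.C κ₀ * s₁ - Polynomial.C κ₁ * s₀ with hQ
  have hTQ : tayl X0 Q = PowerSeries.C κ₀ * tayl X0 s₁ - PowerSeries.C κ₁ * tayl X0 s₀ := by
    simp [hQ, tayl_C]
  have hTQ' : tayl X0 (derivative Q) = PowerSeries.C κ₀ * tayl X0 (derivative s₁) - PowerSeries.C κ₁ * tayl X0 (derivative s₀) := by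
    simp [hQ, tayl_C]
  -- 2 α r w = Q
  have i1 : 2 * (r * tayl X0 w * α) = tayl X0 Q := by
    apply mul_left_cancel₀ hr
    rw [hTw', hTQ]
    linear_combination r * tayl X0 s₁ * E0 - r * tayl X0 s₀ * E1
  have i2 : r * (r * tayl X0 w * PowerSeries.derivative ℂ α) = - (r * tayl X0 (derivative Q) + PowerSeries.derivative ℂ r * tayl X0 Q) := by
    rw [hTw', hTQ, hTQ']
    linear_combination (-(r * tayl X0 (derivative s₁) + PowerSeries.derivative ℂ r * tayl X0 s₁)) * E0 + (r * tayl X0 (derivative s₀) + PowerSeries.derivative ℂ r * tayl X0 s₀) * E1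
  have i3 := congrArg (PowerSeries.derivative ℂ) i1
  have c2 : PowerSeries.derivative ℂ (2 : PowerSeries ℂ) = 0 := by
    have := (PowerSeries.derivative ℂ).map_natCast 2
    simpa using this
  simp only [Derivation.leibniz, smul_eq_mul, tayl_der, c2] at i3
  have i4 : r * (tayl X0 (derivative w) * tayl X0 Q - 3 * tayl X0 w * tayl X0 (derivative Q))
      = PowerSeries.derivative ℂ r * (tayl X0 w * tayl X0 Q) := by
    have h1 : r * tayl X0 (derivative w) * (2 * (r * tayl X0 w * α)) = r * tayl X0 (derivative w) * tayl X0 Q := by rw [i1]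
    have h2 : PowerSeries.derivative ℂ r * tayl X0 w * (2 * (r * tayl X0 w * α)) = PowerSeries.derivative ℂ r * tayl X0 w * tayl X0 Q := by rw [i1]
    linear_combination -h1 - h2 + r * tayl X0 w * i3 - 2 * tayl X0 w * i2
  have hE : X * (X^4 - 1) * (derivative w * Q - 3 * w * derivative Q) + w * Q * (3 * (X^4-1) + 12 * X^4) = 0 := by
    apply tayl_inj X0
    apply mul_left_cancel₀ hr
    have e3 : tayl X0 3 = 3 := map_ofNat (tayl X0) 3
    rw [map_zero, map_add, map_mul, map_mul _ (w*Q), map_mul _ w Q, map_sub, map_mul _ (derivative w), map_mul _ (3*w), map_mul _ 3, e3]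
    linear_combination tayl X0 (X * (X^4 - 1)) * i4 + (tayl X0 w * tayl X0 Q) * hr'
  have k0 : κ₀ = 0 := eval_cond z₀ hz0 a₀ s₁ s₀ w Q κ₀ κ₁ h0 ha0 h10 hw hQ hE
  have k1 : κ₁ = 0 := by
    refine eval_cond z₁ hz1 a₁ s₀ s₁ (-w) (-Q) κ₁ κ₀ h1 ha1 h01 (by rw [hw]; ring) (by rw [hQ]; ring) ?_
    have d1 : derivative (-w) = -derivative w := Polynomial.derivative_neg w
    have d2 : derivative (-Q) = -derivative Q := Polynomial.derivative_neg Q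
    rw [d1, d2]; linear_combination hE
  exact fin k0 k1

end alg
end ZV

namespace ZV
open scoped ContDiff
open TopologicalSpace

section sm
/-- extension by zero -/
def ext0 {Ω : Opens ℂ} (f : Ω → ℂ) : ℂ → ℂ := by
  classical
  exact fun z => if h : z ∈ Ω then f ⟨z, h⟩ else 0

theorem ext0_of_mem {Ω : Opens ℂ} (f : Ω → ℂ) (z : Ω) : ext0 f z = f z := by
  simp [ext0]

theorem ext0_eqOn {Ω : Opens ℂ} (F : ℂ → ℂ) : Set.EqOn (ext0 (fun z : Ω => F z)) F Ω := by
  intro z hz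
  exact ext0_of_mem (Ω := Ω) (fun z : Ω => F z) ⟨z, hz⟩

variable (𝕜 : Type) [NontriviallyNormedField 𝕜] [NormedAlgebra 𝕜 ℂ] (Ω : Opens ℂ)

/-- ring of smooth complex functions on `Ω` -/
def Sm : Subalgebra ℂ (Ω → ℂ) where
  carrier := {f | ContDiffOn 𝕜 ∞ (ext0 f) Ω}
  mul_mem' := by
    intro f g hf hg
    refine (ContDiffOn.mul hf hg).congr fun z hz => ?_
    have : z ∈ Ω := hz
    simp [ext0, this]
  add_mem' := by
    intro f g hf hg
    refine (ContDiffOn.add hf hg).congr fun z hz => ?_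
    have : z ∈ Ω := hz
    simp [ext0, this]
  algebraMap_mem' := by
    intro r
    refine (contDiffOn_const (c := r)).congr fun z hz => ?_
    have : z ∈ Ω := hz
    simp [ext0, this]

variable {𝕜 Ω}

/-- construct element from a function on `ℂ` -/
def Sm.of (F : ℂ → ℂ) (hF : ContDiffOn 𝕜 ∞ F Ω) : Sm 𝕜 Ω :=
  ⟨fun z => F z, hF.congr (ext0_eqOn F)⟩

theorem Sm.of_val (F : ℂ → ℂ) (hF : ContDiffOn 𝕜 ∞ F Ω) (z : Ω) : (Sm.of F hF).1 z = F z := rfl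

theorem Sm.ext {f g : Sm 𝕜 Ω} (h : ∀ z, f.1 z = g.1 z) : f = g := Subtype.ext (funext h)

theorem Sm.diffAt (f : Sm 𝕜 Ω) (z : Ω) : DifferentiableAt 𝕜 (ext0 f.1) z :=
  (f.2.contDiffAt (Ω.isOpen.mem_nhds z.2)).differentiableAt (by simp)

theorem Sm.fderiv_congr (f : Sm 𝕜 Ω) (F : ℂ → ℂ) (h : ∀ z : Ω, f.1 z = F z) (z : Ω) :
    fderiv 𝕜 (ext0 f.1) z = fderiv 𝕜 F z := by
  apply Filter.EventuallyEq.fderiv_eq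
  filter_upwards [Ω.isOpen.mem_nhds z.2] with w hw
  have := ext0_of_mem f.1 ⟨w, hw⟩
  rw [h] at this
  exact this

/-- directional derivative -/
def Sm.dir (v : ℂ) : Derivation ℂ (Sm 𝕜 Ω) (Sm 𝕜 Ω) :=
  Derivation.mk'
    { toFun := fun f => Sm.of (fun z => fderiv 𝕜 (ext0 f.1) z v)
        ((f.2.fderiv_of_isOpen Ω.isOpen (m := ∞) (by simp)).clm_apply contDiffOn_const)
      map_add' := by
        intro f g
        apply Sm.ext
        intro z
        have h : fderiv 𝕜 (ext0 (f+g).1) z = fderiv 𝕜 (ext0 f.1 + ext0 g.1) z :=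
          Sm.fderiv_congr _ _ (fun z => by simp [ext0_of_mem]) z
        have := fderiv_add (Sm.diffAt f z) (Sm.diffAt g z)
        simp only [Sm.of_val, Subalgebra.coe_add, Pi.add_apply] at h ⊢
        rw [h, this]; simp
      map_smul' := by
        intro c f
        apply Sm.ext
        intro z
        have h : fderiv 𝕜 (ext0 (c • f).1) z = fderiv 𝕜 (c • ext0 f.1) z :=
          Sm.fderiv_congr _ _ (fun z => by simp [ext0_of_mem]) z
        have := fderiv_const_smul (Sm.diffAt f z) c
        simp only [RingHom.id_apply, Sm.of_val, Subalgebra.coe_smul, Pi.smul_apply] at h ⊢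
        rw [h, this]; simp }
    (by
      intro f g
      apply Sm.ext
      intro z
      have h : fderiv 𝕜 (ext0 (f*g).1) z = fderiv 𝕜 (ext0 f.1 * ext0 g.1) z :=
          Sm.fderiv_congr _ _ (fun z => by simp [ext0_of_mem]) z
      have := fderiv_mul (Sm.diffAt f z) (Sm.diffAt g z)
      simp only [LinearMap.coe_mk, AddHom.coe_mk, Sm.of_val, smul_eq_mul, Subalgebra.coe_add, Subalgebra.coe_mul, Pi.add_apply, Pi.mul_apply] at h ⊢
      rw [h, this]; simp [ext0_of_mem])

theorem Sm.dir_val (v : ℂ) (f : Sm 𝕜 Ω) (z : Ω) : (Sm.dir v f).1 z = fderiv 𝕜 (ext0 f.1) z v := rfl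

theorem Sm.dir_of (v : ℂ) (f : Sm 𝕜 Ω) (F : ℂ → ℂ) (h : ∀ z : Ω, f.1 z = F z) (z : Ω) :
    (Sm.dir v f).1 z = fderiv 𝕜 F z v := by
  rw [Sm.dir_val, Sm.fderiv_congr f F h]

/-- evaluation -/
def Sm.ev (z : Ω) : Sm 𝕜 Ω →ₐ[ℂ] ℂ := (Pi.evalAlgHom ℂ (fun _ : Ω => ℂ) z).comp (Sm 𝕜 Ω).val

theorem Sm.ev_apply (z : Ω) (f : Sm 𝕜 Ω) : Sm.ev z f = f.1 z := rfl

end sm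

section tay
open PowerSeries
variable {R A : Type*} [CommRing R] [Algebra ℂ R] [CommRing A] [Algebra ℂ A]

/-- formal Taylor coefficients -/
def tayF (D : Derivation ℂ R R) (ev : R →ₐ[ℂ] A) (f : R) : PowerSeries A :=
  PowerSeries.mk fun n => ((n.factorial : ℂ)⁻¹) • ev (D^[n] f)

variable (D : Derivation ℂ R R) (ev : R →ₐ[ℂ] A)

theorem tayF_coeff (n : ℕ) (f : R) : coeff n (tayF D ev f) = ((n.factorial : ℂ)⁻¹) • ev (D^[n] f) := by
  simp [tayF]

theorem tayF_add (f g : R) : tayF D ev (f + g) = tayF D ev f + tayF D ev g := by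
  ext n; simp [tayF_coeff, iterate_map_add]

theorem tayF_smul (c : ℂ) (f : R) : tayF D ev (c • f) = c • tayF D ev f := by
  ext n
  have : D^[n] (c • f) = c • D^[n] f := by
    induction n generalizing f with
    | zero => rfl
    | succ n ih => rw [Function.iterate_succ_apply, Function.iterate_succ_apply, ← ih]; simp
  simp [tayF_coeff, this, smul_comm c]

theorem tayF_der (f : R) : PowerSeries.derivative A (tayF D ev f) = tayF D ev (D f) := by
  ext n
  rw [PowerSeries.coeff_derivative, tayF_coeff, tayF_coeff, Function.iterate_succ_apply, Nat.factorial_succ]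
  have h : ((n:A) + 1) = algebraMap ℂ A ((n:ℂ)+1) := by simp
  rw [h, mul_comm, ← Algebra.smul_def, smul_smul]
  congr 1
  have h2 : ((n:ℂ)+1) ≠ 0 := by exact_mod_cast Nat.succ_ne_zero n
  have h3 : ((n.factorial:ℕ):ℂ) ≠ 0 := by exact_mod_cast Nat.factorial_ne_zero n
  push_cast
  field_simp

theorem tayF_const (f : R) : constantCoeff (tayF D ev f) = ev f := by
  rw [← coeff_zero_eq_constantCoeff_apply, tayF_coeff]; simp

theorem coeff_succ_der (n : ℕ) (f g : PowerSeries A) (h : coeff n (PowerSeries.derivative A f) = coeff n (PowerSeries.derivative A g)) :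
    coeff (n+1) f = coeff (n+1) g := by
  rw [PowerSeries.coeff_derivative, PowerSeries.coeff_derivative] at h
  have h' : ((n:A) + 1) = algebraMap ℂ A ((n:ℂ)+1) := by simp
  rw [h', mul_comm, mul_comm _ (algebraMap _ _ _), ← Algebra.smul_def, ← Algebra.smul_def] at h
  have h2 : ((n:ℂ)+1) ≠ 0 := by exact_mod_cast Nat.succ_ne_zero n
  have := congrArg (fun x => ((n:ℂ)+1)⁻¹ • x) h
  simpa [smul_smul, h2] using this

theorem der_ext' (f g : PowerSeries A) (h : PowerSeries.derivative A f = PowerSeries.derivative A g)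
    (h0 : constantCoeff f = constantCoeff g) : f = g := by
  ext n
  cases n with
  | zero => simpa using h0
  | succ n => exact coeff_succ_der n f g (by rw [h])

theorem tayF_mul (f g : R) : tayF D ev (f * g) = tayF D ev f * tayF D ev g := by
  have : ∀ n f g, coeff n (tayF D ev (f * g)) = coeff n (tayF D ev f * tayF D ev g) := by
    intro n
    induction n with
    | zero => intro f g; simp [tayF_const]
    | succ n ih =>
      intro f g
      apply coeff_succ_der
      rw [tayF_der, Derivation.leibniz, Derivation.leibniz, tayF_add, tayF_der, tayF_der]
      simp only [smul_eq_mul, map_add, ih]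
  ext n; exact this n f g

/-- Taylor expansion along a derivation, as a ring homomorphism -/
def tay : R →ₐ[ℂ] PowerSeries A :=
  AlgHom.ofLinearMap
    { toFun := tayF D ev, map_add' := tayF_add D ev, map_smul' := tayF_smul D ev }
    (by
      refine der_ext' _ _ ?_ ?_
      · have := tayF_der D ev (1 : R)
        simp only [LinearMap.coe_mk, AddHom.coe_mk]
        rw [this]
        have h0 : tayF D ev 0 = 0 := by simpa using tayF_smul D ev 0 0
        simp [h0]
      · simp [tayF_const])
    (tayF_mul D ev)

theorem tay_der (f : R) : PowerSeries.derivative A (tay D ev f) = tay D ev (D f) := tayF_der D ev f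
theorem tay_const (f : R) : constantCoeff (tay D ev f) = ev f := tayF_const D ev f
theorem tay_coeff (n : ℕ) (f : R) : coeff n (tay D ev f) = ((n.factorial : ℂ)⁻¹) • ev (D^[n] f) :=
  tayF_coeff D ev n f

end tay
end ZV

namespace ZV
open scoped ContDiff
open TopologicalSpace

section ring
/-- the disc in the logarithmic coordinate -/
def Hb (R : ℝ) : Opens ℂ := ⟨Metric.ball (-(R:ℂ)) R, Metric.isOpen_ball⟩

abbrev OO (R : ℝ) := Sm ℂ (Hb R)

theorem Hb_re {R : ℝ} {z : ℂ} (hz : z ∈ Hb R) : z.re < 0 := by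
  have h : ‖z + R‖ < R := by
    have := Metric.mem_ball.mp (show z ∈ Metric.ball (-(R:ℂ)) R from hz)
    rwa [dist_eq_norm, sub_neg_eq_add] at this
  have := (Complex.re_le_norm (z + R)).trans_lt h
  simp at this
  exact this

theorem mem_Hb {z : ℂ} (hz : z.re < 0) : ∃ R0 : ℝ, ∀ R > R0, 0 < R → z ∈ Hb R := by
  refine ⟨Complex.normSq z / (-2 * z.re), fun R hR hR0 => ?_⟩
  show z ∈ Metric.ball (-(R:ℂ)) R
  rw [Metric.mem_ball, dist_eq_norm, sub_neg_eq_add]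
  rw [gt_iff_lt, div_lt_iff₀ (by linarith)] at hR
  apply lt_of_pow_lt_pow_left₀ 2 hR0.le
  rw [← Complex.normSq_eq_norm_sq]
  rw [Complex.normSq_apply] at hR ⊢
  simp
  nlinarith

def ofD {R : ℝ} (F : ℂ → ℂ) (hF : DifferentiableOn ℂ F (Hb R)) : OO R :=
  Sm.of F (hF.contDiffOn (Hb R).isOpen)

def sE (R : ℝ) : OO R := ofD Complex.exp (Complex.differentiable_exp.differentiableOn)
def sI (R : ℝ) : OO R := ofD (fun z => Complex.exp (-z)) (by fun_prop)

theorem sE_val (R : ℝ) (z) : (sE R).1 z = Complex.exp z := rfl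
theorem sI_val (R : ℝ) (z) : (sI R).1 z = Complex.exp (-z) := rfl

theorem OO_diffOn {R : ℝ} (f : OO R) : DifferentiableOn ℂ (ext0 f.1) (Hb R) := fun z hz =>
  (Sm.diffAt f ⟨z, hz⟩).differentiableWithinAt

def DD (ζ : ℂ) (R : ℝ) : Derivation ℂ (OO R) (OO R) := (ζ⁻¹ • sI R) • Sm.dir 1

theorem DD_val (ζ : ℂ) (R : ℝ) (f : OO R) (z : Hb R) (F : ℂ → ℂ) (d : ℂ) (h : ∀ w : Hb R, f.1 w = F w) (hd : HasDerivAt F d z) :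
    (DD ζ R f).1 z = ζ⁻¹ * Complex.exp (-z) * d := by
  have : (Sm.dir (𝕜 := ℂ) 1 f).1 z = d := by
    rw [Sm.dir_of 1 f F h z, fderiv_eq_smul_deriv, hd.deriv]; simp
  simp only [DD, Derivation.smul_apply, smul_eq_mul, Subalgebra.coe_mul, Pi.mul_apply, this, Subalgebra.coe_smul, Pi.smul_apply, sI_val]

theorem OO_prim {ζ : ℂ} (hζ : ζ ≠ 0) {R : ℝ} (f : OO R) (z0 : Hb R) (c : ℂ) : ∃ F : OO R, DD ζ R F = f ∧ F.1 z0 = c := by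
  have h1 : DifferentiableOn ℂ (fun z => ζ * Complex.exp z * ext0 f.1 z) (Metric.ball (-(R:ℂ)) R) := by
    have := OO_diffOn f
    exact DifferentiableOn.mul (by fun_prop) this
  obtain ⟨g, hg0, hg⟩ := h1.isExactOn_ball.with_val_at z0 c
  refine ⟨ofD g (fun z hz => (hg z hz).differentiableAt.differentiableWithinAt), ?_, hg0⟩
  apply Sm.ext
  intro z
  rw [DD_val ζ R _ z g _ (fun w => rfl) (hg z z.2), ext0_of_mem]
  have : Complex.exp (-(z:ℂ)) * Complex.exp z = 1 := by rw [← Complex.exp_add]; simp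
  field_simp
  linear_combination (f.1 z) * this

theorem DD_sE {ζ : ℂ} {R : ℝ} : DD ζ R (sE R) = algebraMap ℂ _ ζ⁻¹ := by
  apply Sm.ext
  intro z
  rw [DD_val ζ R _ z Complex.exp _ (sE_val R) (Complex.hasDerivAt_exp z)]
  have : Complex.exp (-(z:ℂ)) * Complex.exp z = 1 := by rw [← Complex.exp_add]; simp
  rw [mul_assoc, this]; simp

theorem OO_sep {ζ : ℂ} (hζ : ζ ≠ 0) {R : ℝ} (z0 : Hb R) (f : OO R) (h : tay (DD ζ R) (Sm.ev z0) f = 0) : f = 0 := by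
  have hd : ∀ f : OO R, tay (DD ζ R) (Sm.ev z0) f = 0 → tay (DD ζ R) (Sm.ev z0) (Sm.dir 1 f) = 0 := by
    intro f hf
    have e : Sm.dir 1 f = (ζ • sE R) * DD ζ R f := by
      apply Sm.ext
      intro z
      have : Complex.exp (z:ℂ) * Complex.exp (-z) = 1 := by rw [← Complex.exp_add]; simp
      simp only [DD, Derivation.smul_apply, smul_eq_mul, Subalgebra.coe_mul, Pi.mul_apply, Subalgebra.coe_smul, Pi.smul_apply, sI_val, sE_val]
      field_simp
      linear_combination -((Sm.dir 1 f).1 z) * this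
    rw [e, map_mul, ← tay_der, hf]; simp
  have hit : ∀ n (f : OO R), tay (DD ζ R) (Sm.ev z0) f = 0 → iteratedDeriv n (ext0 f.1) z0 = 0 := by
    intro n
    induction n with
    | zero =>
      intro f hf
      have := tay_const (DD ζ R) (Sm.ev z0) f
      rw [hf] at this
      simp only [iteratedDeriv_zero, ext0_of_mem]
      simpa [Sm.ev_apply] using this.symm
    | succ n ih =>
      intro f hf
      rw [iteratedDeriv_succ']
      have : deriv (ext0 f.1) =ᶠ[nhds (z0:ℂ)] ext0 (Sm.dir (𝕜 := ℂ) 1 f).1 := by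
        filter_upwards [(Hb R).isOpen.mem_nhds z0.2] with w hw
        have := ext0_of_mem (Sm.dir (𝕜 := ℂ) 1 f).1 ⟨w, hw⟩
        rw [Sm.dir_val, fderiv_eq_smul_deriv] at this
        simp at this
        exact this.symm
      rw [this.iteratedDeriv_eq]
      exact ih _ (hd f hf)
  have han : AnalyticOnNhd ℂ (ext0 f.1) (Hb R) := (OO_diffOn f).analyticOnNhd (Hb R).isOpen
  obtain ⟨r, hr, hsub⟩ := Metric.isOpen_iff.mp (Hb R).isOpen z0 z0.2
  have hev : ext0 f.1 =ᶠ[nhds (z0:ℂ)] 0 := by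
    filter_upwards [Metric.ball_mem_nhds (z0:ℂ) hr] with w hw
    rw [← Complex.taylorSeries_eq_on_ball' hw ((OO_diffOn f).mono hsub)]
    simp [hit _ f h]
  have hpre : IsPreconnected (Hb R : Set ℂ) := (convex_ball _ _).isPreconnected
  have := han.eqOn_zero_of_preconnected_of_eventuallyEq_zero hpre z0.2 hev
  apply Sm.ext
  intro z
  rw [← ext0_of_mem f.1 z, this z.2]; rfl

theorem OO_jump {ζ : ℂ} {R : ℝ} (z0 z1 : Hb R) (f : OO R) 
    (h : tay (DD ζ R) (Sm.ev z1) (DD ζ R f) = tay (DD ζ R) (Sm.ev z0) (DD ζ R f)) :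
    tay (DD ζ R) (Sm.ev z1) f = tay (DD ζ R) (Sm.ev z0) f + PowerSeries.C (f.1 z1 - f.1 z0) := by
  apply der_ext'
  · rw [map_add, tay_der, tay_der, h]; simp
  · rw [map_add, tay_const, tay_const]; simp [Sm.ev_apply]

end ring

section prim

/-- the polynomial `(1+s)^3 (4 + 6 s + 4 s^2 + s^3)^3` -/
def dpol (s : ℂ) : ℂ := (1 + s)^3 * (4 + 6*s + 4*s^2 + s^3)^3

theorem dpol_ne {s : ℂ} (hs : ‖s‖ < 1) : dpol s ≠ 0 := by
  have h1 : 1 + s ≠ 0 := by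
    intro h
    have : s = -1 := by linear_combination h
    rw [this] at hs; simp at hs
  have h2 : s + 2 ≠ 0 := by
    intro h
    have : s = -2 := by linear_combination h
    rw [this] at hs; norm_num at hs
  have h3 : s^2 + 2*s + 2 ≠ 0 := by
    intro h
    have h' : ‖s^2 + 2 * s‖ = 2 := by
      rw [show s^2+2*s = -2 by linear_combination h]; norm_num
    have : (s + 1 - Complex.I) * (s + 1 + Complex.I) = 0 := by
      linear_combination h - Complex.I_sq
    have hn : ‖s‖^2 < 1 := by nlinarith [norm_nonneg s]
    rw [← Complex.normSq_eq_norm_sq, Complex.normSq_apply] at hn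
    rcases mul_eq_zero.mp this with h | h
    · have e1 := congrArg Complex.re h
      have e2 := congrArg Complex.im h
      simp at e1 e2
      nlinarith
    · have e1 := congrArg Complex.re h
      have e2 := congrArg Complex.im h
      simp at e1 e2
      nlinarith
  have e : (4 + 6*s + 4*s^2 + s^3) = (s+2)*(s^2+2*s+2) := by ring
  rw [dpol, e]
  exact mul_ne_zero (pow_ne_zero _ h1) (pow_ne_zero _ (mul_ne_zero h2 h3))

/-- remainder polynomial -/
def ppol (s : ℂ) : ℂ := -85 - 7137/16*s - 9285/8*s^2 - 61865/32*s^3 - 72435/32*s^4 - 124287/64*s^5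
  - 19835/16*s^6 - 75105/128*s^7 - 25755/128*s^8 - 6077/128*s^9 - 885/128*s^10 - 15/32*s^11

theorem dp_eq (s : ℂ) : 1 = dpol s * ((1 - 15/2*s + 30*s^2)/64) + s^3 * ppol s := by
  unfold dpol ppol; ring

/-- primitive of `exp (n t)` -/
def Pz (n : ℤ) (t : ℂ) : ℂ := if n = 0 then t else Complex.exp (n * t) / n

theorem Pz_deriv (n : ℤ) (t : ℂ) : HasDerivAt (Pz n) (Complex.exp (n*t)) t := by
  by_cases h : n = 0
  · have : Pz n = fun t => t := by funext t; simp [Pz, h]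
    rw [this, h]; simpa using hasDerivAt_id' t
  · have e : Pz n = fun t => Complex.exp (n * t) / n := by funext t; simp [Pz, h]
    have hn : (n:ℂ) ≠ 0 := by exact_mod_cast h
    rw [e]
    have := (((hasDerivAt_id' t).const_mul (n:ℂ)).cexp).div_const (n:ℂ)
    refine this.congr_deriv ?_
    rw [mul_one, mul_div_cancel_right₀ _ hn]

theorem Pz_jump (n : ℤ) (t : ℂ) : Pz n (t + 2 * π * Complex.I) = Pz n t + if n = 0 then 2 * π * Complex.I else 0 := by
  by_cases h : n = 0
  · simp [Pz, h]
  · have : Complex.exp (n * (t + 2 * π * Complex.I)) = Complex.exp (n * t) := by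
      rw [mul_add, Complex.exp_add, Complex.exp_int_mul_two_pi_mul_I, mul_one]
    simp [Pz, h, this]

/-- residues -/
def jl (l : ℕ) : ℂ := 2 * π * Complex.I / 64 * (if l = 0 then 30 else if l = 1 then -15/2 else if l = 2 then 1 else 0)

theorem Kprim (l : ℕ) : ∃ K : ℂ → ℂ, (∀ t : ℂ, t.re < 0 →
    HasDerivAt K (Complex.exp t * (Complex.exp t)^l / (dpol (Complex.exp t) * (Complex.exp t)^3)) t) ∧
    ∀ t, K (t + 2 * π * Complex.I) = K t + jl l := by
  have hdiff : DifferentiableOn ℂ (fun s => s^l * (ppol s / dpol s)) (Metric.ball 0 1) := by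
    intro s hs
    have : dpol s ≠ 0 := dpol_ne (by simpa using hs)
    unfold dpol at this
    unfold ppol dpol
    apply DifferentiableAt.differentiableWithinAt
    fun_prop (disch := assumption)
  obtain ⟨Ψ, hΨ⟩ := hdiff.isExactOn_ball
  refine ⟨fun t => (1/64) * (Pz ((l:ℤ) - 2) t - 15/2 * Pz ((l:ℤ)-1) t + 30 * Pz (l:ℤ) t) + Ψ (Complex.exp t), ?_, ?_⟩
  · intro t ht
    have hs : ‖Complex.exp t‖ < 1 := by rw [Complex.norm_exp]; exact (Real.exp_lt_one_iff).mpr ht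
    have h1 := (hΨ (Complex.exp t) (by simpa using hs)).comp t (Complex.hasDerivAt_exp t)
    have h2 := ((((Pz_deriv ((l:ℤ)-2) t).sub ((Pz_deriv ((l:ℤ)-1) t).const_mul (15/2))).add ((Pz_deriv (l:ℤ) t).const_mul 30)).const_mul (1/64 : ℂ)).add h1
    refine h2.congr_deriv ?_
    have hne := Complex.exp_ne_zero t
    have hd := dpol_ne hs
    have e0 : Complex.exp (((l:ℤ):ℂ) * t) = Complex.exp t ^ l := by
      rw [← Complex.exp_nat_mul]; simp
    have e1 : Complex.exp ((((l:ℤ) - 1 : ℤ):ℂ) * t) = Complex.exp t ^ l / Complex.exp t := by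
      rw [← e0, ← Complex.exp_sub]; congr 1; push_cast; ring
    have e2 : Complex.exp ((((l:ℤ) - 2 : ℤ):ℂ) * t) = Complex.exp t ^ l / (Complex.exp t)^2 := by
      rw [← e0, pow_two, ← Complex.exp_add, ← Complex.exp_sub]; congr 1; push_cast; ring
    rw [e0, e1, e2]
    show _ + Complex.exp t ^ l * (ppol (Complex.exp t) / dpol (Complex.exp t)) * Complex.exp t = _
    clear h1 h2 e0 e1 e2
    have := dp_eq (Complex.exp t)
    generalize Complex.exp t = s at *
    generalize dpol s = d at *
    generalize ppol s = p at *
    generalize s^l = sl at *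
    field_simp
    linear_combination (-128 * sl) * this
  · intro t
    have : Complex.exp (t + 2 * π * Complex.I) = Complex.exp t := by
      rw [Complex.exp_add, Complex.exp_two_pi_mul_I, mul_one]
    simp only [Pz_jump, this, jl]
    rcases l with _ | _ | _ | l
    · norm_num; ring
    · norm_num; ring
    · norm_num; ring
    · have h0 : ((l + 1 + 1 + 1 : ℕ) : ℤ) - 2 ≠ 0 := by push_cast; omega
      have h1 : ((l + 1 + 1 + 1 : ℕ) : ℤ) - 1 ≠ 0 := by push_cast; omega
      have h2 : ((l + 1 + 1 + 1 : ℕ) : ℤ) ≠ 0 := by push_cast; omega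
      simp only [h0, h1, h2, if_false]
      simp
end prim
end ZV

namespace ZV
open scoped ContDiff
open TopologicalSpace
open PowerSeries

/-- the formal potential -/
def Vf (μ X0 Y0 : ℂ) (r gy : PowerSeries ℂ) : FF :=
  iot (C μ) * (1 + iot (C X0 + X) * C (C Y0 + X))^16 * iot r * C gy

theorem mono_exists (ζ : ℂ) (hζ : ζ^4 = 1) (μ X0 Y0 : ℂ) (r gy : PowerSeries ℂ)
    (hgy : (C Y0 + X)^3 * ((C Y0 + X)^4 - 1)^3 * gy = 1)
    (h0 : Y0 ≠ ζ) (h1 : ‖Y0 / ζ - 1‖ < 1) :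
    ∃ L, Mono (Vf μ X0 Y0 r gy)
      (r * (C (μ * (2 * π * Complex.I) * (30/64) * ζ⁻¹^2) * ((1 + C ζ * (C X0 + X))^14 * (1 - C ζ * (C X0 + X))^2))) L := by
  have hζ0 : ζ ≠ 0 := by rintro rfl; norm_num at hζ
  set s0 := Y0 / ζ - 1 with hs0
  have hs0ne : s0 ≠ 0 := by
    intro h; apply h0
    rw [hs0, sub_eq_zero, div_eq_one_iff_eq hζ0] at h; exact h
  set τ0 := Complex.log s0 with hτ0
  have hexp : Complex.exp τ0 = s0 := Complex.exp_log hs0ne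
  have hexp1 : Complex.exp (τ0 + 2 * π * Complex.I) = s0 := by
    rw [Complex.exp_add, Complex.exp_two_pi_mul_I, mul_one, hexp]
  have hre : τ0.re < 0 := by
    rw [hτ0, Complex.log_re]
    exact Real.log_neg (norm_pos_iff.mpr hs0ne) h1
  have hre1 : (τ0 + 2 * π * Complex.I).re < 0 := by simpa using hre
  obtain ⟨R0, hR0⟩ := mem_Hb hre
  obtain ⟨R1, hR1⟩ := mem_Hb hre1
  obtain ⟨R, hR⟩ : ∃ R : ℝ, R0 < R ∧ R1 < R ∧ 0 < R :=
    ⟨max (max R0 R1) 0 + 1, by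
      have := le_max_left (max R0 R1) 0; have := le_max_left R0 R1; linarith, by
      have := le_max_left (max R0 R1) 0; have := le_max_right R0 R1; linarith, by
      have := le_max_right (max R0 R1) 0; linarith⟩
  let z0 : Hb R := ⟨τ0, hR0 R hR.1 hR.2.2⟩
  let z1 : Hb R := ⟨τ0 + 2 * π * Complex.I, hR1 R hR.2.1 hR.2.2⟩
  let t0 := tay (DD ζ R) (Sm.ev z0)
  let t1 := tay (DD ζ R) (Sm.ev z1)
  have hnorm : ∀ t : Hb R, ‖Complex.exp t‖ < 1 := fun t => by
    rw [Complex.norm_exp]; exact Real.exp_lt_one_iff.mpr (Hb_re t.2)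
  have hden : ∀ t : Hb R, (ζ * (1 + Complex.exp t))^3 * ((ζ * (1 + Complex.exp t))^4 - 1)^3
      = ζ^3 * (dpol (Complex.exp t) * (Complex.exp t)^3) := fun t => by
    rw [mul_pow ζ _ 4, hζ, dpol]; ring
  have hden0 : ∀ t : Hb R, (ζ * (1 + Complex.exp t))^3 * ((ζ * (1 + Complex.exp t))^4 - 1)^3 ≠ 0 := fun t => by
    rw [hden]
    exact mul_ne_zero (pow_ne_zero _ hζ0) (mul_ne_zero (dpol_ne (hnorm t)) (pow_ne_zero _ (Complex.exp_ne_zero _)))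
  let gO : OO R := ofD (fun t => ((ζ * (1 + Complex.exp t))^3 * ((ζ * (1 + Complex.exp t))^4 - 1)^3)⁻¹) (by
    intro t ht
    have := hden0 ⟨t, ht⟩
    apply DifferentiableAt.differentiableWithinAt
    exact DifferentiableAt.fun_inv (h := fun t => (ζ * (1 + Complex.exp t))^3 * ((ζ * (1 + Complex.exp t))^4 - 1)^3) (by fun_prop) this)
  let yO : OO R := ζ • (1 + sE R)
  have hgO : yO^3 * (yO^4 - 1)^3 * gO = 1 := by
    apply Sm.ext
    intro t
    exact mul_inv_cancel₀ (hden0 t)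
  have dY : DD ζ R yO = 1 := by
    have e : DD ζ R yO = ζ • (algebraMap ℂ (OO R) ζ⁻¹) := by
      show DD ζ R (ζ • (1 + sE R)) = _
      rw [Derivation.map_smul, map_add, DD_sE, Derivation.map_one_eq_zero, zero_add]
    rw [e, Algebra.smul_def, ← map_mul, mul_inv_cancel₀ hζ0, map_one]
  have hyO : ∀ z : Hb R, Complex.exp z = s0 → tay (DD ζ R) (Sm.ev z) yO = C Y0 + X := by
    intro z hz
    apply der_ext'
    · rw [tay_der, dY]; simp
    · rw [tay_const, Sm.ev_apply]
      show ζ * (1 + Complex.exp z) = _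
      rw [hz, hs0]; simp; field_simp
  have hgO' : ∀ z : Hb R, Complex.exp z = s0 → tay (DD ζ R) (Sm.ev z) gO = gy := by
    intro z hz
    have := congrArg (tay (DD ζ R) (Sm.ev z)) hgO
    simp only [map_mul, map_pow, map_sub, map_one, hyO z hz] at this
    calc _ = tay (DD ζ R) (Sm.ev z) gO * ((C Y0 + X)^3 * ((C Y0 + X)^4 - 1)^3 * gy) := by rw [hgy, mul_one]
      _ = ((C Y0 + X)^3 * ((C Y0 + X)^4 - 1)^3 * tay (DD ζ R) (Sm.ev z) gO) * gy := by ring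
      _ = gy := by rw [this, one_mul]
  have hsE : sE R = ζ⁻¹ • yO - 1 := by
    simp [yO, smul_smul, hζ0]
  have hsE' : ∀ z : Hb R, Complex.exp z = s0 → tay (DD ζ R) (Sm.ev z) (sE R) = ζ⁻¹ • (C Y0 + X) - 1 := by
    intro z hz
    rw [hsE, map_sub, map_smul, hyO z hz, map_one]
  choose K hK1 hK2 using Kprim
  let hO : ℕ → OO R := fun l => ofD (fun t => ζ⁻¹^2 * K l t) (fun t ht =>
    ((hK1 l t (Hb_re ht)).const_mul (ζ⁻¹^2)).differentiableAt.differentiableWithinAt)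
  have hhO : ∀ l, DD ζ R (hO l) = (sE R)^l * gO := by
    intro l
    apply Sm.ext
    intro t
    rw [DD_val ζ R (hO l) t _ _ (fun w => rfl) ((hK1 l t (Hb_re t.2)).const_mul (ζ⁻¹^2))]
    show _ = (Complex.exp t)^l * ((ζ * (1 + Complex.exp t))^3 * ((ζ * (1 + Complex.exp t))^4 - 1)^3)⁻¹
    rw [hden t, Complex.exp_neg]
    have h1 := Complex.exp_ne_zero t
    have h2 := dpol_ne (hnorm t)
    field_simp
  let ss : PowerSeries ℂ := ζ⁻¹ • (C Y0 + X) - 1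
  have hD0 : ∀ l, t0 (DD ζ R (hO l)) = ss^l * gy := fun l => by
    rw [hhO, map_mul, map_pow, hgO' z0 hexp, hsE' z0 hexp]
  have hD1 : ∀ l, t1 (DD ζ R (hO l)) = ss^l * gy := fun l => by
    rw [hhO, map_mul, map_pow, hgO' z1 hexp1, hsE' z1 hexp1]
  refine ⟨(t0.prod t1).range, ⟨?_, ?_, ?_⟩⟩
  · rintro a b ⟨f, hf⟩
    have hf0 : t0 f = PowerSeries.derivative ℂ a := congrArg Prod.fst hf
    have hf1 : t1 f = b := congrArg Prod.snd hf
    obtain ⟨F, hF, hF0⟩ := OO_prim hζ0 f z0 (constantCoeff a)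
    refine ⟨t1 F, ?_, F, ?_⟩
    · rw [← hf1, ← hF]; exact tay_der _ _ _
    · have : t0 F = a := by
        apply der_ext'
        · rw [← hf0, ← hF]; exact tay_der _ _ _
        · rw [← hF0]; exact tay_const _ _ _
      exact Prod.ext this rfl
  · rintro b ⟨f, hf⟩
    have hf0 : t0 f = 0 := congrArg Prod.fst hf
    have hf1 : t1 f = b := congrArg Prod.snd hf
    rw [← hf1, OO_sep hζ0 z0 f hf0, map_zero]
  · refine ⟨fun l => C μ * ((16 : ℕ).choose l : PowerSeries ℂ) * (1 + C ζ * (C X0 + X))^(16 - (l:ℕ)) * (C ζ * (C X0 + X))^(l:ℕ) * r,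
      fun l => t0 (hO l), fun l => ζ⁻¹^2 * jl l, ?_, ?_, ?_, ?_⟩
    · have hder : ∀ l, PowerSeries.derivative ℂ (t0 (hO l)) = ss^l * gy := fun l => by
        rw [← hD0 l]; exact tay_der _ _ _
      simp only [hder]
      rw [Fin.sum_univ_eq_sum_range (fun l => iot (C μ * ((16 : ℕ).choose l : PowerSeries ℂ) * (1 + C ζ * (C X0 + X))^(16 - l) * (C ζ * (C X0 + X))^l * r) * C (ss^l * gy)) 17]
      have e : (1 + iot (C X0 + X) * C (C Y0 + X) : FF) = iot (C ζ * (C X0 + X)) * C ss + iot (1 + C ζ * (C X0 + X)) := by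
        have : (C Y0 + X : PowerSeries ℂ) = C ζ * (ss + 1) := by
          simp only [ss, sub_add_cancel, PowerSeries.smul_eq_C_mul]
          rw [← mul_assoc, ← map_mul, mul_inv_cancel₀ hζ0]; simp
        rw [this]
        have hc : (C (C ζ : PowerSeries ℂ) : FF) = iot (C ζ) := by simp [iot]
        simp only [map_mul, map_add, map_one, hc]; ring
      rw [Vf, e, add_pow, Finset.mul_sum, Finset.sum_mul, Finset.sum_mul]
      refine Finset.sum_congr rfl fun l _ => ?_
      simp only [map_mul, map_pow, map_natCast]
      ring
    · intro l
      have h0 := hD0 l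
      have h1 := hD1 l
      refine ⟨DD ζ R (hO l), ?_⟩
      have e0 : PowerSeries.derivative ℂ (t0 (hO l)) = t0 (DD ζ R (hO l)) := tay_der _ _ _
      rw [e0]
      exact Prod.ext rfl (h1.trans h0.symm)
    · intro l
      refine ⟨hO l, Prod.ext rfl ?_⟩
      have := OO_jump z0 z1 (hO l) ((hD1 l).trans (hD0 l).symm)
      show t1 (hO l) = _
      refine this.trans ?_
      congr 2
      show ζ⁻¹^2 * K l (τ0 + 2 * π * Complex.I) - ζ⁻¹^2 * K l τ0 = _
      rw [hK2]; ring
    · generalize C X0 + X = x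
      rw [Fin.sum_univ_eq_sum_range (fun l => C (ζ⁻¹^2 * jl l) * (C μ * ((16 : ℕ).choose l : PowerSeries ℂ) * (1 + C ζ * x)^(16 - l) * (C ζ * x)^l * r)) 17]
      have hz : ∀ l ∈ Finset.range 17, l ∉ Finset.range 3 → C (ζ⁻¹^2 * jl l) * (C μ * ((16 : ℕ).choose l : PowerSeries ℂ) * (1 + C ζ * x)^(16 - l) * (C ζ * x)^l * r) = 0 := by
        intro l _ hl
        have : jl l = 0 := by
          simp only [Finset.mem_range, not_lt] at hl
          simp [jl, show l ≠ 0 by omega, show l ≠ 1 by omega, show l ≠ 2 by omega]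
        simp [this]
      rw [← Finset.sum_subset (Finset.range_subset_range.mpr (by norm_num : 3 ≤ 17)) hz]
      simp only [Finset.sum_range_succ, Finset.sum_range_zero, zero_add]
      have c0 : ζ⁻¹^2 * jl 0 = ((2 * π * Complex.I) * (1/128) * ζ⁻¹^2) * 60 := by simp only [jl]; norm_num; try ring
      have c1 : ζ⁻¹^2 * jl 1 = ((2 * π * Complex.I) * (1/128) * ζ⁻¹^2) * (-15) := by simp only [jl]; norm_num; try ring
      have c2 : ζ⁻¹^2 * jl 2 = ((2 * π * Complex.I) * (1/128) * ζ⁻¹^2) * 2 := by simp only [jl]; norm_num; try ring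
      have c3 : μ * (2 * π * Complex.I) * (30/64) * ζ⁻¹^2 = ((2 * π * Complex.I) * (1/128) * ζ⁻¹^2) * (μ * 60) := by ring
      have n1 : (C (60:ℂ) : PowerSeries ℂ) = 60 := map_ofNat C 60
      have n2 : (C (-15:ℂ) : PowerSeries ℂ) = -15 := by rw [map_neg, map_ofNat C 15]
      have n3 : (C (2:ℂ) : PowerSeries ℂ) = 2 := map_ofNat C 2
      rw [c0, c1, c2, c3, map_mul C _ (60:ℂ), map_mul C _ (-15:ℂ), map_mul C _ (2:ℂ), map_mul C _ (μ * 60), map_mul C μ, n1, n2, n3]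
      have k0 : Nat.choose 16 0 = 1 := by decide
      have k1 : Nat.choose 16 1 = 16 := by decide
      have k2 : Nat.choose 16 2 = 120 := by decide
      rw [k0, k1, k2]
      push_cast
      ring
end ZV

namespace ZV
open PowerSeries

theorem formal_V1 (μ X0 Y0 : ℂ) (hμ : μ ≠ 0) (r gy : PowerSeries ℂ)
    (hr : (C X0 + X)^3 * ((C X0 + X)^4 - 1)^3 * r = 1)
    (hgy : (C Y0 + X)^3 * ((C Y0 + X)^4 - 1)^3 * gy = 1)
    (h0 : Y0 ≠ 1) (h1 : ‖Y0 - 1‖ < 1) (h2 : Y0 ≠ -Complex.I) (h3 : ‖Y0 + Complex.I‖ < 1)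
    (A : ℤ → FF) (hfin : ∃ N : ℕ, ∀ j : ℤ, (N:ℤ) < |j| → A j = 0)
    (hA : ∀ j, dT (A j) + LV (Vf μ X0 Y0 r gy) (j+2) (A (j+2)) = 0) :
    (∀ j, j ≠ 0 → A j = 0) ∧ ∃ c : ℂ, A 0 = iot (C c) := by
  obtain ⟨L₀, M₀⟩ := mono_exists 1 (by norm_num) μ X0 Y0 r gy hgy h0 (by simpa using h1)
  have hI : (-Complex.I)^4 = 1 := by rw [neg_pow, Complex.I_pow_four]; norm_num
  have hIn : ‖Y0 / (-Complex.I) - 1‖ < 1 := by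
    have e : Y0 / (-Complex.I) - 1 = Complex.I * (Y0 + Complex.I) := by
      rw [div_neg, Complex.div_I]; linear_combination -Complex.I_sq
    rw [e, norm_mul, Complex.norm_I, one_mul]; exact h3
  obtain ⟨L₁, M₁⟩ := mono_exists (-Complex.I) hI μ X0 Y0 r gy hgy h2 hIn
  have hrne : r ≠ 0 := by rintro rfl; simp at hr
  have hpi : (2 * π * Complex.I : ℂ) ≠ 0 := Complex.two_pi_I_ne_zero
  have hx : tayl X0 Polynomial.X = C X0 + X := tayl_X X0
  have hr' : tayl X0 (Polynomial.X * (Polynomial.X^4-1)) * PowerSeries.derivative ℂ r = - (r * tayl X0 (3 * (Polynomial.X^4-1) + 12 * Polynomial.X^4)) := by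
    have t3 : tayl X0 3 = 3 := map_ofNat (tayl X0) 3
    have t12 : tayl X0 12 = 12 := map_ofNat (tayl X0) 12
    simp only [map_mul, map_sub, map_add, map_pow, map_one, hx, t3, t12]
    have hd := congrArg (PowerSeries.derivative ℂ) hr
    have dx : PowerSeries.derivative ℂ (C X0 + X : PowerSeries ℂ) = 1 := by simp
    generalize (C X0 + X : PowerSeries ℂ) = x at *
    simp only [Derivation.leibniz, Derivation.leibniz_pow, map_sub, dx, Derivation.map_one_eq_zero, smul_eq_mul, nsmul_eq_mul] at hd
    push_cast at hd
    linear_combination (-x * (x^4-1) * PowerSeries.derivative ℂ r - r * (15 * x^4 - 3)) * hr + r * x * (x^4-1) * hd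
  set c₀ : ℂ := μ * (2 * π * Complex.I) * (30/64) * (1:ℂ)⁻¹^2 with hc₀
  set c₁ : ℂ := μ * (2 * π * Complex.I) * (30/64) * (-Complex.I)⁻¹^2 with hc₁
  have hc₀n : c₀ ≠ 0 := by
    rw [hc₀]; refine mul_ne_zero (mul_ne_zero (mul_ne_zero hμ hpi) (by norm_num)) (by norm_num)
  have hc₁n : c₁ ≠ 0 := by
    rw [hc₁]; refine mul_ne_zero (mul_ne_zero (mul_ne_zero hμ hpi) (by norm_num)) (pow_ne_zero _ (inv_ne_zero (neg_ne_zero.mpr Complex.I_ne_zero)))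
  have e1I : (1 + Complex.I) ≠ 0 := by
    intro h; have := congrArg Complex.re h; simp at this
  have e1I' : (1 - Complex.I) ≠ 0 := by
    intro h; have := congrArg Complex.re h; simp at this
  have G := good_pair X0 r hrne hr'
    (Polynomial.C c₀ * ((1 + Polynomial.C 1 * Polynomial.X)^14 * (1 - Polynomial.C 1 * Polynomial.X)^2))
    (Polynomial.C c₁ * ((1 + Polynomial.C (-Complex.I) * Polynomial.X)^14 * (1 - Polynomial.C (-Complex.I) * Polynomial.X)^2))
    (Polynomial.C c₀ * (1 + Polynomial.C 1 * Polynomial.X)^14)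
    (Polynomial.C c₁ * Polynomial.C (-1) * (1 + Polynomial.C (-Complex.I) * Polynomial.X)^14)
    1 Complex.I (by norm_num) Complex.I_pow_four (by simp only [map_one]; ring)
    (by
      have : (Polynomial.C (-1:ℂ)) = (Polynomial.C Complex.I)^2 := by rw [← map_pow, Complex.I_sq]
      have h1 : (Polynomial.C Complex.I)^2 * Polynomial.C Complex.I^2 = 1 := by
        rw [← this, ← map_mul]; norm_num
      rw [this, map_neg]
      have h2 : (Polynomial.C Complex.I : Polynomial ℂ)^2 = -1 := by rw [← this]; simp
      generalize (1 + -Polynomial.C Complex.I * Polynomial.X : Polynomial ℂ)^14 = t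
      linear_combination (Polynomial.C c₁ * t) * (1 - (Polynomial.C Complex.I)^2 + 2 * Polynomial.C Complex.I * Polynomial.X) * h2)
    (by
      simp [hc₀n]) 
    (by
      simp [hc₁n])
    (by
      simp [hc₀n, e1I, e1I'])
    (by
      simp [hc₁n, e1I, e1I', sub_eq_add_neg] ; simpa [sub_eq_add_neg] using e1I')
  have T : ∀ c ζ : ℂ, tayl X0 (Polynomial.C c * ((1 + Polynomial.C ζ * Polynomial.X)^14 * (1 - Polynomial.C ζ * Polynomial.X)^2))
      = C c * ((1 + C ζ * (C X0 + X))^14 * (1 - C ζ * (C X0 + X))^2) := by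
    intro c ζ
    simp only [map_mul, map_pow, map_add, map_sub, map_one, tayl_C, hx]
  rw [T, T] at G
  obtain ⟨N, hN⟩ := hfin
  have S : Sol (Vf μ X0 Y0 r gy) N (fun k => A (N - k)) := by
    refine ⟨?_, ?_, ?_⟩
    · have := hA N
      rw [hN (N+2) (by rw [abs_of_nonneg] <;> omega), LV_zero, add_zero] at this
      simpa using this
    · have := hA (N-1)
      rw [hN (N-1+2) (by rw [abs_of_nonneg] <;> omega), LV_zero, add_zero] at this
      simpa using this
    · intro k
      have := hA (N - (k+2))
      rw [show (N:ℤ) - (k+2) + 2 = N - k by ring] at this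
      push_cast
      exact this
  have := formal_main M₀ M₁ G (2*N+1) N _ S (fun k hk => hN _ (by
    rw [abs_of_nonpos] <;> omega))
  constructor
  · intro j hj
    by_cases h : j ≤ N
    · have := this.1 (N - j).toNat (by
        rw [Int.toNat_of_nonneg (by omega)]; omega)
      rwa [Int.toNat_of_nonneg (by omega), sub_sub_cancel] at this
    · exact hN _ (by rw [abs_of_nonneg] <;> omega)
  · obtain ⟨c, hc⟩ := this.2 N rfl
    exact ⟨c, by simpa using hc⟩
end ZV

namespace ZV

section lau
variable {R M : Type*} [CommRing R] [Algebra ℂ R] [AddCommMonoid M]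

/-- graded-coefficientwise linear map -/
def cwFun (δ : M → R →ₗ[ℂ] R) (f : AddMonoidAlgebra R M) : AddMonoidAlgebra R M :=
  .ofCoeff (Finsupp.onFinset f.coeff.support (fun m => δ m (f.coeff m)) (by
    intro m hm
    rw [Finsupp.mem_support_iff]
    intro h
    rw [h, map_zero] at hm
    exact hm rfl))

theorem cwFun_coeff (δ : M → R →ₗ[ℂ] R) (f : AddMonoidAlgebra R M) (m : M) :
    (cwFun δ f).coeff m = δ m (f.coeff m) := rfl

/-- coefficientwise derivation -/
def cwD (δ : M → R →ₗ[ℂ] R) (h : ∀ m n a b, δ (m+n) (a*b) = a * δ n b + b * δ m a) :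
    Derivation ℂ (AddMonoidAlgebra R M) (AddMonoidAlgebra R M) :=
  Derivation.mk'
    { toFun := cwFun δ
      map_add' := by
        intro f g; ext m; simp [cwFun_coeff]
      map_smul' := by
        intro c f; ext m; simp [cwFun_coeff] }
    (by
      have sgl : ∀ m a, cwFun δ (AddMonoidAlgebra.single m a) = AddMonoidAlgebra.single m (δ m a) := by
        classical
        intro m a
        ext n
        rw [cwFun_coeff]
        simp only [AddMonoidAlgebra.coeff_single_apply]
        split_ifs with h
        · rw [h]
        · simp
      have hadd : ∀ f g : AddMonoidAlgebra R M, cwFun δ (f+g) = cwFun δ f + cwFun δ g := by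
        intro f g; ext m; simp [cwFun_coeff]
      have h0 : cwFun δ 0 = 0 := by ext m; simp [cwFun_coeff]
      intro f g
      simp only [LinearMap.coe_mk, AddHom.coe_mk, smul_eq_mul]
      induction f using AddMonoidAlgebra.induction_linear with
      | zero => simp [h0]
      | add f₁ f₂ h₁ h₂ => rw [add_mul, hadd, h₁, h₂, hadd]; ring
      | single m a =>
        induction g using AddMonoidAlgebra.induction_linear with
        | zero => simp [h0]
        | add f₁ f₂ h₁ h₂ => rw [mul_add, hadd, h₁, h₂, hadd]; ring
        | single n b =>
          rw [AddMonoidAlgebra.single_mul_single, sgl, sgl, sgl, AddMonoidAlgebra.single_mul_single, AddMonoidAlgebra.single_mul_single, h,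
            AddMonoidAlgebra.single_add, add_comm n m])

theorem cwD_coeff (δ : M → R →ₗ[ℂ] R) (h) (f : AddMonoidAlgebra R M) (m : M) :
    (cwD δ h f).coeff m = δ m (f.coeff m) := rfl

/-- coefficientwise extension of a derivation -/
def extD (M : Type*) [AddCommMonoid M] (D : Derivation ℂ R R) : Derivation ℂ (AddMonoidAlgebra R M) (AddMonoidAlgebra R M) :=
  cwD (fun _ => D.toLinearMap) (by intro m n a b; simp)

theorem extD_coeff (D : Derivation ℂ R R) (f : AddMonoidAlgebra R M) (m : M) :
    (extD M D f).coeff m = D (f.coeff m) := rfl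

/-- Euler derivation -/
def eulD (R : Type*) [CommRing R] [Algebra ℂ R] (w : M →+ ℤ) : Derivation ℂ (AddMonoidAlgebra R M) (AddMonoidAlgebra R M) :=
  cwD (fun m => w m • LinearMap.id) (by intro m n a b; simp [add_mul]; ring)

theorem eulD_coeff (w : M →+ ℤ) (f : AddMonoidAlgebra R M) (m : M) :
    (eulD R w f).coeff m = w m * f.coeff m := by
  show (w m • LinearMap.id (R := ℂ) (M := R)) (f.coeff m) = _
  simp

end lau

/-- The ring of Laurent polynomials in `P`, polynomial in the scaling parameter. -/
abbrev Lau (R : Type*) [CommRing R] := AddMonoidAlgebra R (ℤ × ℕ)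

section
variable {R : Type*} [CommRing R] [Algebra ℂ R]
/-- monomials -/
abbrev mono (j : ℤ) (n : ℕ) (a : R) : Lau R := AddMonoidAlgebra.single (j, n) a

theorem mono_mul_coeff (j : ℤ) (a : R) (f : Lau R) (i : ℤ) (n : ℕ) :
    (mono j 0 a * f).coeff (i, n) = a * f.coeff (i - j, n) := by
  classical
  apply AddMonoidAlgebra.coeff_single_mul_eq_mul_coeff
  rintro ⟨k, l⟩ _
  simp only [Prod.mk_add_mk, Prod.mk.injEq]
  omega

theorem mono_mul_coeff2 (j : ℤ) (a : R) (f : Lau R) (i : ℤ) (n : ℕ) :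
    (mono j 2 a * f).coeff (i, n) = if 2 ≤ n then a * f.coeff (i - j, n - 2) else 0 := by
  classical
  split_ifs with h
  · apply AddMonoidAlgebra.coeff_single_mul_eq_mul_coeff
    rintro ⟨k, l⟩ _
    simp only [Prod.mk_add_mk, Prod.mk.injEq]
    omega
  · apply AddMonoidAlgebra.coeff_single_mul_of_forall_add_ne
    rintro ⟨k, l⟩ hk
    simp only [Prod.mk_add_mk, Prod.mk.injEq] at hk
    omega

/-- evaluation -/
def evL (φ : R →+* ℂ) (P : ℂˣ) (l : ℂ) : Lau R →+* ℂ :=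
  AddMonoidAlgebra.liftNCRingHom φ
    { toFun := fun m => ((P ^ m.toAdd.1 : ℂˣ) : ℂ) * l ^ m.toAdd.2
      map_one' := by simp
      map_mul' := by intro a b; simp [zpow_add, pow_add]; ring }
    (fun _ _ => Commute.all _ _)

theorem evL_mono (φ : R →+* ℂ) (P : ℂˣ) (l : ℂ) (j n) (a : R) :
    evL φ P l (mono j n a) = φ a * (((P ^ j : ℂˣ) : ℂ) * l ^ n) := by
  simp [evL]

theorem evL_sum (φ : R →+* ℂ) (P : ℂˣ) (l : ℂ) (f : Lau R) :
    evL φ P l f = ∑ m ∈ f.coeff.support, φ (f.coeff m) * (((P ^ m.1 : ℂˣ) : ℂ) * l ^ m.2) := by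
  conv_lhs => rw [← AddMonoidAlgebra.sum_coeff_single f]
  rw [Finsupp.sum, map_sum]
  exact Finset.sum_congr rfl fun m _ => evL_mono φ P l m.1 m.2 _

theorem lau_zero (f : Lau R) (φ : R →+* ℂ) (Λ : Set ℂ) (hΛ : Λ.Infinite) (Ci : ℂ → Set ℂˣ) (hC : ∀ l ∈ Λ, (Ci l).Infinite)
    (h : ∀ l ∈ Λ, ∀ P ∈ Ci l, evL φ P l f = 0) : ∀ m, φ (f.coeff m) = 0 := by
  classical
  obtain ⟨K, hK⟩ : ∃ K : ℕ, ∀ m ∈ f.coeff.support, -(K:ℤ) ≤ m.1 := by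
    refine ⟨f.coeff.support.sup fun m => (m.1).natAbs, fun m hm => ?_⟩
    have := Finset.le_sup (f := fun m : ℤ × ℕ => (m.1).natAbs) hm
    omega
  let q : Polynomial (Polynomial ℂ) := ∑ m ∈ f.coeff.support, Polynomial.monomial (m.1 + K).toNat (Polynomial.monomial m.2 (φ (f.coeff m)))
  have hq : q = 0 := by
    have h1 : ∀ l ∈ Λ, q.map (Polynomial.evalRingHom l) = 0 := by
      intro l hl
      apply Polynomial.eq_zero_of_infinite_isRoot
      refine ((hC l hl).image (f := fun u : ℂˣ => (u:ℂ)) (Units.val_injective.injOn)).mono ?_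
      rintro _ ⟨P, hP, rfl⟩
      have := h l hl P hP
      rw [evL_sum] at this
      simp only [q, Set.mem_setOf_eq, Polynomial.IsRoot, Polynomial.map_sum, Polynomial.eval_finset_sum, Polynomial.map_monomial, Polynomial.eval_monomial, Polynomial.coe_evalRingHom]
      have h2 := congrArg (fun x => x * ((P^K : ℂˣ):ℂ)) this
      simp only [zero_mul, Finset.sum_mul] at h2
      rw [← h2]
      refine Finset.sum_congr rfl fun m hm => ?_
      have h3 : ((P ^ m.1 : ℂˣ):ℂ) * ((P^K : ℂˣ):ℂ) = (P:ℂ)^(m.1 + K).toNat := by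
        rw [← Units.val_mul, ← Units.val_pow_eq_pow_val, ← zpow_natCast P K, ← zpow_add, ← zpow_natCast P, Int.toNat_of_nonneg]
        have := hK m hm; omega
      rw [← h3]; ring
    ext1 i
    rw [Polynomial.coeff_zero]
    apply Polynomial.eq_zero_of_infinite_isRoot
    refine hΛ.mono fun l hl => ?_
    have := congrArg (fun p => Polynomial.coeff p i) (h1 l hl)
    simpa using this
  intro m
  by_cases hm : m ∈ f.coeff.support
  · have h1 := congrArg (fun p => (Polynomial.coeff p (m.1 + K).toNat).coeff m.2) hq
    simp only [q, Polynomial.finset_sum_coeff, Polynomial.coeff_zero] at h1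
    rw [Finset.sum_eq_single m] at h1
    · simpa using h1
    · intro n hn hnm
      rw [Polynomial.coeff_monomial]
      split_ifs with h2
      · rw [Polynomial.coeff_monomial, if_neg]
        intro h3
        apply hnm
        have := hK m hm
        have := hK n hn
        exact Prod.ext (by omega) h3
      · simp
    · exact fun h => absurd hm h
  · rw [Finsupp.notMem_support_iff.mp hm, map_zero]
end
end ZV

namespace ZV

section flow
variable {R : Type*} [CommRing R] [Algebra ℂ R] (dX dY : Derivation ℂ R R) (V1 V2 : R)

/-- embedding of coefficients -/
def cst : R →+* Lau R := AddMonoidAlgebra.singleZeroRingHom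

theorem cst_apply (a : R) : cst a = mono 0 0 a := rfl

/-- potential -/
def VL : Lau R := mono 0 0 V1 + mono 0 2 V2
/-- conjugate momentum -/
def QL : Lau R := mono (-1) 0 V1 + mono (-1) 2 V2
/-- momentum -/
def PL (R : Type*) [CommRing R] : Lau R := mono 1 0 1

/-- the flow derivation -/
def flow : Derivation ℂ (Lau R) (Lau R) :=
  PL R • extD (ℤ × ℕ) dY + QL V1 V2 • extD (ℤ × ℕ) dX
    + QL (dX V1) (dX V2) • eulD R (AddMonoidHom.fst ℤ ℕ)

theorem PL_QL : PL R * QL V1 V2 = VL V1 V2 := by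
  simp [PL, QL, VL, mul_add, mono, AddMonoidAlgebra.single_mul_single]

theorem PL_cancel (a b : Lau R) (h : PL R * a = PL R * b) : a = b := by
  have h1 : (mono (-1) 0 1 : Lau R) * PL R = 1 := by
    simp [PL, mono, AddMonoidAlgebra.single_mul_single]; rfl
  have := congrArg (fun x => (mono (-1) 0 1 : Lau R) * x) h
  simp only [← mul_assoc, h1, one_mul] at this
  exact this

theorem flow_apply (f : Lau R) : flow dX dY V1 V2 f = PL R * extD (ℤ × ℕ) dY f + QL V1 V2 * extD (ℤ × ℕ) dX f
    + QL (dX V1) (dX V2) * eulD R (AddMonoidHom.fst ℤ ℕ) f := by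
  simp [flow]

theorem extD_mono (D : Derivation ℂ R R) (j n) (a : R) : extD (ℤ × ℕ) D (mono j n a) = mono j n (D a) := by
  classical
  ext m
  simp only [extD_coeff, mono, AddMonoidAlgebra.coeff_single_apply]
  split_ifs <;> simp

theorem eulD_mono (j n) (a : R) : eulD R (AddMonoidHom.fst ℤ ℕ) (mono j n a) = mono j n (j * a) := by
  classical
  ext m
  simp only [eulD_coeff, mono, AddMonoidAlgebra.coeff_single_apply]
  split_ifs with h
  · rw [← h]; simp
  · simp

theorem flow_cst (a : R) : flow dX dY V1 V2 (cst a) = PL R * cst (dY a) + QL V1 V2 * cst (dX a) := by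
  rw [flow_apply, cst_apply, extD_mono, extD_mono, eulD_mono]
  simp [cst_apply, mono]

theorem flow_lam (b : ℂ) (k : ℕ) : flow dX dY V1 V2 (mono 0 k (algebraMap ℂ R b)) = 0 := by
  rw [flow_apply, extD_mono, extD_mono, eulD_mono]
  simp [mono]

theorem flow_PL : flow dX dY V1 V2 (PL R) = VL (dX V1) (dX V2) := by
  rw [flow_apply, PL, extD_mono, extD_mono, eulD_mono]
  simp [mono, QL, VL, add_mul, AddMonoidAlgebra.single_mul_single]

theorem flow_QL : flow dX dY V1 V2 (QL V1 V2) = VL (dY V1) (dY V2) := by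
  have h := congrArg (flow dX dY V1 V2) (PL_QL V1 V2)
  rw [Derivation.leibniz, flow_PL, flow_apply dX dY V1 V2 (VL V1 V2)] at h
  have e1 : ∀ D : Derivation ℂ R R, extD (ℤ × ℕ) D (VL V1 V2) = VL (D V1) (D V2) := by
    intro D; rw [VL, map_add, extD_mono, extD_mono]; rfl
  have e2 : eulD R (AddMonoidHom.fst ℤ ℕ) (VL V1 V2) = 0 := by
    rw [VL, map_add, eulD_mono, eulD_mono]; simp [mono]
  rw [e1, e1, e2] at h
  simp only [smul_eq_mul, mul_zero, add_zero] at h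
  apply PL_cancel
  linear_combination h

theorem QL_mul_coeff (a b : R) (f : Lau R) (j : ℤ) (n : ℕ) :
    (QL a b * f).coeff (j+1, n) = a * f.coeff (j+2, n) + if 2 ≤ n then b * f.coeff (j+2, n-2) else 0 := by
  rw [QL, add_mul, AddMonoidAlgebra.coeff_add, Finsupp.add_apply, mono_mul_coeff, mono_mul_coeff2,
    show j + 1 - -1 = j + 2 by ring]

theorem flow_coeff (f : Lau R) (j : ℤ) (n : ℕ) : (flow dX dY V1 V2 f).coeff (j+1, n) =
    dY (f.coeff (j,n)) + (V1 * dX (f.coeff (j+2,n)) + ((j+2 : ℤ) : R) * (dX V1 * f.coeff (j+2,n)))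
     + if 2 ≤ n then (V2 * dX (f.coeff (j+2,n-2)) + ((j+2 : ℤ) : R) * (dX V2 * f.coeff (j+2,n-2))) else 0 := by
  rw [flow_apply, AddMonoidAlgebra.coeff_add, AddMonoidAlgebra.coeff_add, Finsupp.add_apply, Finsupp.add_apply,
    QL_mul_coeff, QL_mul_coeff, PL, mono_mul_coeff]
  simp only [eulD_coeff, extD_coeff, add_sub_cancel_right, AddMonoidHom.coe_fst]
  split_ifs <;> ring

theorem flow_triv (f : Lau R) (hf : flow dX dY V1 V2 f = 0)
    (triv : ∀ A : ℤ → R, (∃ N : ℕ, ∀ j : ℤ, (N:ℤ) < |j| → A j = 0) →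
      (∀ j, dY (A j) + (V1 * dX (A (j+2)) + ((j+2 : ℤ) : R) * (dX V1 * A (j+2))) = 0) →
      (∀ j, j ≠ 0 → A j = 0) ∧ dX (A 0) = 0 ∧ dY (A 0) = 0) (n : ℕ) :
    (∀ j, j ≠ 0 → f.coeff (j,n) = 0) ∧ dX (f.coeff (0,n)) = 0 ∧ dY (f.coeff (0,n)) = 0 := by
  induction n using Nat.strong_induction_on with
  | _ n ih =>
    apply triv (fun j => f.coeff (j,n))
    · refine ⟨f.coeff.support.sup fun m => (m.1).natAbs, fun j hj => ?_⟩
      by_contra h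
      have := Finset.le_sup (f := fun m : ℤ × ℕ => (m.1).natAbs) (Finsupp.mem_support_iff.mpr h)
      simp only at this
      rw [Int.abs_eq_natAbs] at hj
      omega
    · intro j
      have h := flow_coeff dX dY V1 V2 f j n
      rw [hf] at h
      have h2 : (if 2 ≤ n then (V2 * dX (f.coeff (j+2,n-2)) + ((j+2 : ℤ) : R) * (dX V2 * f.coeff (j+2,n-2))) else 0) = 0 := by
        split_ifs with hn
        · obtain ⟨i1, i2, i3⟩ := ih (n-2) (by omega)
          by_cases hj : j + 2 = 0
          · rw [hj, i2]; simp
          · rw [i1 _ hj]; simp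
        · rfl
      rw [h2, add_zero] at h
      exact h.symm

end flow
end ZV

namespace ZV
open scoped ContDiff
open TopologicalSpace

section general
variable {Ω : Opens ℂ}

theorem Sm.exists_inv (f : Sm ℝ Ω) (h : ∀ z, f.1 z ≠ 0) : ∃ g : Sm ℝ Ω, f * g = 1 := by
  refine ⟨Sm.of (fun z => (ext0 f.1 z)⁻¹) (ContDiffOn.inv f.2 ?_), ?_⟩
  · intro z hz
    have := ext0_of_mem f.1 ⟨z, hz⟩
    simp only at this
    rw [this]; exact h _
  · apply Sm.ext
    intro z
    simp only [Subalgebra.coe_mul, Pi.mul_apply, Sm.of_val, ext0_of_mem]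
    rw [mul_inv_cancel₀ (h z)]; rfl

theorem Sm.dir_comm (u v : ℂ) (f : Sm ℝ Ω) : Sm.dir u (Sm.dir v f) = Sm.dir v (Sm.dir u f) := by
  apply Sm.ext
  intro z
  rw [Sm.dir_of u (Sm.dir v f) (fun z => fderiv ℝ (ext0 f.1) z v) (fun z => rfl),
    Sm.dir_of v (Sm.dir u f) (fun z => fderiv ℝ (ext0 f.1) z u) (fun z => rfl)]
  have hc : ContDiffAt ℝ ∞ (ext0 f.1) z := f.2.contDiffAt (Ω.isOpen.mem_nhds z.2)
  have hd : DifferentiableAt ℝ (fderiv ℝ (ext0 f.1)) z :=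
    (hc.fderiv_right (m := ∞) (by simp)).differentiableAt (by simp)
  have hs : IsSymmSndFDerivAt ℝ (ext0 f.1) z := hc.isSymmSndFDerivAt (by simp; decide)
  rw [fderiv_clm_apply hd (by fun_prop), fderiv_clm_apply hd (by fun_prop)]
  simp
  exact hs u v

/-- Wirtinger derivatives -/
def wX : Derivation ℂ (Sm ℝ Ω) (Sm ℝ Ω) := (1/2 : ℂ) • ((Sm.dir 1 : Derivation ℂ (Sm ℝ Ω) (Sm ℝ Ω)) - Complex.I • (Sm.dir Complex.I : Derivation ℂ (Sm ℝ Ω) (Sm ℝ Ω)))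
/-- conjugate Wirtinger derivative -/
def wY : Derivation ℂ (Sm ℝ Ω) (Sm ℝ Ω) := (1/2 : ℂ) • ((Sm.dir 1 : Derivation ℂ (Sm ℝ Ω) (Sm ℝ Ω)) + Complex.I • (Sm.dir Complex.I : Derivation ℂ (Sm ℝ Ω) (Sm ℝ Ω)))

theorem wX_apply (f : Sm ℝ Ω) : wX f = (1/2 : ℂ) • (Sm.dir 1 f - Complex.I • Sm.dir Complex.I f) := rfl
theorem wY_apply (f : Sm ℝ Ω) : wY f = (1/2 : ℂ) • (Sm.dir 1 f + Complex.I • Sm.dir Complex.I f) := rfl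

theorem w_comm (f : Sm ℝ Ω) : wX (wY f) = wY (wX f) := by
  simp only [wX_apply, wY_apply, map_add, map_sub, Derivation.map_smul]
  rw [Sm.dir_comm 1 Complex.I]
  module

/-- holomorphic coordinate -/
def eX : Sm ℝ Ω := Sm.of (fun z => z) contDiffOn_id
/-- antiholomorphic coordinate -/
def eY : Sm ℝ Ω := Sm.of (fun z => (starRingEnd ℂ) z) (Complex.conjCLE.contDiff.contDiffOn)

theorem dir_eX (v : ℂ) : Sm.dir v (eX : Sm ℝ Ω) = algebraMap ℂ _ v := by
  apply Sm.ext; intro z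
  rw [Sm.dir_of v eX (fun z => z) (fun z => rfl)]
  simp

theorem dir_eY (v : ℂ) : Sm.dir v (eY : Sm ℝ Ω) = algebraMap ℂ _ ((starRingEnd ℂ) v) := by
  apply Sm.ext; intro z
  rw [Sm.dir_of v eY (fun z => Complex.conjCLE z) (fun z => rfl)]
  rw [ContinuousLinearEquiv.fderiv]; rfl

theorem wX_eX : wX (eX : Sm ℝ Ω) = 1 := by
  rw [wX_apply, dir_eX, dir_eX, Algebra.smul_def, Algebra.smul_def, ← map_mul, ← map_sub, ← map_mul, Complex.I_mul_I]
  norm_num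
theorem wY_eX : wY (eX : Sm ℝ Ω) = 0 := by
  rw [wY_apply, dir_eX, dir_eX, Algebra.smul_def, Algebra.smul_def, ← map_mul, ← map_add, ← map_mul, Complex.I_mul_I]
  norm_num
theorem wX_eY : wX (eY : Sm ℝ Ω) = 0 := by
  rw [wX_apply, dir_eY, dir_eY, Algebra.smul_def, Algebra.smul_def, ← map_mul, ← map_sub, ← map_mul, Complex.conj_I, mul_neg, Complex.I_mul_I]
  norm_num
theorem wY_eY : wY (eY : Sm ℝ Ω) = 1 := by
  rw [wY_apply, dir_eY, dir_eY, Algebra.smul_def, Algebra.smul_def, ← map_mul, ← map_add, ← map_mul, Complex.conj_I, mul_neg, Complex.I_mul_I]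
  norm_num

theorem w_const (hΩ : Convex ℝ (Ω : Set ℂ)) (f : Sm ℝ Ω) (h1 : wX f = 0) (h2 : wY f = 0) (z z' : Ω) : f.1 z = f.1 z' := by
  have e1 : Sm.dir 1 f = 0 := by
    have : Sm.dir 1 f = wX f + wY f := by
      rw [wX_apply, wY_apply]; module
    rw [this, h1, h2, add_zero]
  have e2 : Sm.dir Complex.I f = 0 := by
    have : Complex.I • Sm.dir Complex.I f = wY f - wX f := by
      rw [wX_apply, wY_apply]; module
    rw [h1, h2, sub_zero] at this
    have h3 := congrArg (fun x => (-Complex.I) • x) this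
    simpa [smul_smul] using h3
  have := hΩ.is_const_of_fderivWithin_eq_zero (𝕜 := ℝ) (f := ext0 f.1) (f.2.differentiableOn (by simp)) (fun w hw => by
    rw [fderivWithin_of_isOpen Ω.isOpen hw]
    apply ContinuousLinearMap.ext
    intro v
    have t1 : fderiv ℝ (ext0 f.1) w 1 = 0 := congrArg (fun g : Sm ℝ Ω => g.1 ⟨w, hw⟩) e1
    have t2 : fderiv ℝ (ext0 f.1) w Complex.I = 0 := congrArg (fun g : Sm ℝ Ω => g.1 ⟨w, hw⟩) e2
    have hv : v = v.re • (1:ℂ) + v.im • Complex.I := by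
      simp [Complex.re_add_im]
    rw [hv, map_add, map_smul, map_smul, t1, t2]; simp) z.2 z'.2
  simpa [ext0_of_mem] using this

end general

/-- Taylor expansion at a point -/
def tau {Ω : Opens ℂ} (w : Ω) : Sm ℝ Ω →ₐ[ℂ] FF := tay wX (tay wY (Sm.ev w))

section tau
variable {Ω : Opens ℂ} (w : Ω)
open PowerSeries
theorem tau_dX (f : Sm ℝ Ω) : tau w (wX f) = dS (tau w f) := by
  unfold tau
  rw [dS]
  exact (tay_der wX _ f).symm

theorem tau_dY (f : Sm ℝ Ω) : tau w (wY f) = dT (tau w f) := by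
  ext1 n
  rw [coeff_dT]
  simp only [tau, tay_coeff]
  have : ∀ n : ℕ, wX^[n] (wY f) = wY (wX^[n] f) := by
    intro n
    induction n with
    | zero => rfl
    | succ n ih => rw [Function.iterate_succ_apply', Function.iterate_succ_apply', ih, w_comm]
  rw [this, ← tay_der]
  rw [PowerSeries.smul_eq_C_mul, PowerSeries.smul_eq_C_mul, Derivation.leibniz]
  simp

theorem tau_eX : tau w eX = iot (C w.1 + X) := by
  refine der_ext' _ _ ?_ ?_
  · have h1 := tau_dX w eX
    rw [wX_eX, map_one, dS] at h1
    have h2 := dS_iot (C w.1 + X)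
    rw [dS] at h2
    rw [← h1, h2]
    simp
  · rw [tau, tay_const]
    have h3 : constantCoeff (iot (C w.1 + X)) = C w.1 := by
      simp [iot]
    rw [h3]
    refine der_ext' _ _ ?_ ?_
    · rw [tay_der, wY_eX]; simp
    · rw [tay_const, Sm.ev_apply]; simp [eX, Sm.of_val]
theorem tau_eY : tau w eY = C (C ((starRingEnd ℂ) w.1) + X) := by
  refine der_ext' _ _ ?_ ?_
  · have h1 := tau_dX w eY
    rw [wX_eY, map_zero, dS] at h1
    have h2 := dS_C (C ((starRingEnd ℂ) w.1) + X)
    rw [dS] at h2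
    rw [← h1, h2]
  · rw [tau, tay_const]
    rw [PowerSeries.constantCoeff_C]
    refine der_ext' _ _ ?_ ?_
    · rw [tay_der, wY_eY]; simp
    · rw [tay_const, Sm.ev_apply]; simp only [eY, map_add, PowerSeries.constantCoeff_C, PowerSeries.constantCoeff_X, add_zero]; rfl

theorem tau_zero (f : Sm ℝ Ω) (h : tau w f = 0) : f.1 w = 0 := by
  have h1 : constantCoeff (tau w f) = 0 := by rw [h]; simp
  have h2 : constantCoeff (tay wY (Sm.ev w) f) = 0 := by
    rw [tau, tay_const] at h1; rw [h1]; simp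
  rw [tay_const] at h2
  exact h2
end tau
end ZV

namespace ZV
open scoped ContDiff
open TopologicalSpace

/-- the box -/
def Bx : Opens ℂ := ⟨{w | (4/5 < w.re ∧ w.re < 9/10) ∧ (4/5 < w.im ∧ w.im < 9/10)}, by
  refine IsOpen.inter (IsOpen.inter ?_ ?_) (IsOpen.inter ?_ ?_)
  · exact isOpen_lt continuous_const Complex.continuous_re
  · exact isOpen_lt Complex.continuous_re continuous_const
  · exact isOpen_lt continuous_const Complex.continuous_im
  · exact isOpen_lt Complex.continuous_im continuous_const⟩

theorem mem_Bx (w : ℂ) : w ∈ Bx ↔ (4/5 < w.re ∧ w.re < 9/10) ∧ (4/5 < w.im ∧ w.im < 9/10) := Iff.rfl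

theorem convex_Bx : Convex ℝ (Bx : Set ℂ) := by
  intro a ha b hb s t hs ht hst
  obtain ⟨⟨a1, a2⟩, a3, a4⟩ := ha
  obtain ⟨⟨b1, b2⟩, b3, b4⟩ := hb
  have ht' : t = 1 - s := by linarith
  have key : ∀ u v lo hi : ℝ, lo < u → u < hi → lo < v → v < hi → lo < s * u + t * v ∧ s * u + t * v < hi := by
    intro u v lo hi h1 h2 h3 h4
    rcases hs.eq_or_lt with h | h
    · have : t = 1 := by linarith
      rw [← h, this]; constructor <;> linarith
    · have q1 := mul_pos h (sub_pos.2 h1)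
      have q2 := mul_pos h (sub_pos.2 h2)
      have q3 := mul_nonneg ht (sub_pos.2 h3).le
      have q4 := mul_nonneg ht (sub_pos.2 h4).le
      subst ht'
      constructor <;> nlinarith
  have k1 := key _ _ _ _ a1 a2 b1 b2
  have k2 := key _ _ _ _ a3 a4 b3 b4
  show (_ ∧ _) ∧ (_ ∧ _)
  simpa using ⟨k1, k2⟩

section triv
open PowerSeries

theorem triv_Bx (μ : ℂ) (hμ : μ ≠ 0) (gX gY V1 : Sm ℝ Bx)
    (hX : eX^3 * (eX^4 - 1)^3 * gX = 1) (hY : eY^3 * (eY^4 - 1)^3 * gY = 1)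
    (hV : V1 = algebraMap ℂ _ μ * (1 + eX * eY)^16 * gX * gY)
    (A : ℤ → Sm ℝ Bx) (hfin : ∃ N : ℕ, ∀ j : ℤ, (N:ℤ) < |j| → A j = 0)
    (hA : ∀ j, wY (A j) + (V1 * wX (A (j+2)) + ((j+2 : ℤ) : Sm ℝ Bx) * (wX V1 * A (j+2))) = 0) :
    (∀ j, j ≠ 0 → A j = 0) ∧ wX (A 0) = 0 ∧ wY (A 0) = 0 := by
  have inv : ∀ (z : ℂ), z^3 * (z^4-1)^3 ≠ 0 → ∃ r : PowerSeries ℂ, (C z + X)^3 * ((C z + X)^4 - 1)^3 * r = 1 := by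
    intro z hz
    exact ⟨((C z + X)^3 * ((C z + X)^4 - 1)^3)⁻¹, PowerSeries.mul_inv_cancel _ (by simpa using hz)⟩
  have main : ∀ w : Bx, (∀ j, j ≠ 0 → tau w (A j) = 0) ∧ ∃ c : ℂ, tau w (A 0) = iot (C c) := by
    intro w
    set Y0 : ℂ := (starRingEnd ℂ) w.1 with hY0
    have nX : w.1^3 * (w.1^4-1)^3 ≠ 0 := by
      have := congrArg (Sm.ev w) hX
      rw [map_mul, map_mul, map_pow, map_pow, map_sub, map_pow, map_one] at this
      exact left_ne_zero_of_mul (ne_of_eq_of_ne this one_ne_zero)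
    have nY : Y0^3 * (Y0^4-1)^3 ≠ 0 := by
      have := congrArg (Sm.ev w) hY
      rw [map_mul, map_mul, map_pow, map_pow, map_sub, map_pow, map_one] at this
      exact left_ne_zero_of_mul (ne_of_eq_of_ne this one_ne_zero)
    obtain ⟨r, hr⟩ := inv _ nX
    obtain ⟨gy, hgy⟩ := inv _ nY
    have tX : tau w gX = iot r := by
      have h1 := congrArg (tau w) hX
      have h2 := congrArg iot hr
      simp only [map_mul, map_pow, map_sub, map_one, tau_eX] at h1
      simp only [map_mul, map_pow, map_sub, map_one] at h2
      generalize (iot (C w.1 + X)) ^ 3 * ((iot (C w.1 + X)) ^ 4 - 1)^3 = u at h1 h2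
      linear_combination (-(iot r) * h1 + tau w gX * h2) * (-1 : FF)
    have tY : tau w gY = C gy := by
      have h1 := congrArg (tau w) hY
      have h2 := congrArg (C (R := PowerSeries ℂ)) hgy
      simp only [map_mul, map_pow, map_sub, map_one, tau_eY, ← hY0] at h1
      simp only [map_mul, map_pow, map_sub, map_one] at h2
      generalize (C (C Y0 + X) : FF) ^ 3 * ((C (C Y0 + X) : FF) ^ 4 - 1)^3 = u at h1 h2
      linear_combination (-(C gy) * h1 + tau w gY * h2) * (-1 : FF)
    have tV : tau w V1 = Vf μ w.1 Y0 r gy := by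
      rw [hV, Vf, map_mul, map_mul, map_mul, map_pow, map_add, map_mul, map_one, tX, tY, tau_eX, tau_eY]
      congr 3
      rw [AlgHom.commutes]
      simp [iot, PowerSeries.algebraMap_apply]
    obtain ⟨⟨a1, a2⟩, a3, a4⟩ := (mem_Bx _).mp w.2
    have re0 : Y0.re = w.1.re := by simp [hY0]
    have im0 : Y0.im = - w.1.im := by simp [hY0]
    have nrm : ∀ z : ℂ, z.re^2 + z.im^2 < 1 → ‖z‖ < 1 := by
      intro z hz
      rw [← sq_lt_one_iff₀ (norm_nonneg z), ← Complex.normSq_eq_norm_sq, Complex.normSq_apply]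
      nlinarith
    refine formal_V1 μ w.1 Y0 hμ r gy hr hgy ?_ ?_ ?_ ?_ (fun j => tau w (A j)) ?_ ?_
    · intro h; have := congrArg Complex.re h; rw [re0] at this; simp at this; linarith
    · apply nrm
      simp only [Complex.sub_re, Complex.sub_im, re0, im0, Complex.one_re, Complex.one_im]
      nlinarith
    · intro h; have := congrArg Complex.re h; rw [re0] at this; simp at this; linarith
    · apply nrm
      simp only [Complex.add_re, Complex.add_im, re0, im0, Complex.I_re, Complex.I_im]
      nlinarith
    · obtain ⟨N, hN⟩ := hfin
      exact ⟨N, fun j hj => by simp only [hN j hj, map_zero]⟩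
    · intro j
      have := congrArg (tau w) (hA j)
      simp only [map_add, map_mul, tau_dX, tau_dY, tV, map_zero, map_intCast] at this
      rw [LV]
      exact this
  refine ⟨fun j hj => ?_, ?_, ?_⟩
  · exact Sm.ext fun w => tau_zero w _ ((main w).1 j hj)
  · refine Sm.ext fun w => tau_zero w _ ?_
    obtain ⟨c, hc⟩ := (main w).2
    rw [tau_dX, hc, dS_iot]; simp
  · refine Sm.ext fun w => tau_zero w _ ?_
    obtain ⟨c, hc⟩ := (main w).2
    rw [tau_dY, hc, dT_iot]
end triv
end ZV

namespace ZV
open scoped ContDiff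
open TopologicalSpace

/-- base domain in the `(x,y)` plane -/
def U2 : Set (ℝ × ℝ) := {p | 1 < p.1 ∧ -1 < p.2 ∧ p.2 < 1}

theorem isOpen_U2 : IsOpen U2 :=
  (isOpen_lt continuous_const continuous_fst).inter
    ((isOpen_lt continuous_const continuous_snd).inter (isOpen_lt continuous_snd continuous_const))

/-- the coordinate change -/
def xyw (w : ℂ) : ℝ × ℝ :=
  ((Complex.normSq w + (Complex.normSq w)⁻¹) / 2, (w.re^2 - w.im^2) * (Complex.normSq w)⁻¹)

theorem normSq_gt {w : ℂ} (hw : w ∈ Bx) : 1 < Complex.normSq w := by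
  obtain ⟨⟨a1, a2⟩, a3, a4⟩ := (mem_Bx _).mp hw
  rw [Complex.normSq_apply]; nlinarith

theorem xyw_mem {w : ℂ} (hw : w ∈ Bx) : xyw w ∈ U2 := by
  have hN := normSq_gt hw
  obtain ⟨⟨a1, a2⟩, a3, a4⟩ := (mem_Bx _).mp hw
  have hN2 : Complex.normSq w = w.re^2 + w.im^2 := by rw [Complex.normSq_apply]; ring
  have hN0 : 0 < Complex.normSq w := by linarith
  refine ⟨?_, ?_, ?_⟩
  · show 1 < (Complex.normSq w + (Complex.normSq w)⁻¹) / 2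
    have : Complex.normSq w + (Complex.normSq w)⁻¹ - 2 = (Complex.normSq w - 1)^2 / Complex.normSq w := by field_simp; ring
    have : 0 < (Complex.normSq w - 1)^2 / Complex.normSq w := div_pos (pow_pos (by linarith) 2) hN0
    linarith
  · show -1 < (w.re^2 - w.im^2) * (Complex.normSq w)⁻¹
    rw [← div_eq_mul_inv, lt_div_iff₀ hN0, hN2]; nlinarith
  · show (w.re^2 - w.im^2) * (Complex.normSq w)⁻¹ < 1
    rw [← div_eq_mul_inv, div_lt_iff₀ hN0, hN2]; nlinarith

theorem xyw_smooth : ContDiffOn ℝ ∞ xyw Bx := by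
  have h1 : ContDiff ℝ ∞ (fun w : ℂ => w.re) := Complex.reCLM.contDiff
  have h2 : ContDiff ℝ ∞ (fun w : ℂ => w.im) := Complex.imCLM.contDiff
  have hN : ContDiff ℝ ∞ (fun w : ℂ => Complex.normSq w) := by
    have : (fun w : ℂ => Complex.normSq w) = fun w => w.re * w.re + w.im * w.im := by
      ext w; rw [Complex.normSq_apply]
    rw [this]; fun_prop
  have hi : ContDiffOn ℝ ∞ (fun w : ℂ => (Complex.normSq w)⁻¹) Bx :=
    hN.contDiffOn.inv fun w hw => by have := normSq_gt hw; linarith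
  unfold xyw
  refine ContDiffOn.prodMk ?_ ?_
  · exact (hN.contDiffOn.add hi).div_const 2
  · exact (((h1.pow 2).sub (h2.pow 2)).contDiffOn).mul hi

/-- smooth real functions of `(x,y)` -/
def SmU : Type := {g : ℝ × ℝ → ℝ // ContDiffOn ℝ ∞ g U2}

/-- partial derivatives -/
def SmU.pd (v : ℝ × ℝ) (g : SmU) : SmU :=
  ⟨fun p => fderiv ℝ g.1 p v, (g.2.fderiv_of_isOpen isOpen_U2 (m := ∞) (by simp)).clm_apply contDiffOn_const⟩

/-- pull-back to the box -/
def Gs (g : SmU) : Sm ℝ Bx := Sm.of (fun w => ((g.1 (xyw w) : ℝ) : ℂ))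
  (Complex.ofRealCLM.contDiff.comp_contDiffOn (g.2.comp xyw_smooth fun _ hw => xyw_mem hw))

theorem Gs_val (g : SmU) (w : Bx) : (Gs g).1 w = ((g.1 (xyw w) : ℝ) : ℂ) := rfl

/-- coordinate functions -/
def sx : SmU := ⟨Prod.fst, contDiffOn_fst⟩
/-- coordinate functions -/
def sy : SmU := ⟨Prod.snd, contDiffOn_snd⟩

theorem Gs_dir (v : ℂ) (g : SmU) : Sm.dir v (Gs g) =
    Gs (g.pd (1,0)) * Sm.dir v (Gs sx) + Gs (g.pd (0,1)) * Sm.dir v (Gs sy) := by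
  apply Sm.ext
  intro w
  have hg : DifferentiableAt ℝ g.1 (xyw w) :=
    (g.2.contDiffAt (isOpen_U2.mem_nhds (xyw_mem w.2))).differentiableAt (by simp)
  have hx : DifferentiableAt ℝ xyw w :=
    (xyw_smooth.contDiffAt (Bx.isOpen.mem_nhds w.2)).differentiableAt (by simp)
  have key : ∀ (g : SmU), DifferentiableAt ℝ g.1 (xyw w) → (Sm.dir v (Gs g)).1 w = ((fderiv ℝ g.1 (xyw w) (fderiv ℝ xyw w v) : ℝ) : ℂ) := by
    intro g hg
    rw [Sm.dir_of v (Gs g) (fun w => ((g.1 (xyw w) : ℝ) : ℂ)) (fun w => rfl)]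
    have := (Complex.ofRealCLM.hasFDerivAt.comp (w:ℂ) (hg.hasFDerivAt.comp (w:ℂ) hx.hasFDerivAt)).fderiv
    have e : (fun w => ((g.1 (xyw w) : ℝ) : ℂ)) = ⇑Complex.ofRealCLM ∘ g.1 ∘ xyw := rfl
    rw [e, this]; rfl
  simp only [Subalgebra.coe_add, Subalgebra.coe_mul, Pi.add_apply, Pi.mul_apply]
  rw [key g hg, key sx differentiableAt_fst, key sy differentiableAt_snd, Gs_val, Gs_val]
  have e1 : fderiv ℝ sx.1 (xyw w) = ContinuousLinearMap.fst ℝ ℝ ℝ := fderiv_fst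
  have e2 : fderiv ℝ sy.1 (xyw w) = ContinuousLinearMap.snd ℝ ℝ ℝ := fderiv_snd
  rw [e1, e2]
  generalize fderiv ℝ xyw w v = u
  simp only [ContinuousLinearMap.coe_fst', ContinuousLinearMap.coe_snd', SmU.pd]
  have : u = u.1 • ((1:ℝ),(0:ℝ)) + u.2 • ((0:ℝ),(1:ℝ)) := by ext <;> simp
  conv_lhs => rw [this]
  rw [map_add, map_smul, map_smul]
  push_cast [smul_eq_mul]
  ring

theorem Gs_wX (g : SmU) : wX (Gs g) =
    Gs (g.pd (1,0)) * wX (Gs sx) + Gs (g.pd (0,1)) * wX (Gs sy) := by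
  rw [wX_apply, wX_apply, wX_apply, Gs_dir 1 g, Gs_dir Complex.I g]
  simp only [Algebra.smul_def]; ring

theorem Gs_wY (g : SmU) : wY (Gs g) =
    Gs (g.pd (1,0)) * wY (Gs sx) + Gs (g.pd (0,1)) * wY (Gs sy) := by
  rw [wY_apply, wY_apply, wY_apply, Gs_dir 1 g, Gs_dir Complex.I g]
  simp only [Algebra.smul_def]; ring
end ZV

namespace ZV
open scoped ContDiff
open TopologicalSpace

/-- inverse of `XY` -/
def iN : Sm ℝ Bx := Sm.of (fun w => w⁻¹ * ((starRingEnd ℂ) w)⁻¹) (by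
  have h : ∀ w ∈ (Bx : Set ℂ), w ≠ 0 := fun w hw h0 => by
    have := normSq_gt hw; rw [h0] at this; simp at this; linarith
  refine ContDiffOn.mul (contDiffOn_id.inv h) ((Complex.conjCLE.contDiff.contDiffOn).inv fun w hw => ?_)
  simpa using h w hw)

theorem ne0_Bx (w : Bx) : (w : ℂ) ≠ 0 := fun h0 => by
    have := normSq_gt w.2; rw [h0] at this; simp at this; linarith

/-- scalar -/
abbrev kk (c : ℂ) : Sm ℝ Bx := algebraMap ℂ (Sm ℝ Bx) c
theorem kk_val (c : ℂ) (w : Bx) : (kk c).1 w = c := rfl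
theorem iN_val (w : Bx) : iN.1 w = (w:ℂ)⁻¹ * ((starRingEnd ℂ) (w:ℂ))⁻¹ := rfl
theorem eX_val (w : Bx) : (eX : Sm ℝ Bx).1 w = (w:ℂ) := rfl
theorem eY_val (w : Bx) : (eY : Sm ℝ Bx).1 w = (starRingEnd ℂ) (w:ℂ) := rfl

theorem iN_mul : eX * eY * iN = (1 : Sm ℝ Bx) := by
  apply Sm.ext; intro w
  have h := ne0_Bx w
  have h2 : (starRingEnd ℂ) (w:ℂ) ≠ 0 := by simpa using h
  show (w:ℂ) * (starRingEnd ℂ) (w:ℂ) * ((w:ℂ)⁻¹ * ((starRingEnd ℂ) (w:ℂ))⁻¹) = 1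
  field_simp

/-- hyperbolic sine -/
def sh : Sm ℝ Bx := kk (1/2) * (eX * eY - iN)
/-- sine -/
def sn : Sm ℝ Bx := kk (-Complex.I/2) * ((eX^2 - eY^2) * iN)

theorem Gs_sx : Gs sx = kk (1/2) * (eX * eY + iN) := by
  apply Sm.ext; intro w
  show (((Complex.normSq w + (Complex.normSq w)⁻¹) / 2 : ℝ) : ℂ) = (1/2) * ((w:ℂ) * (starRingEnd ℂ) (w:ℂ) + (w:ℂ)⁻¹ * ((starRingEnd ℂ) (w:ℂ))⁻¹)
  rw [← mul_inv, Complex.mul_conj]; push_cast; ring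

theorem Gs_sy : Gs sy = kk (1/2) * ((eX^2 + eY^2) * iN) := by
  apply Sm.ext; intro w
  show ((((w:ℂ).re^2 - (w:ℂ).im^2) * (Complex.normSq w)⁻¹ : ℝ) : ℂ) = (1/2) * (((w:ℂ)^2 + (starRingEnd ℂ) (w:ℂ)^2) * ((w:ℂ)⁻¹ * ((starRingEnd ℂ) (w:ℂ))⁻¹))
  rw [← mul_inv, Complex.mul_conj]
  have : (w:ℂ)^2 + (starRingEnd ℂ) (w:ℂ)^2 = ((2 * ((w:ℂ).re^2 - (w:ℂ).im^2) : ℝ) : ℂ) := by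
    apply Complex.ext <;> simp [pow_two] <;> ring
  rw [this]; push_cast; ring

theorem sh_val (w : Bx) : sh.1 w = (((Complex.normSq w - (Complex.normSq w)⁻¹) / 2 : ℝ) : ℂ) := by
  show (1/2) * ((w:ℂ) * (starRingEnd ℂ) (w:ℂ) - (w:ℂ)⁻¹ * ((starRingEnd ℂ) (w:ℂ))⁻¹) = _
  rw [← mul_inv, Complex.mul_conj]; push_cast; ring

theorem sn_val (w : Bx) : sn.1 w = ((2 * (w:ℂ).re * (w:ℂ).im * (Complex.normSq w)⁻¹ : ℝ) : ℂ) := by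
  show (-Complex.I/2) * (((w:ℂ)^2 - (starRingEnd ℂ) (w:ℂ)^2) * ((w:ℂ)⁻¹ * ((starRingEnd ℂ) (w:ℂ))⁻¹)) = _
  rw [← mul_inv, Complex.mul_conj]
  have : -Complex.I/2 * ((w:ℂ)^2 - (starRingEnd ℂ) (w:ℂ)^2) = ((2 * (w:ℂ).re * (w:ℂ).im : ℝ) : ℂ) := by
    apply Complex.ext <;> simp [pow_two] ; ring
  rw [← mul_assoc, this]; push_cast; ring

theorem wX_iN : eX * wX iN = - iN := by
  have h := congrArg wX iN_mul
  simp only [Derivation.leibniz, wX_eX, wX_eY, smul_eq_mul, Derivation.map_one_eq_zero] at h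
  linear_combination (eX * iN) * h - (iN + eX * wX iN) * iN_mul
theorem wY_iN : eY * wY iN = - iN := by
  have h := congrArg wY iN_mul
  simp only [Derivation.leibniz, wY_eX, wY_eY, smul_eq_mul, Derivation.map_one_eq_zero] at h
  linear_combination (eY * iN) * h - (iN + eY * wY iN) * iN_mul

theorem kk_der (D : Derivation ℂ (Sm ℝ Bx) (Sm ℝ Bx)) (c : ℂ) (f) : D (kk c * f) = kk c * D f := by
  rw [Derivation.leibniz]; simp

theorem kI : kk Complex.I * kk Complex.I = -1 := by
  rw [← map_mul, Complex.I_mul_I]; simp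

theorem kh : kk (-Complex.I/2) = - kk Complex.I * kk (1/2) := by
  rw [← map_neg, ← map_mul]; congr 1; ring

theorem kh2 : 2 * kk (1/2) = 1 := by
  have : (2 : Sm ℝ Bx) = kk 2 := (map_ofNat (algebraMap ℂ (Sm ℝ Bx)) 2).symm
  rw [this, ← map_mul]; norm_num

theorem X_x : eX * wX (Gs sx) = sh := by
  rw [Gs_sx, sh, kk_der, map_add, Derivation.leibniz, wX_eX, wX_eY, smul_eq_mul, smul_eq_mul]
  linear_combination kk (1/2) * wX_iN
theorem Y_x : eY * wY (Gs sx) = sh := by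
  rw [Gs_sx, sh, kk_der, map_add, Derivation.leibniz, wY_eX, wY_eY, smul_eq_mul, smul_eq_mul]
  linear_combination kk (1/2) * wY_iN
theorem X_sh : eX * wX sh = Gs sx := by
  rw [Gs_sx, sh, kk_der, map_sub, Derivation.leibniz, wX_eX, wX_eY, smul_eq_mul, smul_eq_mul]
  linear_combination - kk (1/2) * wX_iN
theorem Y_sh : eY * wY sh = Gs sx := by
  rw [Gs_sx, sh, kk_der, map_sub, Derivation.leibniz, wY_eX, wY_eY, smul_eq_mul, smul_eq_mul]
  linear_combination - kk (1/2) * wY_iN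
theorem X_y : eX * wX (Gs sy) = kk Complex.I * sn := by
  rw [Gs_sy, sn, kk_der, kh]
  simp only [Derivation.leibniz, Derivation.leibniz_pow, map_add, wX_eX, wX_eY, smul_eq_mul, nsmul_eq_mul]
  push_cast
  linear_combination kk (1/2) * (eX^2+eY^2) * wX_iN + kk (1/2) * (eX^2 - eY^2) * iN * kI
theorem Y_y : eY * wY (Gs sy) = - (kk Complex.I * sn) := by
  rw [Gs_sy, sn, kk_der, kh]
  simp only [Derivation.leibniz, Derivation.leibniz_pow, map_add, wY_eX, wY_eY, smul_eq_mul, nsmul_eq_mul]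
  push_cast
  linear_combination kk (1/2) * (eX^2+eY^2) * wY_iN - kk (1/2) * (eX^2 - eY^2) * iN * kI
theorem X_sn : eX * wX sn = - (kk Complex.I * Gs sy) := by
  rw [Gs_sy, sn, kk_der, kh]
  simp only [Derivation.leibniz, Derivation.leibniz_pow, map_sub, wX_eX, wX_eY, smul_eq_mul, nsmul_eq_mul]
  push_cast
  linear_combination - kk Complex.I * kk (1/2) * (eX^2-eY^2) * wX_iN
theorem Y_sn : eY * wY sn = kk Complex.I * Gs sy := by
  rw [Gs_sy, sn, kk_der, kh]
  simp only [Derivation.leibniz, Derivation.leibniz_pow, map_sub, wY_eX, wY_eY, smul_eq_mul, nsmul_eq_mul]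
  push_cast
  linear_combination - kk Complex.I * kk (1/2) * (eX^2-eY^2) * wY_iN

theorem X_g (g : SmU) : eX * wX (Gs g) = Gs (g.pd (1,0)) * sh + Gs (g.pd (0,1)) * (kk Complex.I * sn) := by
  rw [Gs_wX]; linear_combination Gs (g.pd (1,0)) * X_x + Gs (g.pd (0,1)) * X_y
theorem Y_g (g : SmU) : eY * wY (Gs g) = Gs (g.pd (1,0)) * sh - Gs (g.pd (0,1)) * (kk Complex.I * sn) := by
  rw [Gs_wY]; linear_combination Gs (g.pd (1,0)) * Y_x + Gs (g.pd (0,1)) * Y_y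
end ZV

namespace ZV
open scoped ContDiff
open TopologicalSpace

/-- abstract computation of the flow of the momenta -/
theorem mom_flow {L : Type*} [CommRing L] [Algebra ℂ L] (D : Derivation ℂ L L)
    (X Y P Q x y s n i V VX VY T Tx Ty px py : L) (hi : i * i = -1) (hDi : D i = 0)
    (hX : D X = Q) (hY : D Y = P) (hP : D P = VX) (hQ : D Q = VY) (hPQ : P * Q = V) (hT : X * Y * V = T)
    (hs : X * Y * D s = x * (X * P + Y * Q)) (hn : X * Y * D n = i * y * (X * P - Y * Q))
    (hTX : X * Y * (X * VX) + T = Tx * s + Ty * (i * n))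
    (hTY : X * Y * (Y * VY) + T = Tx * s - Ty * (i * n))
    (hpx : 2 * s * px = X * P + Y * Q) (hpy : 2 * i * n * py = X * P - Y * Q)
    (us : ∀ a b : L, 2 * s * a = 2 * s * b → a = b) (un : ∀ a b : L, 2 * i * n * a = 2 * i * n * b → a = b) :
    X * Y * D px = Tx - 2 * x * px^2 ∧ X * Y * D py = Ty + 2 * y * py^2 := by
  have d2 : D (2:L) = 0 := by
    have : (2 : L) = algebraMap ℂ L 2 := (map_ofNat (algebraMap ℂ L) 2).symm
    rw [this, Derivation.map_algebraMap]
  constructor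
  · have h := congrArg D hpx
    simp only [Derivation.leibniz, map_add, smul_eq_mul, hX, hY, hP, hQ, d2] at h
    apply us
    linear_combination (X * Y) * h + hTX + hTY - 2 * px * hs + 2 * X * Y * hPQ + 2 * hT - 2 * x * px * (-hpx)
  · have h := congrArg D hpy
    simp only [Derivation.leibniz, map_sub, smul_eq_mul, hX, hY, hP, hQ, d2, hDi] at h
    apply un
    linear_combination (X * Y) * h + hTX - hTY - 2 * i * py * hn - 2 * y * py * i * i * (-hpy) + (4 * i * n * y * py^2) * (-hi)

theorem exists_ish : ∃ g : Sm ℝ Bx, sh * g = 1 := by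
  apply Sm.exists_inv
  intro w
  rw [sh_val]
  have h := normSq_gt w.2
  have : (Complex.normSq w)⁻¹ < 1 := inv_lt_one_of_one_lt₀ h
  exact_mod_cast (by linarith : (0:ℝ) < (Complex.normSq w - (Complex.normSq w)⁻¹) / 2).ne'

theorem exists_isn : ∃ g : Sm ℝ Bx, sn * g = 1 := by
  apply Sm.exists_inv
  intro w
  rw [sn_val]
  have h := normSq_gt w.2
  obtain ⟨⟨a1, a2⟩, a3, a4⟩ := (mem_Bx _).mp w.2
  have : 0 < 2 * (w:ℂ).re * (w:ℂ).im * (Complex.normSq w)⁻¹ := by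
    have : 0 < (Complex.normSq w)⁻¹ := by positivity
    have h1 : 0 < (w:ℂ).re := by linarith
    have h2 : 0 < (w:ℂ).im := by linarith
    positivity
  exact_mod_cast this.ne'

/-- inverse of `sh` -/
def ish : Sm ℝ Bx := exists_ish.choose
/-- inverse of `sn` -/
def isn : Sm ℝ Bx := exists_isn.choose
theorem sh_ish : sh * ish = 1 := exists_ish.choose_spec
theorem sn_isn : sn * isn = 1 := exists_isn.choose_spec

section
variable (T1 T2 : SmU)

/-- momentum `Q` -/
abbrev Qm : Lau (Sm ℝ Bx) := QL (Gs T1 * iN) (Gs T2 * iN)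
/-- flow -/
abbrev XX : Derivation ℂ (Lau (Sm ℝ Bx)) (Lau (Sm ℝ Bx)) := flow wX wY (Gs T1 * iN) (Gs T2 * iN)
/-- `p_x` -/
def pxL : Lau (Sm ℝ Bx) := cst (kk (1/2) * ish) * (cst eX * PL _ + cst eY * Qm T1 T2)
/-- `p_y` -/
def pyL : Lau (Sm ℝ Bx) := cst (kk (-Complex.I/2) * isn) * (cst eX * PL _ - cst eY * Qm T1 T2)

theorem VL_eq {R : Type*} [CommRing R] [Algebra ℂ R] (a b : R) : VL a b = cst a + mono 0 2 1 * cst b := by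
  simp [VL, cst_apply, mono, AddMonoidAlgebra.single_mul_single]

theorem pxL_eq : 2 * cst sh * pxL T1 T2 = cst eX * PL _ + cst eY * Qm T1 T2 := by
  have h : (2 : Lau (Sm ℝ Bx)) * cst sh * cst (kk (1/2) * ish) = 1 := by
    have : (2 : Lau (Sm ℝ Bx)) = cst 2 := (map_ofNat cst 2).symm
    rw [this, ← map_mul, ← map_mul, ← map_one cst]
    congr 1
    linear_combination sh * ish * kh2 + sh_ish
  rw [pxL, ← mul_assoc, h, one_mul]

theorem pyL_eq : 2 * cst (kk Complex.I) * cst sn * pyL T1 T2 = cst eX * PL _ - cst eY * Qm T1 T2 := by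
  have h : (2 : Lau (Sm ℝ Bx)) * cst (kk Complex.I) * cst sn * cst (kk (-Complex.I/2) * isn) = 1 := by
    have : (2 : Lau (Sm ℝ Bx)) = cst 2 := (map_ofNat cst 2).symm
    rw [this, ← map_mul, ← map_mul, ← map_mul, ← map_one cst]
    congr 1
    rw [kh]
    linear_combination sn * isn * kh2 + sn_isn - sn * isn * 2 * kk (1/2) * kI
  rw [pyL, ← mul_assoc, h, one_mul]

theorem flow_fun (f a b : Sm ℝ Bx) (ha : eX * wX f = a) (hb : eY * wY f = b) :
    cst eX * cst eY * XX T1 T2 (cst f) = cst eX * PL _ * cst b + cst eY * Qm T1 T2 * cst a := by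
  rw [flow_cst, ← ha, ← hb, map_mul, map_mul]; ring

theorem flow_mom :
    cst eX * cst eY * XX T1 T2 (pxL T1 T2) = VL (Gs (T1.pd (1,0))) (Gs (T2.pd (1,0))) - 2 * cst (Gs sx) * pxL T1 T2 ^2 ∧
    cst eX * cst eY * XX T1 T2 (pyL T1 T2) = VL (Gs (T1.pd (0,1))) (Gs (T2.pd (0,1))) + 2 * cst (Gs sy) * pyL T1 T2 ^2 := by
  have key : ∀ T : SmU, eX * eY * (eX * wX (Gs T * iN)) + Gs T = Gs (T.pd (1,0)) * sh + Gs (T.pd (0,1)) * (kk Complex.I * sn) := by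
    intro T
    rw [← X_g T, Derivation.leibniz, smul_eq_mul, smul_eq_mul]
    linear_combination (eX * eY * Gs T) * wX_iN + (eX * wX (Gs T) - Gs T) * iN_mul
  have key2 : ∀ T : SmU, eX * eY * (eY * wY (Gs T * iN)) + Gs T = Gs (T.pd (1,0)) * sh - Gs (T.pd (0,1)) * (kk Complex.I * sn) := by
    intro T
    rw [← Y_g T, Derivation.leibniz, smul_eq_mul, smul_eq_mul]
    linear_combination (eX * eY * Gs T) * wY_iN + (eY * wY (Gs T) - Gs T) * iN_mul
  refine mom_flow (XX T1 T2) (cst eX) (cst eY) (PL _) (Qm T1 T2) (cst (Gs sx)) (cst (Gs sy)) (cst sh) (cst sn) (cst (kk Complex.I))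
    (VL (Gs T1 * iN) (Gs T2 * iN)) _ _ (VL (Gs T1) (Gs T2)) _ _ (pxL T1 T2) (pyL T1 T2)
    ?_ ?_ ?_ ?_ (flow_PL _ _ _ _) (flow_QL _ _ _ _) (PL_QL _ _) ?_ ?_ ?_ ?_ ?_ (pxL_eq T1 T2) (pyL_eq T1 T2) ?_ ?_
  · rw [← map_mul, kI, map_neg, map_one]
  · exact flow_lam _ _ _ _ _ 0
  · rw [flow_cst, wX_eX, wY_eX]; simp
  · rw [flow_cst, wX_eY, wY_eY]; simp
  · rw [VL_eq, VL_eq, map_mul, map_mul]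
    have h := congrArg cst iN_mul
    rw [map_mul, map_mul, map_one] at h
    linear_combination (cst (Gs T1) + mono 0 2 1 * cst (Gs T2)) * h
  · rw [flow_fun T1 T2 sh _ _ X_sh Y_sh]; ring
  · rw [flow_fun T1 T2 sn _ _ X_sn Y_sn]; simp only [map_mul, map_neg]; ring
  · have h1 := congrArg cst (key T1)
    have h2 := congrArg cst (key T2)
    simp only [VL_eq]
    simp only [map_mul, map_add] at h1 h2 ⊢
    linear_combination h1 + mono 0 2 1 * h2
  · have h1 := congrArg cst (key2 T1)
    have h2 := congrArg cst (key2 T2)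
    simp only [VL_eq]
    simp only [map_mul, map_add, map_sub] at h1 h2 ⊢
    linear_combination h1 + mono 0 2 1 * h2
  · intro a b h
    have h' : (2 : Lau (Sm ℝ Bx)) * cst sh * cst (kk (1/2) * ish) = 1 := by
      have : (2 : Lau (Sm ℝ Bx)) = cst 2 := (map_ofNat cst 2).symm
      rw [this, ← map_mul, ← map_mul, ← map_one cst]
      congr 1
      linear_combination sh * ish * kh2 + sh_ish
    linear_combination cst (kk (1/2) * ish) * h - (a - b) * h'
  · intro a b h
    have h' : (2 : Lau (Sm ℝ Bx)) * cst (kk Complex.I) * cst sn * cst (kk (-Complex.I/2) * isn) = 1 := by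
      have : (2 : Lau (Sm ℝ Bx)) = cst 2 := (map_ofNat cst 2).symm
      rw [this, ← map_mul, ← map_mul, ← map_mul, ← map_one cst]
      congr 1
      rw [kh]
      linear_combination sn * isn * kh2 + sn_isn - sn * isn * 2 * kk (1/2) * kI
    linear_combination cst (kk (-Complex.I/2) * isn) * h - (a - b) * h'

theorem flow_coef (g : SmU) : cst eX * cst eY * XX T1 T2 (cst (Gs g)) =
    2 * cst sh ^2 * pxL T1 T2 * cst (Gs (g.pd (1,0))) + 2 * cst sn ^2 * pyL T1 T2 * cst (Gs (g.pd (0,1))) := by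
  rw [flow_fun T1 T2 _ _ _ (X_g g) (Y_g g)]
  have h : cst (kk Complex.I) * cst (kk Complex.I) = (-1 : Lau (Sm ℝ Bx)) := by rw [← map_mul, kI, map_neg, map_one]
  simp only [map_mul, map_add, map_sub]
  linear_combination (- cst sh * cst (Gs (g.pd (1,0)))) * pxL_eq T1 T2 + (cst (kk Complex.I) * cst sn * cst (Gs (g.pd (0,1)))) * pyL_eq T1 T2 - 2 * cst sn ^2 * pyL T1 T2 * cst (Gs (g.pd (0,1))) * h

end
end ZV

namespace ZV
open scoped ContDiff
open TopologicalSpace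

/-- real value of `sh` -/
def shr (w : ℂ) : ℝ := (Complex.normSq w - (Complex.normSq w)⁻¹) / 2
/-- real value of `sn` -/
def snr (w : ℂ) : ℝ := 2 * w.re * w.im * (Complex.normSq w)⁻¹

theorem shr_sq {w : ℂ} (hw : w ∈ Bx) : shr w ^ 2 = (xyw w).1 ^ 2 - 1 := by
  have h := normSq_gt hw
  unfold shr xyw
  have : Complex.normSq w ≠ 0 := by linarith
  field_simp; ring

theorem snr_sq {w : ℂ} (hw : w ∈ Bx) : snr w ^ 2 = 1 - (xyw w).2 ^ 2 := by
  have h := normSq_gt hw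
  unfold snr xyw
  have : Complex.normSq w ≠ 0 := by linarith
  have h2 : Complex.normSq w = w.re * w.re + w.im * w.im := Complex.normSq_apply w
  have h3 : (2 * w.re * w.im)^2 = Complex.normSq w^2 - (w.re^2 - w.im^2)^2 := by rw [h2]; ring
  rw [mul_pow, h3]; field_simp

theorem shr_pos {w : ℂ} (hw : w ∈ Bx) : 0 < shr w := by
  have h := normSq_gt hw
  have : (Complex.normSq w)⁻¹ < 1 := inv_lt_one_of_one_lt₀ h
  unfold shr; linarith

theorem snr_pos {w : ℂ} (hw : w ∈ Bx) : 0 < snr w := by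
  have h := normSq_gt hw
  obtain ⟨⟨a1, a2⟩, a3, a4⟩ := (mem_Bx _).mp hw
  have : 0 < (Complex.normSq w)⁻¹ := by positivity
  have h1 : 0 < w.re := by linarith
  have h2 : 0 < w.im := by linarith
  unfold snr
  positivity

theorem evL_cst {R : Type*} [CommRing R] [Algebra ℂ R] (φ : R →+* ℂ) (P : ℂˣ) (l : ℂ) (a : R) : evL φ P l (cst a) = φ a := by
  rw [cst_apply, evL_mono]; simp

/-- evaluation at a point -/
abbrev ee (w : Bx) (P : ℂˣ) (l : ℝ) : Lau (Sm ℝ Bx) →+* ℂ := evL ((Sm.ev w : Sm ℝ Bx →ₐ[ℂ] ℂ) : Sm ℝ Bx →+* ℂ) P (l : ℂ)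

theorem ee_cst (w : Bx) (P : ℂˣ) (l : ℝ) (a : Sm ℝ Bx) : ee w P l (cst a) = a.1 w := evL_cst _ _ _ _

theorem ee_VL (w : Bx) (P : ℂˣ) (l : ℝ) (a b : SmU) : ee w P l (VL (Gs a) (Gs b)) = ((a.1 (xyw w) + l^2 * b.1 (xyw w) : ℝ) : ℂ) := by
  rw [VL, map_add, evL_mono, evL_mono]
  show (Gs a).1 w * _ + (Gs b).1 w * _ = _
  rw [Gs_val, Gs_val]
  push_cast
  simp; ring

theorem ee_mom (T1 T2 : SmU) (w : Bx) (P : ℂˣ) (l : ℝ)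
    (hP : Complex.normSq P * Complex.normSq w = T1.1 (xyw w) + l^2 * T2.1 (xyw w)) (u v : ℝ)
    (hu : shr w * u = ((w:ℂ) * P).re) (hv : snr w * v = ((w:ℂ) * P).im) :
    ee w P l (pxL T1 T2) = u ∧ ee w P l (pyL T1 T2) = v := by
  have hw0 := ne0_Bx w
  have hcw : (starRingEnd ℂ) (w:ℂ) ≠ 0 := by simpa using hw0
  have hPL : ee w P l (PL _) = P := by rw [PL, evL_mono]; simp
  have hV : ee w P l (VL (Gs T1 * iN) (Gs T2 * iN)) = P * (starRingEnd ℂ) (P:ℂ) := by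
    rw [VL, map_add, evL_mono, evL_mono]
    show (Gs T1).1 w * iN.1 w * _ + (Gs T2).1 w * iN.1 w * _ = _
    rw [Gs_val, Gs_val, iN_val, Complex.mul_conj, ← mul_inv, Complex.mul_conj]
    have hN : (Complex.normSq w : ℂ) ≠ 0 := by
      have := normSq_gt w.2
      exact_mod_cast (by linarith : Complex.normSq w ≠ 0)
    have hP' : (Complex.normSq (P:ℂ) : ℂ) * (Complex.normSq w : ℂ) = T1.1 (xyw w) + (l:ℂ)^2 * T2.1 (xyw w) := by exact_mod_cast hP
    simp only [zpow_zero, Units.val_one, pow_zero, mul_one, one_mul]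
    field_simp
    linear_combination -hP'
  have hQ : ee w P l (Qm T1 T2) = (starRingEnd ℂ) (P:ℂ) := by
    have := congrArg (ee w P l) (PL_QL (Gs T1 * iN) (Gs T2 * iN))
    rw [map_mul, hPL, hV] at this
    exact mul_left_cancel₀ P.ne_zero this
  have hc : ((w:ℂ) * P) = ((shr w * u : ℝ) : ℂ) + ((snr w * v : ℝ) : ℂ) * Complex.I := by
    rw [hu, hv]; exact (Complex.re_add_im _).symm
  have hcc : (starRingEnd ℂ) (w:ℂ) * (starRingEnd ℂ) (P:ℂ) = ((shr w * u : ℝ) : ℂ) - ((snr w * v : ℝ) : ℂ) * Complex.I := by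
    rw [← map_mul, hc, map_add, map_mul, Complex.conj_ofReal, Complex.conj_ofReal, Complex.conj_I]; ring
  have s0 : (shr w : ℂ) ≠ 0 := by exact_mod_cast (shr_pos w.2).ne'
  have n0 : (snr w : ℂ) ≠ 0 := by exact_mod_cast (snr_pos w.2).ne'
  have hsh : sh.1 w = (shr w : ℂ) := sh_val w
  have hsn : sn.1 w = (snr w : ℂ) := sn_val w
  constructor
  · have := congrArg (ee w P l) (pxL_eq T1 T2)
    simp only [map_mul, map_add, ee_cst, hPL, hQ, hsh, eX_val, eY_val, map_ofNat] at this
    rw [hc, hcc] at this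
    apply mul_left_cancel₀ (mul_ne_zero two_ne_zero s0)
    rw [this]; push_cast; ring
  · have := congrArg (ee w P l) (pyL_eq T1 T2)
    simp only [map_mul, map_sub, ee_cst, hPL, hQ, hsn, eX_val, eY_val, map_ofNat, kk_val] at this
    rw [hc, hcc] at this
    apply mul_left_cancel₀ (mul_ne_zero (mul_ne_zero two_ne_zero Complex.I_ne_zero) n0)
    rw [this]; push_cast; ring
end ZV

namespace ZV
open scoped ContDiff
open TopologicalSpace

/-- bracket of one term -/
def brk (T1 T2 g : SmU) (i j : ℕ) (p : ℝ × ℝ) (u v l : ℝ) : ℝ :=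
  (2 * (p.1^2 - 1) * u * (g.pd (1,0)).1 p + 2 * (1 - p.2^2) * v * (g.pd (0,1)).1 p) * u^i * v^j
  + g.1 p * (i * u^(i-1) * v^j * ((T1.pd (1,0)).1 p + l^2 * (T2.pd (1,0)).1 p - 2 * p.1 * u^2)
    + j * u^i * v^(j-1) * ((T1.pd (0,1)).1 p + l^2 * (T2.pd (0,1)).1 p + 2 * p.2 * v^2))

/-- term of the integral -/
def Jt (T1 T2 g : SmU) (i j k : ℕ) (κ : ℝ) : Lau (Sm ℝ Bx) :=
  cst (Gs g) * pxL T1 T2 ^ i * pyL T1 T2 ^ j * mono 0 k (kk κ)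

theorem ee_mono0 (w : Bx) (P : ℂˣ) (l : ℝ) (k : ℕ) (κ : ℝ) : ee w P l (mono 0 k (kk κ)) = ((l^k * κ : ℝ) : ℂ) := by
  rw [evL_mono]
  show (κ:ℂ) * _ = _
  push_cast; simp; ring

theorem ee_Jt (T1 T2 g : SmU) (i j k : ℕ) (κ : ℝ) (w : Bx) (P : ℂˣ) (l : ℝ) (u v : ℝ)
    (hu : ee w P l (pxL T1 T2) = u) (hv : ee w P l (pyL T1 T2) = v) :
    ee w P l (Jt T1 T2 g i j k κ) = ((g.1 (xyw w) * u^i * v^j * (l^k * κ) : ℝ) : ℂ) := by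
  rw [Jt, map_mul, map_mul, map_mul, map_pow, map_pow, hu, hv, ee_mono0, ee_cst, Gs_val]
  push_cast; ring

theorem ee_XJ (T1 T2 g : SmU) (i j k : ℕ) (κ : ℝ) (w : Bx) (P : ℂˣ) (l : ℝ) (u v : ℝ)
    (hu : ee w P l (pxL T1 T2) = u) (hv : ee w P l (pyL T1 T2) = v) :
    ee w P l (cst eX * cst eY * XX T1 T2 (Jt T1 T2 g i j k κ)) = ((brk T1 T2 g i j (xyw w) u v l * (l^k * κ) : ℝ) : ℂ) := by
  have h1 : cst eX * cst eY * XX T1 T2 (Jt T1 T2 g i j k κ) =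
      ((cst eX * cst eY * XX T1 T2 (cst (Gs g))) * pxL T1 T2 ^ i * pyL T1 T2 ^ j
       + cst (Gs g) * ((i:Lau (Sm ℝ Bx)) * pxL T1 T2 ^ (i-1) * pyL T1 T2 ^ j * (cst eX * cst eY * XX T1 T2 (pxL T1 T2))
        + (j:Lau (Sm ℝ Bx)) * pxL T1 T2 ^ i * pyL T1 T2 ^ (j-1) * (cst eX * cst eY * XX T1 T2 (pyL T1 T2)))) * mono 0 k (kk κ) := by
    have hm : XX T1 T2 (mono 0 k (kk κ)) = 0 := flow_lam _ _ _ _ _ _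
    rw [Jt]
    simp only [Derivation.leibniz, Derivation.leibniz_pow, hm, smul_eq_mul, nsmul_eq_mul]
    ring
  rw [h1, flow_coef, (flow_mom T1 T2).1, (flow_mom T1 T2).2]
  have hsh : sh.1 w = (shr w : ℂ) := sh_val w
  have hsn : sn.1 w = (snr w : ℂ) := sn_val w
  have e1 : (shr w : ℂ)^2 = (((xyw w).1^2 - 1 : ℝ) : ℂ) := by rw [← shr_sq w.2]; push_cast; ring
  have e2 : (snr w : ℂ)^2 = ((1 - (xyw w).2^2 : ℝ) : ℂ) := by rw [← snr_sq w.2]; push_cast; ring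
  have ex : (Gs sx).1 w = (((xyw w).1 : ℝ) : ℂ) := rfl
  have ey : (Gs sy).1 w = (((xyw w).2 : ℝ) : ℂ) := rfl
  simp only [map_mul, map_add, map_sub, map_pow, map_natCast, map_ofNat, ee_cst, ee_VL, hu, hv, ee_mono0, hsh, hsn, e1, e2, ex, ey, Gs_val]
  unfold brk
  push_cast; ring

theorem inf_circle (r : ℝ) (hr : 0 < r) : {P : ℂˣ | Complex.normSq P = r}.Infinite := by
  have h : Set.InjOn (fun t : ℝ => (⟨t, √(r - t^2)⟩ : ℂ)) (Set.Ioo 0 (√r)) := by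
    intro a _ b _ h
    exact congrArg Complex.re h
  have h2 : ((fun t : ℝ => (⟨t, √(r - t^2)⟩ : ℂ)) '' (Set.Ioo 0 (√r))).Infinite :=
    (Set.infinite_image_iff h).mpr (Set.Ioo_infinite (Real.sqrt_pos.mpr hr))
  have h3 : ((fun t : ℝ => (⟨t, √(r - t^2)⟩ : ℂ)) '' (Set.Ioo 0 (√r))) ⊆ (fun P : ℂˣ => (P:ℂ)) '' {P : ℂˣ | Complex.normSq P = r} := by
    rintro _ ⟨t, ⟨ht0, ht1⟩, rfl⟩
    have hlt : t^2 < r := by rwa [Real.lt_sqrt ht0.le] at ht1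
    have ne : (⟨t, √(r - t^2)⟩ : ℂ) ≠ 0 := fun h => by
      have := congrArg Complex.re h
      simp at this; linarith
    refine ⟨Units.mk0 _ ne, ?_, rfl⟩
    show Complex.normSq ⟨t, √(r - t^2)⟩ = r
    rw [Complex.normSq_apply]
    simp only
    rw [Real.mul_self_sqrt (by linarith)]; ring
  exact (h2.mono h3).of_image _

theorem inf_lam (a b : ℝ) (ha : 0 < a) : ((fun l : ℝ => (l:ℂ)) '' {l : ℝ | 0 < a + l^2 * b}).Infinite := by
  rw [Set.infinite_image_iff Complex.ofReal_injective.injOn]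
  have ho : IsOpen {l : ℝ | 0 < a + l^2 * b} := isOpen_lt continuous_const (by fun_prop)
  exact infinite_of_mem_nhds 0 (ho.mem_nhds (by simpa using ha))

theorem XJ_zero {ι : Type*} (S : Finset ι) (T1 T2 : SmU) (g : ι → SmU) (ei ej ek : ι → ℕ) (κ : ι → ℝ)
    (hT : ∀ p ∈ U2, 0 < T1.1 p)
    (hbr : ∀ p ∈ U2, ∀ u v l : ℝ, (p.1^2 - 1) * u^2 + (1 - p.2^2) * v^2 = T1.1 p + l^2 * T2.1 p →
      ∑ s ∈ S, brk T1 T2 (g s) (ei s) (ej s) p u v l * (l^(ek s) * κ s) = 0) :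
    XX T1 T2 (∑ s ∈ S, Jt T1 T2 (g s) (ei s) (ej s) (ek s) (κ s)) = 0 := by
  set J := ∑ s ∈ S, Jt T1 T2 (g s) (ei s) (ej s) (ek s) (κ s) with hJ
  have key : ∀ w : Bx, ∀ m, Sm.ev w ((XX T1 T2 J).coeff m) = 0 := by
    intro w
    have hN := normSq_gt w.2
    have hN0 : 0 < Complex.normSq w := by linarith
    refine lau_zero _ ((Sm.ev w : Sm ℝ Bx →ₐ[ℂ] ℂ) : Sm ℝ Bx →+* ℂ) _ (inf_lam (T1.1 (xyw w)) (T2.1 (xyw w)) (hT _ (xyw_mem w.2)))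
      (fun l => {P | Complex.normSq P = (T1.1 (xyw w) + l.re^2 * T2.1 (xyw w)) / Complex.normSq w}) ?_ ?_
    · rintro _ ⟨l, hl, rfl⟩
      exact inf_circle _ (div_pos hl hN0)
    · rintro _ ⟨l, hl, rfl⟩ P hP
      have hP' : Complex.normSq P * Complex.normSq w = T1.1 (xyw w) + l^2 * T2.1 (xyw w) := by
        have : Complex.normSq P = (T1.1 (xyw w) + l^2 * T2.1 (xyw w)) / Complex.normSq w := hP
        rw [this]; field_simp
      have s0 := (shr_pos w.2).ne'
      have n0 := (snr_pos w.2).ne'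
      set u := ((w:ℂ) * P).re / shr w with hu
      set v := ((w:ℂ) * P).im / snr w with hv
      have hu' : shr w * u = ((w:ℂ) * P).re := by rw [hu]; field_simp
      have hv' : snr w * v = ((w:ℂ) * P).im := by rw [hv]; field_simp
      obtain ⟨h1, h2⟩ := ee_mom T1 T2 w P l hP' u v hu' hv'
      have hz : ee w P l (cst eX * cst eY * XX T1 T2 J) = 0 := by
        rw [hJ, map_sum, Finset.mul_sum, map_sum, Finset.sum_congr rfl fun s _ => ee_XJ T1 T2 (g s) (ei s) (ej s) (ek s) (κ s) w P l u v h1 h2]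
        rw [← Complex.ofReal_sum, hbr _ (xyw_mem w.2) u v l, Complex.ofReal_zero]
        rw [← shr_sq w.2, ← snr_sq w.2, ← hP', ← mul_pow, ← mul_pow, hu', hv', mul_comm (Complex.normSq (P:ℂ)), ← Complex.normSq_mul, Complex.normSq_apply]
        ring
      rw [map_mul, map_mul, ee_cst, ee_cst, eX_val, eY_val, Complex.mul_conj] at hz
      rcases mul_eq_zero.mp hz with h | h
      · exfalso; have : Complex.normSq w = 0 := by exact_mod_cast h
        linarith
      · exact h
  ext m w
  exact key w m
end ZV

namespace ZV
open scoped ContDiff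
open TopologicalSpace

theorem U2_pos {p : ℝ × ℝ} (hp : p ∈ U2) : 0 < p.1 - 1 ∧ 0 < p.1 + 1 ∧ 0 < p.1^2 - 1 ∧ 0 < 1 - p.2^2 ∧ 0 < p.1^2 - p.2^2 := by
  obtain ⟨h1, h2, h3⟩ := hp
  have a : 0 < p.1^2 - 1 := by nlinarith
  have b : 0 < 1 - p.2^2 := by nlinarith
  exact ⟨by linarith, by linarith, a, b, by linarith⟩

/-- the function `F` -/
def fF (p : ℝ × ℝ) : ℝ := ((p.1 + 1)/(p.1 - 1))^2
/-- the function `G` -/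
def fG (p : ℝ × ℝ) : ℝ := (p.1^2 - 1)^4 / (p.1^2 - p.2^2)^3

theorem fF_smooth : ContDiffOn ℝ ∞ fF U2 := by
  unfold fF
  refine ContDiffOn.pow (ContDiffOn.div (by fun_prop) (by fun_prop) fun p hp => (U2_pos hp).1.ne') 2

theorem fG_smooth : ContDiffOn ℝ ∞ fG U2 := by
  unfold fG
  refine ContDiffOn.div (by fun_prop) (by fun_prop) fun p hp => (pow_pos (U2_pos hp).2.2.2.2 3).ne'

theorem fF_pos {p : ℝ × ℝ} (hp : p ∈ U2) : 0 < fF p := by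
  obtain ⟨h1, h2, h3, h4, h5⟩ := U2_pos hp
  unfold fF; positivity
theorem fG_pos {p : ℝ × ℝ} (hp : p ∈ U2) : 0 < fG p := by
  obtain ⟨h1, h2, h3, h4, h5⟩ := U2_pos hp
  unfold fG; positivity

/-- leading potential -/
def TT (b : ℝ) : SmU := ⟨fun p => fF p^2 * fG p * b^2, ((fF_smooth.pow 2).mul fG_smooth).mul contDiffOn_const⟩

theorem TT_pos (b : ℝ) (hb : b ≠ 0) : ∀ p ∈ U2, 0 < (TT b).1 p := fun p hp => by
  have := fF_pos hp
  have := fG_pos hp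
  show 0 < fF p^2 * fG p * b^2
  positivity

theorem pow4_ne (w z : ℂ) (hw : w ∈ Bx) (hz : Complex.normSq z = Complex.normSq w) : z^3 * (z^4 - 1)^3 ≠ 0 := by
  have h := normSq_gt hw
  refine mul_ne_zero (pow_ne_zero _ fun h0 => ?_) (pow_ne_zero _ fun h0 => ?_)
  · rw [h0, map_zero] at hz; linarith
  · have h1 : z^4 = 1 := sub_eq_zero.mp h0
    have h2 := congrArg Complex.normSq h1
    rw [map_pow, map_one, hz] at h2
    have := one_lt_pow₀ h (n := 4) (by norm_num)
    linarith

theorem TT_form (b : ℝ) : ∃ gX gY : Sm ℝ Bx, eX^3 * (eX^4 - 1)^3 * gX = 1 ∧ eY^3 * (eY^4 - 1)^3 * gY = 1 ∧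
    Gs (TT b) * iN = algebraMap ℂ _ ((b:ℂ)^2/4) * (1 + eX * eY)^16 * gX * gY := by
  obtain ⟨gX, hX⟩ := Sm.exists_inv (Ω := Bx) (eX^3 * (eX^4 - 1)^3) (fun w => by
    rw [← Sm.ev_apply, map_mul, map_pow, map_pow, map_sub, map_pow, map_one, Sm.ev_apply, eX_val]
    exact pow4_ne w w w.2 rfl)
  obtain ⟨gY, hY⟩ := Sm.exists_inv (Ω := Bx) (eY^3 * (eY^4 - 1)^3) (fun w => by
    rw [← Sm.ev_apply, map_mul, map_pow, map_pow, map_sub, map_pow, map_one, Sm.ev_apply, eY_val]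
    exact pow4_ne w _ w.2 (Complex.normSq_conj _))
  refine ⟨gX, gY, hX, hY, ?_⟩
  apply Sm.ext
  intro w
  have h1 : (w:ℂ)^3 * ((w:ℂ)^4-1)^3 * gX.1 w = 1 := by
    have := congrArg (Sm.ev w) hX
    rwa [map_mul, map_mul, map_pow, map_pow, map_sub, map_pow, map_one, Sm.ev_apply, Sm.ev_apply, eX_val] at this
  have h2 : ((starRingEnd ℂ) (w:ℂ))^3 * (((starRingEnd ℂ) (w:ℂ))^4-1)^3 * gY.1 w = 1 := by
    have := congrArg (Sm.ev w) hY
    rwa [map_mul, map_mul, map_pow, map_pow, map_sub, map_pow, map_one, Sm.ev_apply, Sm.ev_apply, eY_val] at this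
  have nX := pow4_ne w w w.2 rfl
  have nY := pow4_ne w _ w.2 (Complex.normSq_conj _)
  show (((TT b).1 (xyw w) : ℝ) : ℂ) * ((w:ℂ)⁻¹ * ((starRingEnd ℂ) (w:ℂ))⁻¹) = (b:ℂ)^2/4 * (1 + (w:ℂ) * (starRingEnd ℂ) (w:ℂ))^16 * gX.1 w * gY.1 w
  have hN := normSq_gt w.2
  have hx : (((xyw w).1 : ℝ) : ℂ) = ((w:ℂ) * (starRingEnd ℂ) (w:ℂ) + ((w:ℂ) * (starRingEnd ℂ) (w:ℂ))⁻¹) / 2 := by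
    rw [Complex.mul_conj]; unfold xyw; push_cast; rfl
  have hy : (((xyw w).2 : ℝ) : ℂ) = ((w:ℂ)^2 + (starRingEnd ℂ) (w:ℂ)^2) / 2 * ((w:ℂ) * (starRingEnd ℂ) (w:ℂ))⁻¹ := by
    rw [Complex.mul_conj]; unfold xyw; push_cast
    congr 1
    apply Complex.ext <;> simp [pow_two] ; ring
  have n1 : ((w:ℂ) * (starRingEnd ℂ) (w:ℂ)) - 1 ≠ 0 := by
    rw [Complex.mul_conj]; exact_mod_cast (by linarith : Complex.normSq w - 1 ≠ 0)
  have n2 : ((w:ℂ) * (starRingEnd ℂ) (w:ℂ)) + 1 ≠ 0 := by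
    rw [Complex.mul_conj]; exact_mod_cast (by linarith : Complex.normSq w + 1 ≠ 0)
  have hT : (((TT b).1 (xyw w) : ℝ) : ℂ) = (((((xyw w).1 : ℝ) : ℂ) + 1)/((((xyw w).1 : ℝ) : ℂ) - 1))^4 *
     (((((xyw w).1 : ℝ) : ℂ)^2-1)^4 / ((((xyw w).1 : ℝ) : ℂ)^2 - (((xyw w).2 : ℝ) : ℂ)^2)^3) * (b:ℂ)^2 := by
    show (((fF (xyw w))^2 * fG (xyw w) * b^2 : ℝ) : ℂ) = _
    unfold fF fG; push_cast; ring
  rw [hT, hx, hy]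
  generalize (starRingEnd ℂ) (w:ℂ) = Y at *
  generalize (w:ℂ) = X at *
  obtain ⟨a1, a2⟩ := mul_ne_zero_iff.mp nX
  obtain ⟨a3, a4⟩ := mul_ne_zero_iff.mp nY
  have X0 : X ≠ 0 := fun h => a1 (by rw [h]; simp)
  have Y0 : Y ≠ 0 := fun h => a3 (by rw [h]; simp)
  have X4 : X^4 - 1 ≠ 0 := fun h => a2 (by rw [h]; simp)
  have Y4 : Y^4 - 1 ≠ 0 := fun h => a4 (by rw [h]; simp)
  have gx : gX.1 w = (X^3 * (X^4-1)^3)⁻¹ := eq_inv_of_mul_eq_one_right h1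
  have gy : gY.1 w = (Y^3 * (Y^4-1)^3)⁻¹ := eq_inv_of_mul_eq_one_right h2
  rw [gx, gy]
  have e1 : (X * Y + (X * Y)⁻¹) / 2 + 1 = (X * Y + 1)^2 / (2 * (X * Y)) := by field_simp; ring
  have e2 : (X * Y + (X * Y)⁻¹) / 2 - 1 = (X * Y - 1)^2 / (2 * (X * Y)) := by field_simp; ring
  have e3 : ((X * Y + (X * Y)⁻¹) / 2)^2 - 1 = (X * Y - 1)^2 * (X * Y + 1)^2 / (4 * (X * Y)^2) := by field_simp; ring
  have e4 : ((X * Y + (X * Y)⁻¹) / 2)^2 - ((X^2 + Y^2) / 2 * (X * Y)⁻¹)^2 = (X^4 - 1) * (Y^4 - 1) / (4 * (X * Y)^2) := by field_simp; ring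
  rw [e1, e2, e3, e4, add_comm 1 (X * Y)]
  generalize X^4 - 1 = A at *
  generalize Y^4 - 1 = B at *
  generalize X * Y + 1 = C at *
  generalize X * Y - 1 = D at *
  field_simp

theorem local_const {ι : Type*} (S : Finset ι) (b : ℝ) (hb : b ≠ 0) (T2 : SmU) (g : ι → SmU) (ei ej ek : ι → ℕ) (κ : ι → ℝ)
    (hbr : ∀ p ∈ U2, ∀ u v l : ℝ, (p.1^2 - 1) * u^2 + (1 - p.2^2) * v^2 = (TT b).1 p + l^2 * T2.1 p →
      ∑ s ∈ S, brk (TT b) T2 (g s) (ei s) (ej s) p u v l * (l^(ek s) * κ s) = 0) :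
    ∃ c : ℝ, ∀ w ∈ Bx, ∀ u v : ℝ, (u, v) ≠ 0 →
      ((xyw w).1^2 - 1) * u^2 + (1 - (xyw w).2^2) * v^2 = (TT b).1 (xyw w) + T2.1 (xyw w) →
      ∑ s ∈ S, (g s).1 (xyw w) * u^(ei s) * v^(ej s) * κ s = c := by
  have hX := XJ_zero S (TT b) T2 g ei ej ek κ (TT_pos b hb) hbr
  set J := ∑ s ∈ S, Jt (TT b) T2 (g s) (ei s) (ej s) (ek s) (κ s) with hJ
  obtain ⟨gX, gY, h1, h2, h3⟩ := TT_form b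
  have hμ : (b:ℂ)^2/4 ≠ 0 := by
    have : (b:ℂ) ≠ 0 := by exact_mod_cast hb
    simpa using this
  have ht := flow_triv wX wY (Gs (TT b) * iN) (Gs T2 * iN) J hX (triv_Bx _ hμ gX gY _ h1 h2 h3)
  have hev : ∀ (w w' : Bx) (P P' : ℂˣ), ee w P 1 J = ee w' P' 1 J := by
    intro w w' P P'
    rw [evL_sum, evL_sum]
    refine Finset.sum_congr rfl fun m _ => ?_
    obtain ⟨t1, t2, t3⟩ := ht m.2
    by_cases hm : m.1 = 0
    · have : J.coeff m = J.coeff (0, m.2) := by rw [← hm]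
      rw [this, hm, zpow_zero, zpow_zero]
      congr 1
      exact w_const convex_Bx _ t2 t3 w w'
    · have : J.coeff m = 0 := t1 m.1 hm
      rw [this, map_zero, map_zero]; ring
  have w0 : Bx := ⟨⟨17/20, 17/20⟩, by rw [mem_Bx]; norm_num⟩
  refine ⟨(ee w0 1 1 J).re, fun w hw u v huv hon => ?_⟩
  lift w to Bx using hw
  have s0 := shr_pos w.2
  have n0 := snr_pos w.2
  set z : ℂ := ⟨shr w * u, snr w * v⟩ with hz
  have z0 : z ≠ 0 := by
    intro h
    apply huv
    have h1 := congrArg Complex.re h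
    have h2 := congrArg Complex.im h
    simp only [hz, Complex.zero_re, Complex.zero_im, mul_eq_zero, s0.ne', n0.ne', false_or] at h1 h2
    rw [h1, h2]; rfl
  have hw0 := ne0_Bx w
  set P : ℂˣ := Units.mk0 (z / w) (div_ne_zero z0 hw0) with hP
  have hwP : (w:ℂ) * P = z := by rw [hP, Units.val_mk0]; field_simp
  have hP' : Complex.normSq P * Complex.normSq w = (TT b).1 (xyw w) + (1:ℝ)^2 * T2.1 (xyw w) := by
    rw [← Complex.normSq_mul, mul_comm, hwP, one_pow, one_mul, ← hon, ← shr_sq w.2, ← snr_sq w.2, hz, Complex.normSq_apply]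
    ring
  obtain ⟨q1, q2⟩ := ee_mom (TT b) T2 w P 1 hP' u v (by rw [hwP]) (by rw [hwP])
  have hfin : ee w P 1 J = ((∑ s ∈ S, (g s).1 (xyw w) * u^(ei s) * v^(ej s) * κ s : ℝ) : ℂ) := by
    rw [hJ, map_sum, Finset.sum_congr rfl fun s _ => ee_Jt (TT b) T2 (g s) (ei s) (ej s) (ek s) (κ s) w P 1 u v q1 q2]
    rw [← Complex.ofReal_sum]
    simp
  rw [hev w0 w 1 P, hfin, Complex.ofReal_re]
end ZV

namespace ZV
open scoped ContDiff
open TopologicalSpace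

theorem isOpen_TStar : IsOpen TStar :=
  (isOpen_lt continuous_const (continuous_apply 0)).inter
    ((isOpen_lt continuous_const (continuous_apply 1)).inter (isOpen_lt (continuous_apply 1) continuous_const))

/-- phase point with `φ = t = 0` -/
def zpt (p : ℝ × ℝ) (u v a b : ℝ) : PhasePt := ![p.1, p.2, 0, 0, u, v, a, b]

theorem zpt_mem {p : ℝ × ℝ} (hp : p ∈ U2) (u v a b : ℝ) : zpt p u v a b ∈ TStar := hp

/-- direction -/
def vec (d : ℝ × ℝ) (d3 d4 : ℝ) : PhasePt := ![d.1, d.2, 0, 0, d3, d4, 0, 0]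

theorem vec_eq (d : ℝ × ℝ) (d3 d4 : ℝ) : vec d d3 d4 = d.1 • Pi.single 0 1 + d.2 • Pi.single 1 1 + d3 • Pi.single 4 1 + d4 • Pi.single 5 1 := by
  ext i
  fin_cases i <;> simp [vec, Pi.single_apply]

theorem zpt_line (p d : ℝ × ℝ) (u v a b d3 d4 s : ℝ) :
    zpt p u v a b + s • vec d d3 d4 = zpt (p + s • d) (u + s * d3) (v + s * d4) a b := by
  ext i
  fin_cases i <;> simp [vec, zpt]

theorem fd_vec (L : PhasePt →L[ℝ] ℝ) (d : ℝ × ℝ) (d3 d4 : ℝ) : L (vec d d3 d4) =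
    d.1 * L (Pi.single 0 1) + d.2 * L (Pi.single 1 1) + d3 * L (Pi.single 4 1) + d4 * L (Pi.single 5 1) := by
  rw [vec_eq]; simp only [map_add, map_smul, smul_eq_mul]

theorem fd_Pphi (z : PhasePt) : fderiv ℝ Pphi z = ContinuousLinearMap.proj 6 :=
  (ContinuousLinearMap.proj (R := ℝ) (φ := fun _ : Fin 8 => ℝ) 6).hasFDerivAt.fderiv
theorem fd_Ptm (z : PhasePt) : fderiv ℝ Ptm z = ContinuousLinearMap.proj 7 :=
  (ContinuousLinearMap.proj (R := ℝ) (φ := fun _ : Fin 8 => ℝ) 7).hasFDerivAt.fderiv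

theorem pois_Pphi (f : PhasePt → ℝ) (z : PhasePt) : pois Pphi f z = - pd 2 f z ∧ pois f Pphi z = pd 2 f z := by
  simp [pois, pd, fd_Pphi, Pi.single_apply]
theorem pois_Ptm (f : PhasePt → ℝ) (z : PhasePt) : pois Ptm f z = - pd 3 f z ∧ pois f Ptm z = pd 3 f z := by
  simp [pois, pd, fd_Ptm, Pi.single_apply]

/-- independence of cyclic coordinates -/
theorem cyclic (I : PhasePt → ℝ) (hI : ∀ z ∈ TStar, DifferentiableAt ℝ I z)
    (h2 : ∀ z ∈ TStar, pd 2 I z = 0) (h3 : ∀ z ∈ TStar, pd 3 I z = 0) (z : PhasePt) (hz : z ∈ TStar) :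
    I z = I (zpt (z 0, z 1) (z 4) (z 5) (z 6) (z 7)) := by
  set q : PhasePt := zpt (z 0, z 1) (z 4) (z 5) (z 6) (z 7) with hq
  set e : PhasePt := z 2 • Pi.single 2 1 + z 3 • Pi.single 3 1 with he
  have hmem : ∀ s : ℝ, q + s • e ∈ TStar := by
    intro s
    have e0 : (q + s • e) 0 = z 0 := by simp [hq, he, zpt]
    have e1 : (q + s • e) 1 = z 1 := by simp [hq, he, zpt]
    show 1 < (q + s • e) 0 ∧ -1 < (q + s • e) 1 ∧ (q + s • e) 1 < 1
    rw [e0, e1]; exact hz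
  have hd : ∀ s : ℝ, HasDerivAt (fun s : ℝ => I (q + s • e)) 0 s := by
    intro s
    have h1 : HasDerivAt (fun s : ℝ => q + s • e) e s := by
      simpa using ((hasDerivAt_id s).smul_const e).const_add q
    have h := (hI _ (hmem s)).hasFDerivAt.comp_hasDerivAt s h1
    have : fderiv ℝ I (q + s • e) e = 0 := by
      have a2 := h2 _ (hmem s)
      have a3 := h3 _ (hmem s)
      unfold pd at a2 a3
      conv_lhs => rw [he]
      rw [map_add, map_smul, map_smul, a2, a3]; simp
    rw [this] at h; exact h
  have h := is_const_of_deriv_eq_zero (fun s => (hd s).differentiableAt) (fun s => (hd s).deriv) 1 0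
  simp only [one_smul, zero_smul, add_zero] at h
  rw [← h]
  congr 1
  ext i
  fin_cases i <;> simp [hq, he, zpt]

/-- derivative along a line -/
theorem line_deriv (f : PhasePt → ℝ) (z v : PhasePt) (hf : DifferentiableAt ℝ f z) :
    HasDerivAt (fun s : ℝ => f (z + s • v)) (fderiv ℝ f z v) 0 := by
  have h1 : HasDerivAt (fun s : ℝ => z + s • v) v 0 := by
    simpa using ((hasDerivAt_id (0:ℝ)).smul_const v).const_add z
  have hf' : DifferentiableAt ℝ f (z + (0:ℝ) • v) := by simpa using hf
  have h : HasDerivAt (fun s : ℝ => f (z + s • v)) (fderiv ℝ f (z + (0:ℝ) • v) v) 0 :=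
    hf'.hasFDerivAt.comp_hasDerivAt (0:ℝ) h1
  rwa [zero_smul, add_zero] at h

/-- second potential -/
def T2f (e a : ℝ) : SmU := ⟨fun p => 2 * e * (fF p * fG p) - a^2 * fG p / ((p.1^2 - 1) * (1 - p.2^2)), by
  refine ContDiffOn.sub (contDiffOn_const.mul (fF_smooth.mul fG_smooth)) ?_
  refine ContDiffOn.div (contDiffOn_const.mul fG_smooth) (by fun_prop) fun p hp => ?_
  obtain ⟨h1, h2, h3, h4, h5⟩ := U2_pos hp
  positivity⟩

theorem Ham_eq {p : ℝ × ℝ} (hp : p ∈ U2) (u v a b e l : ℝ) : Ham (zpt p u v (l * a) b) =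
    l^2 * e + ((p.1^2 - 1) * u^2 + (1 - p.2^2) * v^2 - ((TT b).1 p + l^2 * (T2f e a).1 p)) / (2 * (fF p * fG p)) := by
  obtain ⟨h1, h2, h3, h4, h5⟩ := U2_pos hp
  have hF := (fF_pos hp).ne'
  have hG := (fG_pos hp).ne'
  have hh : Ham (zpt p u v (l * a) b) = (1/2) * (((p.1^2 - 1) * u^2 + (1 - p.2^2) * v^2) / (fF p * fG p)
    + (l * a)^2 / (fF p * ((p.1^2 - 1) * (1 - p.2^2))) - fF p * b^2) := rfl
  have ht : (TT b).1 p + l^2 * (T2f e a).1 p = fF p^2 * fG p * b^2 + l^2 * (2 * e * (fF p * fG p) - a^2 * fG p / ((p.1^2 - 1) * (1 - p.2^2))) := rfl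
  rw [hh, ht]
  have h3' := h3.ne'
  have h4' := h4.ne'
  generalize p.1^2 - 1 = A at *
  generalize 1 - p.2^2 = B at *
  field_simp
  ring

theorem div_diff {f g : PhasePt → ℝ} {z : PhasePt} (hf : DifferentiableAt ℝ f z) (hg : DifferentiableAt ℝ g z) (h : g z ≠ 0) :
    DifferentiableAt ℝ (fun z => f z / g z) z := by
  simp only [div_eq_mul_inv]
  exact hf.fun_mul (hg.fun_inv h)

theorem Ham_diff {z : PhasePt} (hz : z ∈ TStar) : DifferentiableAt ℝ Ham z := by
  obtain ⟨h1, h2, h3, h4, h5⟩ := U2_pos (p := (z 0, z 1)) hz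
  simp only at h1 h2 h3 h4 h5
  unfold Ham
  have d : ∀ i : Fin 8, DifferentiableAt ℝ (fun z : PhasePt => z i) z := fun i => differentiableAt_apply i z
  have hF : DifferentiableAt ℝ (fun z : PhasePt => ((z 0 + 1)/(z 0 - 1))^2) z := by
    have a1 : DifferentiableAt ℝ (fun z : PhasePt => z 0 + 1) z := (d 0).add_const 1
    have a2 : DifferentiableAt ℝ (fun z : PhasePt => z 0 - 1) z := (d 0).sub_const 1
    have a3 : DifferentiableAt ℝ (fun z : PhasePt => (z 0 + 1) / (z 0 - 1)) z := by
      refine div_diff a1 a2 ?_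
      exact h1.ne'
    exact a3.fun_pow 2
  have hG : DifferentiableAt ℝ (fun z : PhasePt => (((z 0)^2 - 1)^4 / ((z 0)^2 - (z 1)^2)^3)) z := by
    have a1 : DifferentiableAt ℝ (fun z : PhasePt => ((z 0)^2 - 1)^4) z := (((d 0).fun_pow 2).sub_const 1).fun_pow 4
    have a2 : DifferentiableAt ℝ (fun z : PhasePt => ((z 0)^2 - (z 1)^2)^3) z := (((d 0).fun_pow 2).fun_sub ((d 1).fun_pow 2)).fun_pow 3
    refine div_diff a1 a2 ?_
    exact (pow_pos h5 3).ne'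
  have hF0 : ((z 0 + 1)/(z 0 - 1))^2 ≠ 0 := by positivity
  have hG0 : (((z 0)^2 - 1)^4 / ((z 0)^2 - (z 1)^2)^3) ≠ 0 := by positivity
  have hB : DifferentiableAt ℝ (fun z : PhasePt => 1 - (z 1)^2) z := ((d 1).pow 2).const_sub 1
  have hA : DifferentiableAt ℝ (fun z : PhasePt => (z 0)^2 - 1) z := ((d 0).pow 2).sub_const 1
  refine DifferentiableAt.const_mul ?_ _
  refine DifferentiableAt.sub (DifferentiableAt.add ?_ ?_) ?_
  · exact div_diff ((hA.fun_mul ((d 4).fun_pow 2)).fun_add (hB.fun_mul ((d 5).fun_pow 2))) (hF.fun_mul hG) (mul_ne_zero hF0 hG0)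
  · exact div_diff ((d 6).fun_pow 2) (hF.fun_mul (hA.fun_mul hB)) (mul_ne_zero hF0 (mul_ne_zero h3.ne' h4.ne'))
  · exact hF.mul ((d 7).pow 2)
end ZV

namespace ZV
open scoped ContDiff
open TopologicalSpace

theorem SmU.hasF (g : SmU) {p : ℝ × ℝ} (hp : p ∈ U2) : HasFDerivAt g.1 (fderiv ℝ g.1 p) p :=
  ((g.2.contDiffAt (isOpen_U2.mem_nhds hp)).differentiableAt (by simp)).hasFDerivAt

theorem SmU.line (g : SmU) {p : ℝ × ℝ} (hp : p ∈ U2) (d : ℝ × ℝ) :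
    HasDerivAt (fun s : ℝ => g.1 (p + s • d)) (d.1 * (g.pd (1,0)).1 p + d.2 * (g.pd (0,1)).1 p) 0 := by
  have h1 : HasDerivAt (fun s : ℝ => p + s • d) d 0 := by
    simpa using ((hasDerivAt_id (0:ℝ)).smul_const d).const_add p
  have hf' : HasFDerivAt g.1 (fderiv ℝ g.1 p) (p + (0:ℝ) • d) := by simpa using g.hasF hp
  have h : HasDerivAt (fun s : ℝ => g.1 (p + s • d)) (fderiv ℝ g.1 p d) 0 :=
    hf'.comp_hasDerivAt (0:ℝ) h1
  have e : d = d.1 • ((1:ℝ),(0:ℝ)) + d.2 • ((0:ℝ),(1:ℝ)) := by ext <;> simp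
  have e2 : fderiv ℝ g.1 p d = d.1 * fderiv ℝ g.1 p (1,0) + d.2 * fderiv ℝ g.1 p (0,1) := by
    conv_lhs => rw [e]
    rw [map_add, map_smul, map_smul]; rfl
  rw [e2] at h
  exact h

theorem lin_line (u d : ℝ) : HasDerivAt (fun s : ℝ => u + s * d) d 0 := by
  simpa using ((hasDerivAt_id (0:ℝ)).mul_const d).const_add u

theorem line_mem {p : ℝ × ℝ} {V : Set (ℝ × ℝ)} (hV : IsOpen V) (hp : p ∈ V) (d : ℝ × ℝ) : ∀ᶠ s in nhds (0:ℝ), p + s • d ∈ V := by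
  have hc : ContinuousAt (fun s : ℝ => p + s • d) 0 := by fun_prop
  exact hc.eventually_mem (by simpa using hV.mem_nhds hp)

theorem Ham_line {p : ℝ × ℝ} (hp : p ∈ U2) (u v a b e l : ℝ)
    (hon : (p.1^2 - 1) * u^2 + (1 - p.2^2) * v^2 = (TT b).1 p + l^2 * (T2f e a).1 p) (d : ℝ × ℝ) (d3 d4 : ℝ) :
    2 * (fF p * fG p) * fderiv ℝ Ham (zpt p u v (l * a) b) (vec d d3 d4) =
     2 * p.1 * d.1 * u^2 + (p.1^2 - 1) * (2 * u * d3) - 2 * p.2 * d.2 * v^2 + (1 - p.2^2) * (2 * v * d4)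
     - ((d.1 * ((TT b).pd (1,0)).1 p + d.2 * ((TT b).pd (0,1)).1 p)
       + l^2 * (d.1 * ((T2f e a).pd (1,0)).1 p + d.2 * ((T2f e a).pd (0,1)).1 p)) := by
  have h1 := line_deriv Ham (zpt p u v (l * a) b) (vec d d3 d4) (Ham_diff (zpt_mem hp _ _ _ _))
  have hu := lin_line u d3
  have hv := lin_line v d4
  have hx := lin_line p.1 d.1
  have hy := lin_line p.2 d.2
  have hFG : DifferentiableAt ℝ (fun s : ℝ => 2 * (fF (p + s • d) * fG (p + s • d))) 0 :=
    ((SmU.line ⟨_, fF_smooth.mul fG_smooth⟩ hp d).differentiableAt).const_mul 2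
  set num : ℝ → ℝ := fun s => ((p.1 + s * d.1)^2 - 1) * (u + s * d3)^2 + (1 - (p.2 + s * d.2)^2) * (v + s * d4)^2
    - ((TT b).1 (p + s • d) + l^2 * (T2f e a).1 (p + s • d)) with hnum
  set den : ℝ → ℝ := fun s => 2 * (fF (p + s • d) * fG (p + s • d)) with hden
  have hn := ((((hx.fun_pow 2).sub_const 1).fun_mul (hu.fun_pow 2)).fun_add (((hy.fun_pow 2).const_sub 1).fun_mul (hv.fun_pow 2))).fun_sub
    (((TT b).line hp d).fun_add (((T2f e a).line hp d).const_mul (l^2)))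
  change HasDerivAt num _ 0 at hn
  have n0 : num 0 = 0 := by
    simp only [hnum, zero_mul, add_zero, zero_smul]; rw [hon]; ring
  have den0 : den 0 = 2 * (fF p * fG p) := by simp [hden]
  have hne : den 0 ≠ 0 := by
    rw [den0]; have := fF_pos hp; have := fG_pos hp; positivity
  have hq := (hn.fun_div hFG.hasDerivAt hne).const_add (l^2 * e)
  have hev : (fun s : ℝ => Ham (zpt p u v (l * a) b + s • vec d d3 d4)) =ᶠ[nhds 0] fun s => l^2 * e + num s / den s := by
    filter_upwards [line_mem isOpen_U2 hp d] with s hs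
    rw [zpt_line, Ham_eq hs]
    rfl
  have := (hq.congr_of_eventuallyEq hev).unique h1
  rw [← this, ← den0]
  simp only [zero_mul, add_zero]
  rw [n0, zero_mul, sub_zero]
  have hD : ∀ A D : ℝ, D ≠ 0 → D * (A * D / D^2) = A := fun A D h => by field_simp
  rw [hD _ _ hne]
  push_cast
  ring

/-- representation as polynomial with index set of exponents -/
def Irep (I : PhasePt → ℝ) (S : Finset (ℕ × ℕ × ℕ × ℕ)) (g : ℕ × ℕ × ℕ × ℕ → SmU) : Prop :=
  ∀ p ∈ U2, ∀ u v a b : ℝ, I (zpt p u v a b) =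
    ∑ s ∈ S, (g s).1 p * u^s.1 * v^s.2.1 * (a^s.2.2.1 * b^s.2.2.2)

theorem I_line (I : PhasePt → ℝ) (S g) (hI : Irep I S g) (hd : ∀ z ∈ TStar, DifferentiableAt ℝ I z)
    {p : ℝ × ℝ} (hp : p ∈ U2) (u v a b : ℝ) (d : ℝ × ℝ) (d3 d4 : ℝ) :
    fderiv ℝ I (zpt p u v a b) (vec d d3 d4) =
     ∑ s ∈ S, ((d.1 * ((g s).pd (1,0)).1 p + d.2 * ((g s).pd (0,1)).1 p) * u^s.1 * v^s.2.1
       + (g s).1 p * (s.1 * u^(s.1-1) * v^s.2.1 * d3 + s.2.1 * u^s.1 * v^(s.2.1-1) * d4)) * (a^s.2.2.1 * b^s.2.2.2) := by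
  have h1 := line_deriv I (zpt p u v a b) (vec d d3 d4) (hd _ (zpt_mem hp _ _ _ _))
  have hu := lin_line u d3
  have hv := lin_line v d4
  have h2 : HasDerivAt (fun t : ℝ => ∑ s ∈ S, (g s).1 (p + t • d) * (u + t * d3)^s.1 * (v + t * d4)^s.2.1 * (a^s.2.2.1 * b^s.2.2.2)) _ 0 :=
    HasDerivAt.fun_sum fun s _ => ((((g s).line hp d).fun_mul (hu.fun_pow s.1)).fun_mul (hv.fun_pow s.2.1)).mul_const (a^s.2.2.1 * b^s.2.2.2)
  have hev : (fun t : ℝ => I (zpt p u v a b + t • vec d d3 d4)) =ᶠ[nhds 0] fun t : ℝ => ∑ s ∈ S, (g s).1 (p + t • d) * (u + t * d3)^s.1 * (v + t * d4)^s.2.1 * (a^s.2.2.1 * b^s.2.2.2) := by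
    filter_upwards [line_mem isOpen_U2 hp d] with s hs
    rw [zpt_line, hI _ hs]
  have := (h2.congr_of_eventuallyEq hev).unique h1
  rw [← this]
  refine Finset.sum_congr rfl fun s _ => ?_
  simp only [zero_mul, add_zero, zero_smul]
  ring

theorem I_brk (I : PhasePt → ℝ) (S g) (hI : Irep I S g) (hd : ∀ z ∈ TStar, DifferentiableAt ℝ I z)
    (hH : ∀ z ∈ TStar, pois Ham I z = 0) (h2 : ∀ z ∈ TStar, pd 2 I z = 0 ∧ pd 3 I z = 0 ∧ pd 2 Ham z = 0 ∧ pd 3 Ham z = 0)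
    (a b e : ℝ) (p : ℝ × ℝ) (hp : p ∈ U2) (u v l : ℝ)
    (hon : (p.1^2 - 1) * u^2 + (1 - p.2^2) * v^2 = (TT b).1 p + l^2 * (T2f e a).1 p) :
    ∑ s ∈ S, brk (TT b) (T2f e a) (g s) s.1 s.2.1 p u v l * (l^s.2.2.1 * (a^s.2.2.1 * b^s.2.2.2)) = 0 := by
  set z := zpt p u v (l * a) b with hz
  have hm : z ∈ TStar := zpt_mem hp _ _ _ _
  obtain ⟨c1, c2, c3, c4⟩ := h2 z hm
  have hb := hH z hm
  rw [pois, c1, c2, c3, c4] at hb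
  have L := Ham_line hp u v a b e l hon
  have K := I_line I S g hI hd hp u v (l * a) b
  have L0 := L (1,0) 0 0
  have L1 := L (0,1) 0 0
  have L4 := L (0,0) 1 0
  have L5 := L (0,0) 0 1
  rw [fd_vec] at L0 L1 L4 L5
  simp only [← hz] at L0 L1 L4 L5
  simp only [one_mul, zero_mul, mul_zero, mul_one, add_zero, zero_add, sub_zero, zero_sub] at L0 L1 L4 L5
  have KK := K (2 * (p.1^2-1) * u, 2 * (1 - p.2^2) * v)
    ((((TT b).pd (1,0)).1 p + l^2 * ((T2f e a).pd (1,0)).1 p - 2 * p.1 * u^2))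
    ((((TT b).pd (0,1)).1 p + l^2 * ((T2f e a).pd (0,1)).1 p + 2 * p.2 * v^2))
  rw [← hz] at KK
  refine Eq.trans (Finset.sum_congr rfl fun s _ => ?_) (KK.symm.trans ?_)
  · rw [mul_pow, brk]; ring
  rw [fd_vec]
  unfold pd at hb
  simp only
  linear_combination (-2 * (fF p * fG p)) * hb + fderiv ℝ I z (Pi.single 4 1) * L0 + fderiv ℝ I z (Pi.single 5 1) * L1
    - fderiv ℝ I z (Pi.single 0 1) * L4 - fderiv ℝ I z (Pi.single 1 1) * L5
end ZV

namespace ZV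
open scoped ContDiff
open TopologicalSpace

/-- inverse coordinate change -/
def winv (q : ℝ × ℝ) : ℂ :=
  ⟨√((q.1 + √(q.1^2 - 1)) * (1 + q.2) / 2), √((q.1 + √(q.1^2 - 1)) * (1 - q.2) / 2)⟩

theorem winv_cont : Continuous winv := by
  have h : winv = fun q : ℝ × ℝ => ((√((q.1 + √(q.1^2 - 1)) * (1 + q.2) / 2) : ℝ) : ℂ) + ((√((q.1 + √(q.1^2 - 1)) * (1 - q.2) / 2) : ℝ) : ℂ) * Complex.I := by
    ext q
    apply Complex.ext <;> simp [winv]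
  rw [h]; fun_prop

theorem xyw_winv {q : ℝ × ℝ} (hq : q ∈ U2) : xyw (winv q) = q := by
  obtain ⟨h1, h2, h3, h4, h5⟩ := U2_pos hq
  obtain ⟨g1, g2, g3⟩ := hq
  set N := q.1 + √(q.1^2 - 1) with hN
  have hs := Real.sqrt_nonneg (q.1^2 - 1)
  have hs2 := Real.sq_sqrt h3.le
  have hN0 : 0 < N := by linarith
  have a1 : √(N * (1 + q.2) / 2)^2 = N * (1 + q.2) / 2 := Real.sq_sqrt (by have : 0 < 1 + q.2 := by linarith
                                                                           positivity)
  have a2 : √(N * (1 - q.2) / 2)^2 = N * (1 - q.2) / 2 := Real.sq_sqrt (by have : 0 < 1 - q.2 := by linarith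
                                                                           positivity)
  have hn : Complex.normSq (winv q) = N := by
    rw [Complex.normSq_apply]
    show √(N * (1 + q.2) / 2) * √(N * (1 + q.2) / 2) + √(N * (1 - q.2) / 2) * √(N * (1 - q.2) / 2) = N
    rw [← pow_two, ← pow_two, a1, a2]; ring
  have hd : (winv q).re^2 - (winv q).im^2 = N * q.2 := by
    show √(N * (1 + q.2) / 2)^2 - √(N * (1 - q.2) / 2)^2 = _
    rw [a1, a2]; ring
  have hi : N⁻¹ = q.1 - √(q.1^2 - 1) := by
    have h1 : N * (q.1 - √(q.1^2 - 1)) = 1 := by rw [hN]; linear_combination -hs2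
    exact (eq_inv_of_mul_eq_one_right h1).symm
  unfold xyw
  rw [hn, hd]
  ext
  · show (N + N⁻¹) / 2 = q.1
    rw [hi, hN]; ring
  · show N * q.2 * N⁻¹ = q.2
    field_simp

/-- good base points -/
def VV : Set (ℝ × ℝ) := U2 ∩ winv ⁻¹' Bx

theorem isOpen_VV : IsOpen VV := isOpen_U2.inter (Bx.isOpen.preimage winv_cont)

theorem VV_ne : ((289/200 + 200/289)/2, 0) ∈ VV := by
  constructor
  · show _ ∧ _ ∧ _
    norm_num
  · have h : √((((289/200 + 200/289)/2, 0) : ℝ × ℝ).1^2 - 1) = (289/200 - 200/289)/2 := by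
      rw [Real.sqrt_eq_iff_mul_self_eq] <;> norm_num
    show winv _ ∈ Bx
    rw [mem_Bx]
    unfold winv
    rw [h]
    simp only
    have e1 : √(((289/200 + 200/289)/2 + (289/200 - 200/289)/2) * (1 + 0) / 2) = (17/20 : ℝ) := by
      rw [Real.sqrt_eq_iff_mul_self_eq] <;> norm_num
    have e2 : √(((289/200 + 200/289)/2 + (289/200 - 200/289)/2) * (1 - 0) / 2) = (17/20 : ℝ) := by
      rw [Real.sqrt_eq_iff_mul_self_eq] <;> norm_num
    rw [e1, e2]; norm_num

theorem I_level (I : PhasePt → ℝ) (S g) (hI : Irep I S g) (hd : ∀ z ∈ TStar, DifferentiableAt ℝ I z)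
    (hH : ∀ z ∈ TStar, pois Ham I z = 0) (h2 : ∀ z ∈ TStar, pd 2 I z = 0 ∧ pd 3 I z = 0 ∧ pd 2 Ham z = 0 ∧ pd 3 Ham z = 0)
    (a b : ℝ) (hb : b ≠ 0) {p q : ℝ × ℝ} (hp : p ∈ VV) (hq : q ∈ VV) (u v u' v' : ℝ) (h0 : (u, v) ≠ 0) (h0' : (u', v') ≠ 0)
    (hh : Ham (zpt p u v a b) = Ham (zpt q u' v' a b)) : I (zpt p u v a b) = I (zpt q u' v' a b) := by
  set e := Ham (zpt p u v a b) with he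
  obtain ⟨c, hc⟩ := local_const S b hb (T2f e a) g (fun s => s.1) (fun s => s.2.1) (fun s => s.2.2.1)
    (fun s => a^s.2.2.1 * b^s.2.2.2) (fun p hp u v l hon => I_brk I S g hI hd hH h2 a b e p hp u v l hon)
  have key : ∀ {p : ℝ × ℝ} (_ : p ∈ VV) (u v : ℝ) (_ : (u, v) ≠ 0) (_ : Ham (zpt p u v a b) = e), I (zpt p u v a b) = c := by
    intro p hp u v h0 hE
    have hx := xyw_winv hp.1
    have h := hc (winv p) hp.2 u v h0
    rw [hx] at h
    rw [hI p hp.1]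
    apply h
    have h3 := Ham_eq hp.1 u v a b e 1
    rw [one_mul, hE, one_pow, one_mul, one_mul] at h3
    have hF := fF_pos hp.1
    have hG := fG_pos hp.1
    have h4 : ((p.1^2 - 1) * u^2 + (1 - p.2^2) * v^2 - ((TT b).1 p + (T2f e a).1 p)) / (2 * (fF p * fG p)) = 0 := by linarith
    have h5 := (div_eq_zero_iff.mp h4).resolve_right (by positivity)
    linarith
  rw [key hp u v h0 he.symm, key hq u' v' h0' hh.symm]

/-- main local step -/
theorem I_dep (I : PhasePt → ℝ) (S g) (hI : Irep I S g) (hd : ∀ z ∈ TStar, DifferentiableAt ℝ I z)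
    (hH : ∀ z ∈ TStar, pois Ham I z = 0) (h2 : ∀ z ∈ TStar, pd 2 I z = 0 ∧ pd 3 I z = 0 ∧ pd 2 Ham z = 0 ∧ pd 3 Ham z = 0)
    (z : PhasePt) (hz : (z 0, z 1) ∈ VV) (hb : z 7 ≠ 0) (h4 : z 4 ≠ 0) :
    ∃ c : ℝ, ∀ d d3 d4, fderiv ℝ I z (vec d d3 d4) = c * fderiv ℝ Ham z (vec d d3 d4) := by
  have hzT : z ∈ TStar := hz.1
  set p : ℝ × ℝ := (z 0, z 1) with hp
  set u := z 4
  set v := z 5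
  set a := z 6
  set b := z 7
  obtain ⟨q1, q2, q3, q4, q5⟩ := U2_pos hz.1
  have hF := fF_pos hz.1
  have hG := fG_pos hz.1
  set k := (p.1^2 - 1) * u^2 + (1 - p.2^2) * v^2 with hk
  have k0 : 0 < k := by positivity
  set e0 := Ham z with he0
  have cI := cyclic I hd (fun z hz => (h2 z hz).1) (fun z hz => (h2 z hz).2.1)
  have cH := cyclic Ham (fun z hz => Ham_diff hz) (fun z hz => (h2 z hz).2.2.1) (fun z hz => (h2 z hz).2.2.2)
  have hzH : e0 = Ham (zpt p u v a b) := cH z hzT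
  set τ : ℝ → ℝ := fun e => √(1 + 2 * (fF p * fG p) * (e - e0) / k) with hτ
  set ψ : ℝ → ℝ := fun e => I (zpt p 0 0 a b + τ e • zpt 0 u v 0 0) with hψ
  have zτ : ∀ t : ℝ, zpt p 0 0 a b + t • zpt 0 u v 0 0 = zpt p (t * u) (t * v) a b := by
    intro t
    ext i
    fin_cases i <;> simp [zpt]
  have τ0 : τ e0 = 1 := by simp [hτ]
  have τd : DifferentiableAt ℝ τ e0 := by
    apply DifferentiableAt.sqrt
    · fun_prop
    · simp
  have ψd : DifferentiableAt ℝ ψ e0 := by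
    have h1 : DifferentiableAt ℝ (fun e => zpt p 0 0 a b + τ e • zpt 0 u v 0 0) e0 :=
      (τd.smul_const _).const_add _
    refine DifferentiableAt.comp (g := I) e0 ?_ h1
    rw [zτ]; exact hd _ (zpt_mem hz.1 _ _ _ _)
  refine ⟨deriv ψ e0, fun d d3 d4 => ?_⟩
  have l1 := line_deriv I z (vec d d3 d4) (hd z hzT)
  have l2 := line_deriv Ham z (vec d d3 d4) (Ham_diff hzT)
  have ψd' : HasDerivAt ψ (deriv ψ e0) (Ham (z + (0:ℝ) • vec d d3 d4)) := by
    rw [zero_smul, add_zero]; exact ψd.hasDerivAt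
  have l3 : HasDerivAt (fun s : ℝ => ψ (Ham (z + s • vec d d3 d4))) (deriv ψ e0 * fderiv ℝ Ham z (vec d d3 d4)) 0 :=
    HasDerivAt.comp (h₂ := ψ) (h := fun s : ℝ => Ham (z + s • vec d d3 d4)) (0:ℝ) ψd' l2
  have hzl : ∀ s : ℝ, p + s • d ∈ U2 → z + s • vec d d3 d4 ∈ TStar ∧
      zpt ((z + s • vec d d3 d4) 0, (z + s • vec d d3 d4) 1) ((z + s • vec d d3 d4) 4) ((z + s • vec d d3 d4) 5)
        ((z + s • vec d d3 d4) 6) ((z + s • vec d d3 d4) 7) = zpt (p + s • d) (u + s * d3) (v + s * d4) a b := by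
    intro s hs
    refine ⟨hs, ?_⟩
    ext i
    fin_cases i <;> simp [zpt, vec, hp, u, v, a, b]
  have hev : (fun s : ℝ => I (z + s • vec d d3 d4)) =ᶠ[nhds 0] fun s : ℝ => ψ (Ham (z + s • vec d d3 d4)) := by
    have c1 : ∀ᶠ s in nhds (0:ℝ), u + s * d3 ≠ 0 := by
      have : ContinuousAt (fun s : ℝ => u + s * d3) 0 := by fun_prop
      exact this.eventually_ne (by simpa using h4)
    have c2 : ∀ᶠ s in nhds (0:ℝ), 0 < 1 + 2 * (fF p * fG p) * (Ham (z + s • vec d d3 d4) - e0) / k := by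
      have hc : ContinuousAt (fun s : ℝ => 1 + 2 * (fF p * fG p) * (Ham (z + s • vec d d3 d4) - e0) / k) 0 := by
        have := l2.continuousAt
        fun_prop
      refine hc.eventually_const_lt ?_
      simp [he0]
    filter_upwards [line_mem isOpen_VV hz d, c1, c2] with s hs hs1 hs2
    obtain ⟨m1, m2⟩ := hzl s hs.1
    rw [cI _ m1, m2]
    set e := Ham (z + s • vec d d3 d4) with he
    have hH' : e = Ham (zpt (p + s • d) (u + s * d3) (v + s * d4) a b) := by rw [he, cH _ m1, m2]
    show _ = I (zpt p 0 0 a b + τ e • zpt 0 u v 0 0)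
    rw [zτ]
    have τp : 0 < τ e := Real.sqrt_pos.mpr hs2
    have τs : τ e^2 = 1 + 2 * (fF p * fG p) * (e - e0) / k := Real.sq_sqrt hs2.le
    refine I_level I S g hI hd hH h2 a b hb hs hz _ _ _ _ ?_ ?_ ?_
    · intro h; exact hs1 (congrArg Prod.fst h)
    · intro h; exact mul_ne_zero τp.ne' h4 (congrArg Prod.fst h)
    · rw [← hH']
      have r1 := Ham_eq hz.1 u v a b 0 1
      have r2 := Ham_eq hz.1 (τ e * u) (τ e * v) a b 0 1
      rw [one_mul] at r1 r2
      rw [← hzH] at r1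
      have r3 : (p.1^2 - 1) * (τ e * u)^2 + (1 - p.2^2) * (τ e * v)^2 = k + 2 * (fF p * fG p) * (e - e0) := by
        have : (p.1^2 - 1) * (τ e * u)^2 + (1 - p.2^2) * (τ e * v)^2 = τ e^2 * k := by rw [hk]; ring
        rw [this, τs]; field_simp
      rw [r2, r3]
      rw [← hk] at r1
      field_simp at r1 ⊢
      linear_combination r1
  exact l1.unique (l3.congr_of_eventuallyEq hev)
end ZV

namespace ZV
open scoped ContDiff
open TopologicalSpace

/-- embedding of the two-dimensional base -/
def emb (p : ℝ × ℝ) : Fin 4 → ℝ := ![p.1, p.2, 0, 0]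

theorem emb_smooth : ContDiff ℝ ∞ emb := by
  rw [contDiff_pi]
  intro i
  fin_cases i
  · exact contDiff_fst
  · exact contDiff_snd
  · exact contDiff_const
  · exact contDiff_const

theorem base_zpt (p : ℝ × ℝ) (u v a b : ℝ) : basePt (zpt p u v a b) = emb p := by
  ext i
  fin_cases i <;> rfl

theorem exists_rep (I : PhasePt → ℝ) (h : IsPolyMom 7 I) : ∃ S g, Irep I S g := by
  obtain ⟨c, hc, hI⟩ := h
  have sm : ∀ s : ℕ × ℕ × ℕ × ℕ, ContDiffOn ℝ ∞ (fun p : ℝ × ℝ =>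
      if s.1 + s.2.1 + s.2.2.1 + s.2.2.2 ≤ 7 then c s.1 s.2.1 s.2.2.1 s.2.2.2 (emb p) else 0) U2 := by
    intro s
    split_ifs
    · exact (hc s.1 s.2.1 s.2.2.1 s.2.2.2).comp emb_smooth.contDiffOn (fun p hp => hp)
    · exact contDiffOn_const
  refine ⟨range 8 ×ˢ (range 8 ×ˢ (range 8 ×ˢ range 8)), fun s => ⟨_, sm s⟩, ?_⟩
  intro p hp u v a b
  rw [hI _ (zpt_mem hp u v a b), base_zpt]
  rw [Finset.sum_product]
  refine Finset.sum_congr rfl fun i _ => ?_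
  rw [Finset.sum_product]
  refine Finset.sum_congr rfl fun j _ => ?_
  rw [Finset.sum_product]
  refine Finset.sum_congr rfl fun k _ => ?_
  refine Finset.sum_congr rfl fun m _ => ?_
  show (if i + j + k + m ≤ 7 then c i j k m (emb p) * u^i * v^j * a^k * b^m else 0) =
    (if i + j + k + m ≤ 7 then c i j k m (emb p) else 0) * u^i * v^j * (a^k * b^m)
  split_ifs <;> ring

theorem final (I : PhasePt → ℝ) (hs : ContDiffOn ℝ (⊤ : ℕ∞) I TStar) (hp : IsPolyMom 7 I)
    (hc : ∀ z ∈ TStar,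
        pois Ham Pphi z = 0 ∧ pois Ham Ptm z = 0 ∧ pois Pphi Ptm z = 0 ∧
        pois Ham I z = 0 ∧ pois Pphi I z = 0 ∧ pois Ptm I z = 0)
    (hF : FunIndep Ham Pphi Ptm I) : False := by
  obtain ⟨S, g, hI⟩ := exists_rep I hp
  have hd : ∀ z ∈ TStar, DifferentiableAt ℝ I z := fun z hz =>
    (hs.contDiffAt (isOpen_TStar.mem_nhds hz)).differentiableAt (by simp)
  have hH : ∀ z ∈ TStar, pois Ham I z = 0 := fun z hz => (hc z hz).2.2.2.1
  have h2 : ∀ z ∈ TStar, pd 2 I z = 0 ∧ pd 3 I z = 0 ∧ pd 2 Ham z = 0 ∧ pd 3 Ham z = 0 := by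
    intro z hz
    obtain ⟨a1, a2, -, -, a5, a6⟩ := hc z hz
    rw [(pois_Pphi _ z).2] at a1
    rw [(pois_Ptm _ z).2] at a2
    rw [(pois_Pphi _ z).1] at a5
    rw [(pois_Ptm _ z).1] at a6
    exact ⟨neg_eq_zero.mp a5, neg_eq_zero.mp a6, a1, a2⟩
  obtain ⟨S0, hS1, hS2, hS3⟩ := hF
  have hW : IsOpen {z : PhasePt | (z 0, z 1) ∈ VV ∧ z 7 ≠ 0 ∧ z 4 ≠ 0} := by
    refine (isOpen_VV.preimage (f := fun z : PhasePt => (z 0, z 1)) (by fun_prop)).inter (IsOpen.inter ?_ ?_)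
    · exact isOpen_ne_fun (continuous_apply 7) continuous_const
    · exact isOpen_ne_fun (continuous_apply 4) continuous_const
  obtain ⟨z, ⟨hz1, hz2, hz3⟩, hzS⟩ := mem_closure_iff.mp (hS2 (zpt_mem VV_ne.1 1 0 0 1)) _ hW
    ⟨VV_ne, one_ne_zero, one_ne_zero⟩
  have hzT := hS1 hzS
  have li := hS3 z hzS
  obtain ⟨c, hcd⟩ := I_dep I S g hI hd hH h2 z hz1 hz2 hz3
  obtain ⟨b1, b2, b3, b4⟩ := h2 z hzT
  simp only [pd] at b1 b2 b3 b4
  set L := fderiv ℝ I z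
  set M := fderiv ℝ Ham z
  rw [Fintype.linearIndependent_iff] at li
  have key := li ![c, L (Pi.single 6 1) - c * M (Pi.single 6 1), L (Pi.single 7 1) - c * M (Pi.single 7 1), -1] ?_ 3
  · simp at key
  · rw [Fin.sum_univ_four]
    simp only [fd_Pphi, fd_Ptm]
    have e0 := hcd (1, 0) 0 0
    have e1 := hcd (0, 1) 0 0
    have e4 := hcd 0 1 0
    have e5 := hcd 0 0 1
    simp only [fd_vec, Prod.fst_zero, Prod.snd_zero, zero_mul, one_mul, add_zero, zero_add] at e0 e1 e4 e5
    have ext8 : ∀ K : PhasePt →L[ℝ] ℝ, (∀ i, K (Pi.single i 1) = 0) → K = 0 := by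
      intro K hK
      ext w
      have : w = ∑ i, w i • (Pi.single i (1:ℝ) : PhasePt) := by
        ext j
        simp [Finset.sum_apply, Pi.single_apply]
      rw [this, map_sum]
      simp [hK]
    apply ext8
    intro i
    fin_cases i
    · simp [e0]
    · simp [e1]
    · simp [b1, b3]
    · simp [b2, b4]
    · simp [e4]
    · simp [e5]
    · simp
    · simp

end ZV

/-- there is no smooth integral polynomial in momenta of degree ≤ 7 that is
functionally independent of `H, p_φ, p_t` and Poisson-commutes with them. -/
theorem no_nontrivial_integral_degree_le_seven :
    ¬ ∃ I : PhasePt → ℝ, ContDiffOn ℝ (⊤ : ℕ∞) I TStar ∧ IsPolyMom 7 I ∧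
      (∀ z ∈ TStar,
        pois Ham Pphi z = 0 ∧ pois Ham Ptm z = 0 ∧ pois Pphi Ptm z = 0 ∧
        pois Ham I z = 0 ∧ pois Pphi I z = 0 ∧ pois Ptm I z = 0) ∧
      FunIndep Ham Pphi Ptm I := by
  rintro ⟨I, h1, h2, h3, h4⟩
  exact ZV.final I h1 h2 h3 h4

end
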